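/- arXiv:1208.5120 — 2 statements merged into one kernel-verified Lean document; each statement's English description precedes it below -/
import Mathlib

section
/- Let A be an AW*-algebra and let {e₁, …, e_n} and {f₁, …, f_n} be two finite orthogonal families of projections in A, each summing to 1, with e₁ ∼ ⋯ ∼ e_n and f₁ ∼ ⋯ ∼ f_n. Then e_j ∼ f_j for each j = 1, …, n. -/
universe u

section Defs

variable {R : Type u} [Ring R] [StarRing R]

/-- An element is a projection if it is self-adjoint and idempotent. -/
def IsProjection (p : R) : Prop := star p = p ∧ p * p = p

/-- Order on projections: `e ≤ f` iff `e = ef`. -/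
def ProjLE (e f : R) : Prop := e * f = e

/-- Murray–von Neumann equivalence of projections. -/
def ProjEquiv (e f : R) : Prop := ∃ v : R, star v * v = e ∧ v * star v = f

/-- `e ≼ f` : `e` is equivalent to a subprojection of `f`. -/
def ProjSubEquiv (e f : R) : Prop :=
  ∃ e' : R, IsProjection e' ∧ ProjLE e' f ∧ ProjEquiv e e'

/-- `e ≺ f` : `e ≼ f` but `e` is not equivalent to `f` (with the convention `0 ≺ 0`). -/
def ProjLT (e f : R) : Prop :=
  (ProjSubEquiv e f ∧ ¬ ProjEquiv e f) ∨ (e = 0 ∧ f = 0)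

/-- A central projection. -/
def IsCentralProj (z : R) : Prop := IsProjection z ∧ ∀ a : R, z * a = a * z

/-- `c` is the central cover of `e`: the least central projection above `e`. -/
def IsCentralCover (e c : R) : Prop :=
  IsCentralProj c ∧ ProjLE e c ∧
    ∀ z : R, IsCentralProj z → ProjLE e z → ProjLE c z

/-- A projection `e` is finite if `e ∼ f ≤ e` implies `f = e`. -/
def ProjFinite (e : R) : Prop :=
  ∀ f : R, IsProjection f → ProjEquiv e f → ProjLE f e → f = e

/-- A nonzero projection is properly infinite if `ze` is infinite
for every central projection `z` with `ze ≠ 0`. -/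
def ProperlyInfinite (e : R) : Prop :=
  IsProjection e ∧ e ≠ 0 ∧
    ∀ z : R, IsCentralProj z → z * e ≠ 0 → ¬ ProjFinite (z * e)

/-- A pairwise orthogonal family of elements. -/
def PairwiseOrthogonal {ι : Type*} (p : ι → R) : Prop :=
  ∀ i j, i ≠ j → p i * p j = 0

/-- `s` is the supremum of the family `p` in the projection order. For an
orthogonal family, this is the sum `Σ pᵢ`. -/
def IsSupProj {ι : Type*} (p : ι → R) (s : R) : Prop :=
  IsProjection s ∧ (∀ i, ProjLE (p i) s) ∧
    ∀ t : R, IsProjection t → (∀ i, ProjLE (p i) t) → ProjLE s t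

/-- The family `p` belongs to `Γ(e)`: an orthogonal family of projections,
each equivalent to `e`, with sum (supremum) `e`. -/
def InGamma (e : R) {ι : Type u} (p : ι → R) : Prop :=
  (∀ i, IsProjection (p i)) ∧ PairwiseOrthogonal p ∧
    (∀ i, ProjEquiv (p i) e) ∧ IsSupProj p e

open Classical in
/-- The dimension `d(e)` of a properly infinite projection: the least cardinal
strictly greater than the cardinality of the index set of every family in
`Γ(e)`, with the convention `d(0) = 0`. -/
noncomputable def projDim (e : R) : Cardinal.{u} :=
  if e = 0 then 0
  else sSup {c : Cardinal.{u} |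
    ∃ (ι : Type u) (p : ι → R), InGamma e p ∧ c = Order.succ (Cardinal.mk ι)}

/-- A properly infinite projection `e` is equidimensional if `d(ze) = d(e)`
for every central projection `z` with `ze ≠ 0` (equivalently, for every
nonzero central projection `z ≤ c(e)`). -/
def Equidimensional (e : R) : Prop :=
  ProperlyInfinite e ∧
    ∀ z : R, IsCentralProj z → z * e ≠ 0 → projDim (z * e) = projDim e

/-- An abelian projection: the corner `eRe` is commutative. -/
def IsAbelianProj (e : R) : Prop :=
  IsProjection e ∧ ∀ a b : R, (e * a * e) * (e * b * e) = (e * b * e) * (e * a * e)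

/-- `j` is the join `e ∨ f` in the projection lattice. -/
def IsJoinProj (e f j : R) : Prop :=
  IsProjection j ∧ ProjLE e j ∧ ProjLE f j ∧
    ∀ t : R, IsProjection t → ProjLE e t → ProjLE f t → ProjLE j t

end Defs

/-- The AW*-condition: the right annihilator of any subset is generated by a
projection: `{a | ∀ s ∈ S, s a = 0} = pR`. -/
def IsAWStarRing (R : Type*) [Ring R] [StarRing R] : Prop :=
  ∀ S : Set R, ∃ p : R, IsProjection p ∧
    {a : R | ∀ s ∈ S, s * a = 0} = {a : R | ∃ b : R, a = p * b}

/-- A maximal abelian (*-sub)algebra. -/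
def IsMaximalAbelian {A : Type*} [Ring A] [StarRing A] [Algebra ℂ A] [StarModule ℂ A]
    (M : StarSubalgebra ℂ A) : Prop :=
  (∀ x ∈ M, ∀ y ∈ M, x * y = y * x) ∧
    ∀ N : StarSubalgebra ℂ A, (∀ x ∈ N, ∀ y ∈ N, x * y = y * x) → M ≤ N → M = N


namespace AWS

variable {A : Type u} [CStarAlgebra A]

theorem ra {a b c : A} (h : a * b = c) (x : A) : a * (b * x) = c * x := by
  rw [← mul_assoc, h]

theorem ssz {x : A} (h : star x * x = 0) : x = 0 :=
  (CStarRing.star_mul_self_eq_zero_iff x).1 h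

theorem proj_sub {e : A} (he : IsProjection e) : IsProjection (1 - e) := by
  refine ⟨by simp [he.1], ?_⟩
  simp [mul_sub, sub_mul, he.2]

theorem star_eq {a b c : A} (h : a * b = c) : star b * star a = star c := by
  rw [← h, star_mul]

theorem le_symm {e f : A} (he : IsProjection e) (hf : IsProjection f) (h : e * f = e) :
    f * e = e := by
  simpa [he.1, hf.1] using star_eq h

theorem orth_symm {e f : A} (he : IsProjection e) (hf : IsProjection f) (h : e * f = 0) :
    f * e = 0 := by
  simpa [he.1, hf.1] using star_eq h

theorem proj_diff {e f : A} (he : IsProjection e) (hf : IsProjection f) (h : e * f = e) :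
    IsProjection (f - e) := by
  refine ⟨by simp [he.1, hf.1], ?_⟩
  simp [mul_sub, sub_mul, he.2, hf.2, h, le_symm he hf h]

theorem proj_add {e f : A} (he : IsProjection e) (hf : IsProjection f) (h : e * f = 0) :
    IsProjection (e + f) := by
  refine ⟨by simp [he.1, hf.1], ?_⟩
  simp [mul_add, add_mul, he.2, hf.2, h, orth_symm he hf h]

theorem proj_mul {e f : A} (he : IsProjection e) (hf : IsProjection f) (h : e * f = f * e) :
    IsProjection (e * f) := by
  refine ⟨by simp [he.1, hf.1, h], ?_⟩
  rw [mul_assoc, ← mul_assoc f, ← h, mul_assoc e f f, hf.2, ← mul_assoc, he.2]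

theorem pi_right {v e : A} (he : IsProjection e) (h : star v * v = e) : v * e = v := by
  have : v * e - v = 0 := by
    apply ssz
    simp only [star_sub, star_mul, he.1, mul_sub, sub_mul, mul_assoc, ra h, h, he.2, sub_self]
  exact sub_eq_zero.1 this

theorem pi_range {v e : A} (he : IsProjection e) (h : star v * v = e) :
    IsProjection (v * star v) := by
  refine ⟨by simp, ?_⟩
  rw [mul_assoc, ra h, ← mul_assoc, pi_right he h]

theorem pi_left {v f : A} (hf : IsProjection f) (h : v * star v = f) : f * v = v := by
  have := pi_right (v := star v) hf (by simpa using h)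
  simpa [hf.1] using congrArg star this

/-- Subequivalence, in terms of partial isometries. -/
def Sub (e f : A) : Prop := ∃ v : A, star v * v = e ∧ f * v = v

theorem pe_symm {e f : A} (h : ProjEquiv e f) : ProjEquiv f e := by
  obtain ⟨v, h1, h2⟩ := h
  exact ⟨star v, by simpa using h2, by simpa using h1⟩

theorem pe_refl {e : A} (h : IsProjection e) : ProjEquiv e e :=
  ⟨e, by rw [h.1, h.2], by rw [h.1, h.2]⟩

theorem pe_trans {e f g : A} (hf : IsProjection f)
    (h : ProjEquiv e f) (h' : ProjEquiv f g) : ProjEquiv e g := by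
  obtain ⟨v, h1, h2⟩ := h
  obtain ⟨w, h3, h4⟩ := h'
  refine ⟨w * v, ?_, ?_⟩
  · rw [star_mul, mul_assoc, ra h3, pi_left hf h2, h1]
  · rw [star_mul, mul_assoc, ra h2, ← mul_assoc, pi_right hf h3, h4]

theorem pe_add {e f e' f' : A} (he : IsProjection e) (hf : IsProjection f)
    (he' : IsProjection e') (hf' : IsProjection f')
    (h : ProjEquiv e f) (h' : ProjEquiv e' f') (hee : e * e' = 0) (hff : f * f' = 0) :
    ProjEquiv (e + e') (f + f') := by
  obtain ⟨v, h1, h2⟩ := h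
  obtain ⟨w, h3, h4⟩ := h'
  have a1 : star v * w = 0 := by
    rw [← pi_left hf h2, ← pi_left hf' h4, star_mul, hf.1, mul_assoc, ra hff]; simp
  have a2 : star w * v = 0 := by simpa using star_eq a1
  have a3 : v * star w = 0 := by
    rw [← pi_right he h1, ← pi_right he' h3, star_mul, he'.1, mul_assoc, ra hee]; simp
  have a4 : w * star v = 0 := by simpa using star_eq a3
  refine ⟨v + w, ?_, ?_⟩
  · simp [mul_add, add_mul, h1, h3, a1, a2]
  · simp [mul_add, add_mul, h2, h4, a3, a4]

theorem central_proj {h e : A} (hh : IsCentralProj h) (he : IsProjection e) :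
    IsProjection (h * e) := proj_mul hh.1 he (hh.2 e)

theorem central_compl {h : A} (hh : IsCentralProj h) : IsCentralProj (1 - h) :=
  ⟨proj_sub hh.1, fun a => by simp [mul_sub, sub_mul, hh.2 a]⟩

theorem pe_central {h e f : A} (hh : IsCentralProj h) (H : ProjEquiv e f) :
    ProjEquiv (h * e) (h * f) := by
  obtain ⟨v, h1, h2⟩ := H
  refine ⟨h * v, ?_, ?_⟩
  · rw [star_mul, hh.1.1, mul_assoc, ra hh.1.2, ← mul_assoc, ← hh.2, mul_assoc, h1]
  · rw [star_mul, hh.1.1, ← hh.2 (star v), mul_assoc, ← mul_assoc v, ← hh.2 v, mul_assoc, ra hh.1.2,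
      h2]

theorem sub_of_pe {e f : A} (hf : IsProjection f) (H : ProjEquiv e f) : Sub e f := by
  obtain ⟨v, h1, h2⟩ := H
  exact ⟨v, h1, pi_left hf h2⟩

theorem sub_of_le {e f : A} (he : IsProjection e) (H : f * e = e) : Sub e f :=
  ⟨e, by rw [he.1, he.2], H⟩

theorem sub_trans {e f g : A} (H : Sub e f) (H' : Sub f g) : Sub e g := by
  obtain ⟨v, h1, h2⟩ := H
  obtain ⟨w, h3, h4⟩ := H'
  refine ⟨w * v, ?_, ?_⟩
  · rw [star_mul, mul_assoc, ra h3, h2, h1]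
  · rw [ra h4]

theorem sub_central {h e f : A} (hh : IsCentralProj h) (H : Sub e f) :
    Sub (h * e) (h * f) := by
  obtain ⟨v, h1, h2⟩ := H
  refine ⟨h * v, ?_, ?_⟩
  · rw [star_mul, hh.1.1, mul_assoc, ra hh.1.2, ← mul_assoc, ← hh.2, mul_assoc, h1]
  · rw [mul_assoc, ← mul_assoc f, ← hh.2 f, mul_assoc, ra hh.1.2, h2]

theorem sub_add {e f e' f' : A} (hf : IsProjection f) (hf' : IsProjection f')
    (H : Sub e f) (H' : Sub e' f') (hff : f * f' = 0) : Sub (e + e') (f + f') := by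
  obtain ⟨v, h1, h2⟩ := H
  obtain ⟨w, h3, h4⟩ := H'
  have a1 : star v * w = 0 := by
    rw [← h2, ← h4, star_mul, hf.1, mul_assoc, ra hff]; simp
  have a2 : star w * v = 0 := by simpa using star_eq a1
  have a3 : f * w = 0 := by rw [← h4, ra hff, zero_mul]
  have a4 : f' * v = 0 := by rw [← h2, ra (orth_symm hf hf' hff), zero_mul]
  refine ⟨v + w, ?_, ?_⟩
  · simp [mul_add, add_mul, h1, h3, a1, a2]
  · simp [mul_add, add_mul, h2, h4, a3, a4]

/-- intertwiner gives equivalence -/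
theorem pe_of_intertwine {e f q U : A} (he : IsProjection e) (hf : IsProjection f)
    (h1 : star U * U = q) (h2 : U * star U = q) (h : e * U = U * f) :
    ProjEquiv (q * f) (q * e) ∧ q * f = f * q ∧ q * e = e * q := by
  have h' : star U * e = f * star U := by simpa [he.1, hf.1] using star_eq h
  have c2 : q * e = e * q := by
    rw [← h2, mul_assoc, h', ← mul_assoc, ← h, mul_assoc]
  have c1 : q * f = f * q := by
    rw [← h1, mul_assoc, ← h, ← mul_assoc, h', mul_assoc]
  refine ⟨⟨e * U, ?_, ?_⟩, c1, c2⟩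
  · rw [star_mul, he.1, mul_assoc, ra he.2, h, ← mul_assoc, h1]
  · rw [star_mul, he.1, mul_assoc, ra h2, c2, ra he.2]

/-- Right projections. -/
theorem exists_rp (hAW : IsAWStarRing A) (S : Set A) :
    ∃ P : A, IsProjection P ∧ ∀ x, (∀ s ∈ S, s * x = 0) ↔ P * x = 0 := by
  obtain ⟨p, hp, H⟩ := hAW S
  refine ⟨1 - p, proj_sub hp, fun x => ?_⟩
  have : (∀ s ∈ S, s * x = 0) ↔ ∃ b : A, x = p * b := by
    have := Set.ext_iff.1 H x
    simpa using this
  rw [this]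
  constructor
  · rintro ⟨b, rfl⟩
    rw [← mul_assoc, sub_mul, hp.2]; simp
  · intro h
    exact ⟨x, by rw [sub_mul, one_mul, sub_eq_zero] at h; exact h⟩

theorem rp_mul {S : Set A} {P : A} (hP : IsProjection P)
    (H : ∀ x, (∀ s ∈ S, s * x = 0) ↔ P * x = 0) {s : A} (hs : s ∈ S) : s * P = s := by
  have := (H (1 - P)).2 (by simp [mul_sub, hP.2]) s hs
  rw [mul_sub, mul_one, sub_eq_zero] at this
  exact this.symm

end AWS

set_option linter.unusedSimpArgs false

namespace AWS

variable {A : Type u} [CStarAlgebra A]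

/-- the cut function `(t-δ)₊` -/
noncomputable def C (δ : ℝ) (a : A) : A := cfc (fun t : ℝ => max (t - δ) 0) a

noncomputable def K (δ : ℝ) (a : A) : A := cfc (fun t : ℝ => (Real.sqrt (max t δ))⁻¹) a

noncomputable def K' (a : A) : A := cfc (fun t : ℝ => (Real.sqrt (max (1 - t) (1/2)))⁻¹) a

theorem star_C (δ : ℝ) (a : A) : star (C δ a) = C δ a :=
  (cfc_predicate (R := ℝ) (p := IsSelfAdjoint) _ a)

theorem star_K (δ : ℝ) (a : A) : star (K δ a) = K δ a :=
  (cfc_predicate (R := ℝ) (p := IsSelfAdjoint) _ a)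

theorem star_K' (a : A) : star (K' a) = K' a :=
  (cfc_predicate (R := ℝ) (p := IsSelfAdjoint) _ a)

theorem cont_k {δ : ℝ} (hδ : 0 < δ) : Continuous (fun t : ℝ => (Real.sqrt (max t δ))⁻¹) := by
  apply Continuous.inv₀ (by fun_prop)
  intro t
  exact (Real.sqrt_pos.2 (lt_max_of_lt_right hδ)).ne'

theorem C_eq {δ : ℝ} (hδ : 0 < δ) {a : A} (ha : IsSelfAdjoint a) :
    ∃ d : A, C δ a = d * a := by
  have hc : Continuous (fun t : ℝ => max (t - δ) 0 / max t δ) := by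
    apply Continuous.div (by fun_prop) (by fun_prop)
    intro t
    exact (lt_max_of_lt_right hδ).ne'
  refine ⟨cfc (fun t : ℝ => max (t - δ) 0 / max t δ) a, ?_⟩
  have hm := cfc_mul _ (fun t : ℝ => t) a hc.continuousOn (by fun_prop)
  rw [cfc_id' ℝ a ha] at hm
  rw [C, ← hm]
  apply cfc_congr
  intro t _
  rcases le_total t δ with h | h
  · simp [h]
  · have : t ≠ 0 := by linarith
    simp only [max_eq_left h, max_eq_left (sub_nonneg.2 h)]
    field_simp

theorem C_K {δ : ℝ} (hδ : 0 < δ) {a : A} (ha : IsSelfAdjoint a) :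
    C δ a * (K δ a * a * K δ a) = C δ a := by
  have hk := (cont_k hδ).continuousOn (s := spectrum ℝ a)
  have hk2 : ContinuousOn (fun t : ℝ => (Real.sqrt (max t δ))⁻¹ * t) (spectrum ℝ a) :=
    hk.mul (by fun_prop)
  have hk3 : ContinuousOn (fun t : ℝ => (Real.sqrt (max t δ))⁻¹ * t * (Real.sqrt (max t δ))⁻¹)
    (spectrum ℝ a) := hk2.mul hk
  have hm := cfc_mul _ (fun t : ℝ => t) a hk (by fun_prop)
  rw [cfc_id' ℝ a ha] at hm
  rw [C, K, ← hm, ← cfc_mul _ _ a hk2 hk, ← cfc_mul _ _ a (by fun_prop) hk3]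
  apply cfc_congr
  intro t _
  rcases le_total t δ with h | h
  · simp [h]
  · have : 0 < t := by linarith
    have h2 := Real.sqrt_pos.2 this
    have h3 := Real.mul_self_sqrt this.le
    simp only [max_eq_left h, max_eq_left (sub_nonneg.2 h)]
    have : (√t)⁻¹ * t * (√t)⁻¹ = 1 := by
      field_simp; nlinarith
    rw [this, mul_one]

theorem K'_C {a : A} (ha : IsSelfAdjoint a) :
    K' a * (1 - a) * K' a = 1 - (2:ℝ) • C (1/2) a := by
  have hk : ContinuousOn (fun t : ℝ => (Real.sqrt (max (1 - t) (1/2)))⁻¹) (spectrum ℝ a) :=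
    ((cont_k (δ := 1/2) (by norm_num)).comp (by fun_prop : Continuous fun t : ℝ => 1 - t)).continuousOn
  have hk2 : ContinuousOn (fun t : ℝ => (Real.sqrt (max (1 - t) (1/2)))⁻¹ * (1 - t))
    (spectrum ℝ a) := hk.mul (by fun_prop)
  have h1 : (1 - a) = cfc (fun t : ℝ => 1 - t) a := by
    rw [cfc_sub (fun _ => 1) (fun t => t) a, cfc_const_one ℝ a, cfc_id' ℝ a ha]
  rw [C, K', ← cfc_const_mul _ _ a (by fun_prop), ← cfc_const_one ℝ a]
  rw [cfc_const_one ℝ a, h1, ← cfc_mul _ _ a hk (by fun_prop),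
    ← cfc_mul _ _ a hk2 hk, ← cfc_const_one ℝ a,
    ← cfc_sub _ _ a (by fun_prop) (by fun_prop)]
  apply cfc_congr
  intro t _
  have key : ∀ r : ℝ, 0 < r → (√r)⁻¹ * (√r)⁻¹ = r⁻¹ := by
    intro r hr
    rw [← mul_inv, Real.mul_self_sqrt hr.le]
  have hpos : 0 < max (1 - t) (1/2) := lt_max_of_lt_right (by norm_num)
  have : (√(max (1 - t) (1/2)))⁻¹ * (1 - t) * (√(max (1 - t) (1/2)))⁻¹
      = (1 - t) * (max (1 - t) (1/2))⁻¹ := by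
    rw [← key _ hpos]; ring
  simp only [this]
  rcases le_total t (1/2) with h | h
  · rw [max_eq_left (by linarith : (1/2 : ℝ) ≤ 1 - t), max_eq_right (by linarith : t - 1/2 ≤ 0),
      mul_inv_cancel₀ (by linarith)]
    simp
  · rw [max_eq_right (by linarith : 1 - t ≤ (1/2 : ℝ)), max_eq_left (by linarith : 0 ≤ t - 1/2)]
    ring

theorem C_ne {x : A} (hx : x ≠ 0) : C (‖star x * x‖ / 2) (star x * x) ≠ 0 := by
  set a := star x * x with ha'
  have ha : IsSelfAdjoint a := IsSelfAdjoint.star_mul_self x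
  have hn : 0 < ‖a‖ := norm_pos_iff.2 (fun h => hx (ssz h))
  intro h
  have h1 : a = cfc (fun t : ℝ => t - max (t - ‖a‖/2) 0) a := by
    rw [cfc_sub _ _ a, cfc_id' ℝ a ha]
    change a = a - C (‖a‖/2) a
    rw [h, sub_zero]
  have h2 : ‖a‖ ≤ ‖a‖ / 2 := by
    conv_lhs => rw [h1]
    apply norm_cfc_le (by positivity)
    intro t ht
    have ht0 : 0 ≤ t := by
      let _ := CStarAlgebra.spectralOrder A
      let _ := CStarAlgebra.spectralOrderedRing A
      exact spectrum_nonneg_of_nonneg (star_mul_self_nonneg x) ht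
    rw [Real.norm_eq_abs, abs_le]
    rcases le_total t (‖a‖/2) with h | h
    · rw [max_eq_right (by linarith)]; constructor <;> linarith
    · rw [max_eq_left (by linarith)]; constructor <;> linarith
  linarith

/-- Partial comparability. -/
theorem pc (hAW : IsAWStarRing A) {e f x : A} (hx : x ≠ 0) (h1 : f * x = x) (h2 : x * e = x) :
    ∃ u : A, u ≠ 0 ∧ IsProjection (star u * u) ∧ f * u = u ∧ u * e = u := by
  have hc := C_ne hx
  have hδ : 0 < ‖star x * x‖ / 2 := by
    have : 0 < ‖star x * x‖ := norm_pos_iff.2 (fun h => hx (ssz h))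
    positivity
  generalize ‖star x * x‖ / 2 = δ at *
  have ha : IsSelfAdjoint (star x * x) := IsSelfAdjoint.star_mul_self x
  obtain ⟨p, hp, H⟩ := exists_rp hAW {C δ (star x * x)}
  simp only [Set.mem_singleton_iff, forall_eq] at H
  have hpk : p * (K δ (star x * x) * (star x * x) * K δ (star x * x)) = p := by
    have := (H (1 - K δ (star x * x) * (star x * x) * K δ (star x * x))).1
      (by rw [mul_sub, mul_one, C_K hδ ha, sub_self])
    rw [mul_sub, mul_one, sub_eq_zero] at this
    exact this.symm
  have huu : star (x * K δ (star x * x) * p) * (x * K δ (star x * x) * p) = p := by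
    rw [star_mul, star_mul, hp.1, star_K]
    calc _ = p * (K δ (star x * x) * (star x * x) * K δ (star x * x)) * p := by
          simp only [mul_assoc]
      _ = p := by rw [hpk, hp.2]
  refine ⟨x * K δ (star x * x) * p, ?_, ?_, ?_, ?_⟩
  · intro h0
    rw [h0, mul_zero] at huu
    apply hc
    have := (H 1).2 (by rw [← huu, zero_mul])
    simpa using this
  · rwa [huu]
  · rw [mul_assoc, ra h1]
  · obtain ⟨d, hd⟩ := C_eq hδ ha
    have := (H (1 - e)).1 (by
      rw [hd, mul_sub, mul_one, mul_assoc, mul_assoc, h2, sub_self])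
    rw [mul_sub, mul_one, sub_eq_zero] at this
    rw [mul_assoc, ← this]

/-- position of two projections -/
theorem two_proj (hAW : IsAWStarRing A) {e f u : A} (he : IsProjection e) (hf : IsProjection f)
    (hu : IsProjection u) (hue : Commute u e) (huf : Commute u f) :
    ∃ q U W : A, IsProjection q ∧ star U * U = q ∧ U * star U = q ∧ star W * W = 1 - q ∧
      W * star W = 1 - q ∧ e * U = U * f ∧ e * W = W * (1 - f) ∧ Commute u U ∧ Commute u W := by
  set c : A := 1 - (e - f) * (e - f) with hc
  have sc : IsSelfAdjoint c := by
    simp [IsSelfAdjoint, hc, he.1, hf.1]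
  have ce : Commute c e := by
    simp only [Commute, SemiconjBy, hc, mul_sub, sub_mul, mul_assoc, ra he.2, he.2, ra hf.2, hf.2, mul_one,
      one_mul]
    abel
  have cf : Commute c f := by
    simp only [Commute, SemiconjBy, hc, mul_sub, sub_mul, mul_assoc, ra he.2, he.2, ra hf.2, hf.2, mul_one,
      one_mul]
    abel
  have cu : Commute c u :=
    (((Commute.one_right u).sub_right ((hue.sub_right huf).mul_right (hue.sub_right huf)))).symm
  obtain ⟨q, hq, H⟩ := exists_rp hAW {C (1/2) c}
  simp only [Set.mem_singleton_iff, forall_eq] at H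
  have Cq0 : C (1/2) c * (1 - q) = 0 := (H _).2 (by simp [mul_sub, hq.2])
  have qC0 : (1 - q) * C (1/2) c = 0 := by
    have := star_eq Cq0
    simpa [star_C, hq.1] using this
  have qcomm : ∀ z : A, IsProjection z → Commute c z → Commute q z := by
    intro z hz hcz
    have h1 : Commute (C (1/2) c) z := hcz.cfc_real _
    have h2 : q * (z * (1 - q)) = 0 := (H _).1 (by
      rw [← mul_assoc, h1.eq, mul_assoc, Cq0, mul_zero])
    rw [mul_sub, mul_sub, mul_one, sub_eq_zero] at h2
    have h3 := congrArg star h2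
    simp only [star_mul, hq.1, hz.1] at h3
    rw [mul_assoc] at h3
    exact h2.trans h3.symm
  have qe := qcomm e he ce
  have qf := qcomm f hf cf
  have qu := qcomm u hu cu
  have cq : Commute c q :=
    ((Commute.one_right q).sub_right ((qe.sub_right qf).mul_right (qe.sub_right qf))).symm
  have Kc : ∀ z, Commute c z → Commute (K (1/2) c) z := fun z hz => hz.cfc_real _
  have Kc' : ∀ z, Commute c z → Commute (K' c) z := fun z hz => hz.cfc_real _
  have qK : q * (K (1/2) c * c * K (1/2) c) = q := by
    have := (H (1 - K (1/2) c * c * K (1/2) c)).1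
      (by rw [mul_sub, mul_one, C_K (by norm_num) sc, sub_self])
    rw [mul_sub, mul_one, sub_eq_zero] at this
    exact this.symm
  have qK' : (1 - q) * (K' c * (1 - c) * K' c) = 1 - q := by
    rw [K'_C sc, mul_sub, mul_one, mul_smul_comm, qC0, smul_zero, sub_zero]
  have gen : ∀ s k c' r : A, star k = k → IsProjection r → star s * s = c' → s * star s = c' →
      r * (k * c' * k) = r → Commute k s → Commute k (star s) → Commute k r → Commute r s →
      Commute r (star s) →
      star (s * k * r) * (s * k * r) = r ∧ (s * k * r) * star (s * k * r) = r := by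
    intro s k c' r hk hr h1 h2 h3 h4 h5 h6 h7 h8
    constructor
    · rw [star_mul, star_mul, hr.1, hk]
      calc _ = r * (k * (star s * s) * k) * r := by simp only [mul_assoc]
        _ = r := by rw [h1, h3, hr.2]
    · rw [star_mul, star_mul, hr.1, hk]
      calc s * k * r * (r * (k * star s)) = s * k * r * (k * star s) := by
            rw [mul_assoc (s * k) r, ra hr.2, ← mul_assoc]
        _ = r * (k * (s * star s) * k) := by
            rw [(h4.symm : Commute s k).eq, mul_assoc k s r, ← h7.eq, h5.eq, ← mul_assoc k r s, h6.eq]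
            simp only [mul_assoc]
        _ = r := by rw [h2, h3]
  have e1 := proj_sub he
  have f1 := proj_sub hf
  have ce1 : Commute c (1 - e) := (Commute.one_right c).sub_right ce
  have cf1 : Commute c (1 - f) := (Commute.one_right c).sub_right cf
  have qe1 : Commute q (1 - e) := (Commute.one_right q).sub_right qe
  have qf1 : Commute q (1 - f) := (Commute.one_right q).sub_right qf
  have ue1 : Commute u (1 - e) := (Commute.one_right u).sub_right hue
  have uf1 : Commute u (1 - f) := (Commute.one_right u).sub_right huf
  have uq1 : Commute u (1 - q) := (Commute.one_right u).sub_right qu.symm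
  set s : A := e * f + (1 - e) * (1 - f) with hs
  set t : A := e * (1 - f) + (1 - e) * f with ht
  have ss : star s = f * e + (1 - f) * (1 - e) := by
    simp [hs, he.1, hf.1]
  have st : star t = (1 - f) * e + f * (1 - e) := by
    simp [ht, he.1, hf.1]
  have r1 : ∀ z, Commute z e → Commute z f → Commute z (1 - e) → Commute z (1 - f) →
      Commute z s ∧ Commute z (star s) ∧ Commute z t ∧ Commute z (star t) := by
    intro z z1 z2 z3 z4
    rw [ss, st, hs, ht]
    exact ⟨(z1.mul_right z2).add_right (z3.mul_right z4),
      (z2.mul_right z1).add_right (z4.mul_right z3),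
      (z1.mul_right z4).add_right (z3.mul_right z2),
      (z4.mul_right z1).add_right (z2.mul_right z3)⟩
  obtain ⟨q1, q2, q3, q4⟩ := r1 q qe qf qe1 qf1
  obtain ⟨u1, u2, u3, u4⟩ := r1 u hue huf ue1 uf1
  obtain ⟨k1, k2, k3, k4⟩ := r1 (K (1/2) c) (Kc _ ce) (Kc _ cf) (Kc _ ce1) (Kc _ cf1)
  obtain ⟨l1, l2, l3, l4⟩ := r1 (K' c) (Kc' _ ce) (Kc' _ cf) (Kc' _ ce1) (Kc' _ cf1)
  have g1 := gen s (K (1/2) c) c q (star_K _ _) hq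
    (by
      rw [ss, hs, hc]
      simp only [mul_sub, sub_mul, mul_add, add_mul, mul_assoc, ra hf.2, hf.2, ra he.2, he.2, mul_one,
        one_mul]
      abel)
    (by
      rw [ss, hs, hc]
      simp only [mul_sub, sub_mul, mul_add, add_mul, mul_assoc, ra hf.2, hf.2, ra he.2, he.2, mul_one,
        one_mul]
      abel) qK k1 k2 (Kc _ cq) q1 q2
  have g2 := gen t (K' c) (1 - c) (1 - q) (star_K' _) (proj_sub hq)
    (by
      rw [st, ht, hc]
      simp only [mul_sub, sub_mul, mul_add, add_mul, mul_assoc, ra hf.2, hf.2, ra he.2, he.2, mul_one,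
        one_mul]
      abel)
    (by
      rw [st, ht, hc]
      simp only [mul_sub, sub_mul, mul_add, add_mul, mul_assoc, ra hf.2, hf.2, ra he.2, he.2, mul_one,
        one_mul]
      abel) qK' l3 l4 ((Commute.one_right _).sub_right (Kc' _ cq))
      ((Commute.one_left _).sub_left q3) ((Commute.one_left _).sub_left q4)
  have es : e * s = s * f := by
    simp only [hs, mul_sub, sub_mul, mul_add, add_mul, mul_assoc, ra hf.2, hf.2, ra he.2, he.2, mul_one,
        one_mul]
    abel
  have et : e * t = t * (1 - f) := by
    simp only [ht, mul_sub, sub_mul, mul_add, add_mul, mul_assoc, ra hf.2, hf.2, ra he.2, he.2, mul_one,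
        one_mul]
    abel
  refine ⟨q, s * K (1/2) c * q, t * K' c * (1 - q), hq, g1.1, g1.2, g2.1, g2.2, ?_, ?_, ?_, ?_⟩
  · rw [mul_assoc s, ra es, mul_assoc s, mul_assoc s, mul_assoc (K (1/2) c), qf.eq,
      ← mul_assoc (K (1/2) c), (Kc _ cf).eq, mul_assoc f]
  · have qq : Commute (1 - q) (1 - f) := (Commute.one_left _).sub_left qf1
    rw [mul_assoc t, ra et, mul_assoc t, mul_assoc t, mul_assoc (K' c), qq.eq,
      ← mul_assoc (K' c), (Kc' _ cf1).eq, mul_assoc (1 - f)]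
  · exact (u1.mul_right (Kc _ cu).symm).mul_right qu.symm
  · exact (u3.mul_right (Kc' _ cu).symm).mul_right uq1

end AWS

namespace AWS

variable {A : Type u} [CStarAlgebra A]

/-- `P` is the right projection of the set `S`. -/
def RP (S : Set A) (P : A) : Prop :=
  IsProjection P ∧ ∀ x, (∀ s ∈ S, s * x = 0) ↔ P * x = 0

theorem RP.le {S : Set A} {P : A} (h : RP S P) {e : A} (he : ∀ s ∈ S, s * e = s) : P * e = P := by
  have := (h.2 (1 - e)).1 (fun s hs => by rw [mul_sub, mul_one, he s hs, sub_self])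
  rw [mul_sub, mul_one, sub_eq_zero] at this
  exact this.symm

theorem RP.mul {S : Set A} {P : A} (h : RP S P) {s : A} (hs : s ∈ S) : s * P = s :=
  rp_mul h.1 h.2 hs

theorem RP.ext {S : Set A} {P P' : A} (h : RP S P) (h' : RP S P') : P = P' := by
  have h1 : P * P' = P := h.le fun s hs => h'.mul hs
  have h2 : P' * P = P' := h'.le fun s hs => h.mul hs
  rw [← h1]
  exact le_symm h'.1 h.1 h2

/-- Orthogonal addability. -/
theorem addable (hAW : IsAWStarRing A) {T : Set A} {e f : A}
    (he : IsProjection e) (hf : IsProjection f) (hef : e * f = 0)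
    (hp : ∀ v ∈ T, IsProjection (star v * v)) (hve : ∀ v ∈ T, v * e = v) (hfv : ∀ v ∈ T, f * v = v)
    (ho : ∀ v ∈ T, ∀ w ∈ T, v ≠ w → star v * w = 0 ∧ v * star w = 0)
    {P Q : A} (hP : RP {x | ∃ v ∈ T, x = star v * v} P) (hQ : RP {x | ∃ v ∈ T, x = v * star v} Q) :
    ProjEquiv P Q := by
  obtain ⟨G, hG⟩ := exists_rp hAW
    {x | ∃ v ∈ T, x = star v * v + v * star v + v + star v}
  have hG : RP _ G := hG
  have hfe := orth_symm he hf hef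
  have vPe : P * e = P := hP.le (by
    rintro _ ⟨v, hv, rfl⟩; rw [mul_assoc, hve v hv])
  have vQf : Q * f = Q := hQ.le (by
    rintro _ ⟨v, hv, rfl⟩
    have := star_eq (hfv v hv)
    rw [hf.1] at this
    rw [mul_assoc, this])
  have ev : ∀ v ∈ T, e * v = 0 := fun v hv => by rw [← hfv v hv, ra hef, zero_mul]
  have vf : ∀ v ∈ T, v * f = 0 := fun v hv => by rw [← hve v hv, mul_assoc, hef, mul_zero]
  have vw : ∀ v ∈ T, ∀ w ∈ T, v * w = 0 := fun v hv w hw => by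
    rw [← hfv w hw, ← mul_assoc, vf v hv, zero_mul]
  have vws : ∀ v ∈ T, ∀ w ∈ T, star v * star w = 0 := fun v hv w hw => by
    simpa using star_eq (vw w hw v hv)
  have vvv : ∀ v ∈ T, v * (star v * v) = v := fun v hv => pi_right (hp v hv) rfl
  have svv : ∀ v ∈ T, star v * (v * star v) = star v := fun v hv => by
    have := star_eq (vvv v hv)
    simpa [mul_assoc] using this
  -- key identities
  have G1 : ∀ v ∈ T, G * (star v * v - v) = 0 := by
    intro v hv
    apply (hG.2 _).1
    rintro _ ⟨w, hw, rfl⟩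
    by_cases hwv : w = v
    · subst hwv
      simp only [mul_sub, add_mul, mul_assoc, vvv w hw, ra (vw w hw w hw), vw w hw w hw,
        ra (vws w hw w hw), zero_mul, mul_zero]
      have h2 : star w * (w * (star w * w)) = star w * w := by rw [vvv w hw]
      simp [h2, vvv w hw]
      abel
    · have h1 := ho w hw v hv hwv
      simp [mul_sub, add_mul, mul_assoc, h1.1, ra h1.1, ra h1.2, vw w hw v hv,
        ra (vws w hw v hv)]
  have G2 : ∀ v ∈ T, G * (star v * v + v) = star v * v + v := by
    intro v hv
    have h1 := hG.mul (s := star v * v + v * star v + v + star v) ⟨v, hv, rfl⟩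
    have h2 : G * (star v * v + v * star v + v + star v) = star v * v + v * star v + v + star v := by
      have := star_eq h1
      simp only [star_add, star_mul, star_star, hG.1.1] at this
      rw [show star v * v + v * star v + v + star v = star v * v + v * star v + star v + v by abel]
      exact this
    have h3 : (star v * v + v * star v + v + star v) * (star v * v) = star v * v + v := by
      simp [add_mul, mul_assoc, vvv v hv, ra (vws v hv v hv)]
    rw [← h3, ← mul_assoc, h2]
  have G3 : ∀ v ∈ T, G * (star v * v) + G * (star v * v) = star v * v + v := by
    intro v hv
    have h1 := G1 v hv
    have h2 := G2 v hv
    rw [mul_sub, sub_eq_zero] at h1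
    rw [mul_add, ← h1] at h2
    exact h2
  have G4 : ∀ v ∈ T, G * (v * star v) + G * (v * star v) = star v + v * star v := by
    intro v hv
    have h1 := G1 v hv
    rw [mul_sub, sub_eq_zero] at h1
    have h3 := G3 v hv
    rw [h1] at h3
    have h4 := congrArg (· * star v) h3
    simp only [add_mul, mul_assoc, svv v hv] at h4
    exact h4
  have Pp : ∀ v ∈ T, P * (star v * v) = star v * v := fun v hv =>
    le_symm (hp v hv) hP.1 (hP.mul ⟨v, hv, rfl⟩)
  have Qq : ∀ v ∈ T, Q * (v * star v) = v * star v := fun v hv =>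
    le_symm (pi_range (hp v hv) rfl) hQ.1 (hQ.mul ⟨v, hv, rfl⟩)
  have Qv : ∀ v ∈ T, Q * v = v := fun v hv => by
    rw [← vvv v hv, ← mul_assoc v, ← mul_assoc Q, Qq v hv]
  have Pv : ∀ v ∈ T, P * star v = star v := fun v hv => by
    rw [← svv v hv, ← mul_assoc (star v), ← mul_assoc P, Pp v hv]
  have Pq : ∀ v ∈ T, P * (v * star v) = 0 := fun v hv => by
    rw [← vPe, mul_assoc, ← mul_assoc e, ev v hv, zero_mul, mul_zero]
  have Qp : ∀ v ∈ T, Q * (star v * v) = 0 := fun v hv => by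
    have : f * star v = 0 := by simpa [hf.1] using star_eq (vf v hv)
    rw [← vQf, mul_assoc, ← mul_assoc f, this, zero_mul, mul_zero]
  have PQ : star (Q * G * P + Q * G * P) = P * G * Q + P * G * Q := by
    simp [hP.1.1, hQ.1.1, hG.1.1, mul_assoc]
  have wp : ∀ v ∈ T, (Q * G * P + Q * G * P) * (star v * v) = v := by
    intro v hv
    rw [add_mul, mul_assoc, Pp v hv, mul_assoc, ← mul_add, G3 v hv, mul_add, Qp v hv, Qv v hv,
      zero_add]
  have wq : ∀ v ∈ T, (P * G * Q + P * G * Q) * (v * star v) = star v := by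
    intro v hv
    rw [add_mul, mul_assoc, Qq v hv, mul_assoc, ← mul_add, G4 v hv, mul_add, Pq v hv, Pv v hv,
      add_zero]
  set w := Q * G * P + Q * G * P with hw
  have wP : w * P = w := by rw [hw]; simp [add_mul, mul_assoc, hP.1.2]
  have wQ : star w * Q = star w := by rw [PQ]; simp [add_mul, mul_assoc, hQ.1.2]
  have fin : ∀ (S : Set A) (R y : A), RP S R → (∀ s ∈ S, IsProjection s) → star y = y → y * R = y →
      (∀ s ∈ S, y * s = s) → y = R := by
    intro S R y hR hS hy hyR h
    have h1 : ∀ s ∈ S, s * y = s := by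
      intro s hs
      have := star_eq (h s hs)
      rwa [hy, (hS s hs).1] at this
    have h2 := hR.le h1
    have h3 := star_eq hyR
    rw [hy, hR.1.1] at h3
    rw [← h3, h2]
  refine ⟨w, ?_, ?_⟩
  · refine fin _ P _ hP ?_ (by simp) (by rw [mul_assoc, wP]) ?_
    · rintro _ ⟨v, hv, rfl⟩; exact hp v hv
    · rintro _ ⟨v, hv, rfl⟩
      rw [mul_assoc, wp v hv, PQ, ← Qv v hv]
      conv_lhs => rw [← vvv v hv]
      rw [Qv v hv, ← mul_assoc v, ← mul_assoc Q, Qq v hv, ← mul_assoc, wq v hv]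
  · refine fin _ Q _ hQ ?_ (by simp) (by rw [mul_assoc, wQ]) ?_
    · rintro _ ⟨v, hv, rfl⟩; exact pi_range (hp v hv) rfl
    · rintro _ ⟨v, hv, rfl⟩
      rw [mul_assoc, PQ, wq v hv]
      conv_lhs => rw [← svv v hv]
      rw [← mul_assoc (star v), ← mul_assoc w, wp v hv]

/-- Orthogonal generalized comparability. -/
theorem orth_gc (hAW : IsAWStarRing A) {e f : A}
    (he : IsProjection e) (hf : IsProjection f) (hef : e * f = 0) :
    ∃ h : A, IsCentralProj h ∧ Sub (h * e) (h * f) ∧ Sub ((1 - h) * f) ((1 - h) * e) := by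
  let good : Set A → Prop := fun T => (∀ v ∈ T, IsProjection (star v * v) ∧ v * e = v ∧ f * v = v) ∧
    ∀ v ∈ T, ∀ w ∈ T, v ≠ w → star v * w = 0 ∧ v * star w = 0
  obtain ⟨T, hT⟩ := zorn_subset {T | good T} (by
    intro c hc hchain
    refine ⟨⋃₀ c, ⟨?_, ?_⟩, fun s hs => Set.subset_sUnion_of_mem hs⟩
    · rintro v ⟨s, hs, hv⟩
      exact (hc hs).1 v hv
    · rintro v ⟨s, hs, hv⟩ w ⟨t, ht, hw⟩ hvw
      rcases hchain.total hs ht with h | h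
      · exact (hc ht).2 v (h hv) w hw hvw
      · exact (hc hs).2 v hv w (h hw) hvw)
  have hgood : good T := hT.1
  obtain ⟨P, hP⟩ := exists_rp hAW {x | ∃ v ∈ T, x = star v * v}
  obtain ⟨Q, hQ⟩ := exists_rp hAW {x | ∃ v ∈ T, x = v * star v}
  have hP : RP _ P := hP
  have hQ : RP _ Q := hQ
  have hPQ := addable hAW he hf hef (fun v hv => (hgood.1 v hv).1) (fun v hv => (hgood.1 v hv).2.1)
    (fun v hv => (hgood.1 v hv).2.2) hgood.2 hP hQ
  have Pe : P * e = P := hP.le (by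
    rintro _ ⟨v, hv, rfl⟩; rw [mul_assoc, (hgood.1 v hv).2.1])
  have Qf : Q * f = Q := hQ.le (by
    rintro _ ⟨v, hv, rfl⟩
    have := star_eq (hgood.1 v hv).2.2
    rw [hf.1] at this
    rw [mul_assoc, this])
  have eP := le_symm hP.1 he Pe
  have fQ := le_symm hQ.1 hf Qf
  have vP : ∀ v ∈ T, v * P = v := fun v hv => by
    rw [← pi_right (hgood.1 v hv).1 rfl, mul_assoc, hP.mul ⟨v, hv, rfl⟩]
  have vQ : ∀ v ∈ T, star v * Q = star v := fun v hv => by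
    have h1 := pi_left (pi_range (hgood.1 v hv).1 rfl) rfl
    have := star_eq h1
    rw [star_mul, star_star] at this
    rw [← this, mul_assoc, hQ.mul ⟨v, hv, rfl⟩]
  have zero : ∀ a : A, (f - Q) * a * (e - P) = 0 := by
    intro a
    by_contra hne
    have pe := proj_diff hP.1 he Pe
    have pf := proj_diff hQ.1 hf Qf
    obtain ⟨v, hv0, hvp, hv1, hv2⟩ := pc hAW (e := e - P) (f := f - Q) hne
      (by rw [mul_assoc, ra pf.2]) (by rw [mul_assoc, pe.2])
    have b1 : v * P = 0 := by
      rw [← hv2, mul_assoc, sub_mul, eP, hP.1.2, sub_self, mul_zero]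
    have b2 : Q * v = 0 := by
      rw [← hv1, ← mul_assoc, mul_sub, Qf, hQ.1.2, sub_self, zero_mul]
    have b3 : v * e = v := by
      rw [← hv2, mul_assoc, sub_mul, he.2, Pe]
    have b4 : f * v = v := by
      rw [← hv1, ← mul_assoc, mul_sub, hf.2, fQ]
    have b1' : P * star v = 0 := by simpa [hP.1.1] using star_eq b1
    have o : ∀ w ∈ T, star w * v = 0 ∧ w * star v = 0 := fun w hw =>
      ⟨by rw [← vQ w hw, mul_assoc, b2, mul_zero], by rw [← vP w hw, mul_assoc, b1', mul_zero]⟩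
    have hvT : v ∉ T := fun h => hv0 (ssz (o v h).1)
    have hg : good (insert v T) := by
      constructor
      · rintro w (rfl | hw)
        · exact ⟨hvp, b3, b4⟩
        · exact hgood.1 w hw
      · rintro w (rfl | hw) x (rfl | hx) hwx
        · exact absurd rfl hwx
        · have := o x hx
          exact ⟨by simpa using star_eq this.1, by simpa using star_eq this.2⟩
        · exact o w hw
        · exact hgood.2 w hw x hx hwx
    exact hvT (hT.2 hg (Set.subset_insert v T) (Set.mem_insert v T))
  obtain ⟨N, hN⟩ := exists_rp hAW {x | ∃ a : A, x = (f - Q) * a}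
  have hN : RP _ N := hN
  have hNb : ∀ b : A, N * b = N * b * N := by
    intro b
    have : N * (b * (1 - N)) = 0 := by
      apply (hN.2 _).1
      rintro _ ⟨a, rfl⟩
      have := (hN.2 (1 - N)).2 (by rw [mul_sub, mul_one, hN.1.2, sub_self]) ((f - Q) * (a * b))
        ⟨a * b, rfl⟩
      simpa [mul_assoc] using this
    rw [mul_sub, mul_sub, mul_one, sub_eq_zero] at this
    rw [mul_assoc]; exact this
  have hNc : IsCentralProj N := by
    refine ⟨hN.1, fun a => ?_⟩
    have h1 := congrArg star (hNb (star a))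
    simp only [star_mul, star_star, hN.1.1] at h1
    rw [h1, hNb a, mul_assoc]
  have hNf : N * (f - Q) = f - Q := by
    have h1 := hN.mul (s := (f - Q) * 1) ⟨1, rfl⟩
    rw [mul_one] at h1
    rw [hNc.2]; exact h1
  have hNe : N * (e - P) = 0 := (hN.2 _).1 (by
    rintro _ ⟨a, rfl⟩; exact zero a)
  rw [mul_sub, sub_eq_zero] at hNe
  have hNf' : (1 - N) * f = (1 - N) * Q := by
    rw [sub_mul, sub_mul, one_mul, one_mul]
    rw [mul_sub] at hNf
    rw [sub_eq_sub_iff_sub_eq_sub, ← hNf]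
  refine ⟨N, hNc, ?_, ?_⟩
  · rw [hNe]
    exact sub_central hNc (sub_trans (sub_of_pe hQ.1 hPQ) (sub_of_le hQ.1 fQ))
  · rw [hNf']
    exact sub_central (central_compl hNc)
      (sub_trans (sub_of_pe hP.1 (pe_symm hPQ)) (sub_of_le hP.1 eP))

end AWS

namespace AWS

variable {A : Type u} [CStarAlgebra A]

theorem orth_q {q f : A} (hq : IsProjection q) (hqf : q * f = f * q) (h : A)
    (hh : IsCentralProj h) : (h * (q * f)) * (h * ((1 - q) * f)) = 0 := by
  have : q * f * ((1 - q) * f) = 0 := by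
    rw [hqf]
    simp only [mul_sub, sub_mul, one_mul, mul_assoc, ra hq.2, sub_self, mul_zero]
  rw [mul_assoc, ← mul_assoc (q * f), ← hh.2 (q * f), mul_assoc h, this]
  simp

theorem glue {q f a b e h : A} (hq : IsProjection q) (hf : IsProjection f) (hqf : q * f = f * q)
    (hh : IsCentralProj h) (H1 : Sub (h * a) (h * (q * f))) (H2 : Sub (h * b) (h * ((1 - q) * f)))
    (hab : a + b = e) : Sub (h * e) (h * f) := by
  have h1 := central_proj hh (proj_mul hq hf hqf)
  have h2 := central_proj hh (proj_mul (proj_sub hq) hf (by rw [sub_mul, mul_sub, hqf]; simp))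
  have := sub_add h1 h2 H1 H2 (orth_q hq hqf h hh)
  rw [← mul_add, ← mul_add, hab, ← add_mul] at this
  simpa using this

theorem gluec {h D y : A} (hh : IsCentralProj h) (hy : IsProjection y)
    (H1 : Sub (h * D) (h * y)) (H2 : Sub ((1 - h) * D) ((1 - h) * y)) : Sub D y := by
  have h1 : IsCentralProj (1 : A) := ⟨⟨by simp, by simp⟩, by simp⟩
  have := glue (a := h * D) (b := (1 - h) * D) (e := D) hh.1 hy (hh.2 y) h1 (by simpa using H1)
    (by simpa using H2) (by rw [← add_mul]; simp)
  simpa using this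

theorem gc (hAW : IsAWStarRing A) {e f : A} (he : IsProjection e) (hf : IsProjection f) :
    ∃ h : A, IsCentralProj h ∧ Sub (h * e) (h * f) ∧ Sub ((1 - h) * f) ((1 - h) * e) := by
  obtain ⟨q, U, W, hq, U1, U2, W1, W2, eU, eW, -, -⟩ := two_proj hAW he hf (u := 1)
    ⟨by simp, by simp⟩ (Commute.one_left _) (Commute.one_left _)
  obtain ⟨A1, qf, qe⟩ := pe_of_intertwine he hf U1 U2 eU
  obtain ⟨A2, -, qe'⟩ := pe_of_intertwine he (proj_sub hf) W1 W2 eW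
  have qf1 : (1 - q) * f = f * (1 - q) := by rw [sub_mul, mul_sub, qf]; simp
  have qf2 : (1 - q) * (1 - f) = (1 - f) * (1 - q) := by
    rw [mul_sub, qf1, sub_mul (1 : A) f]; simp
  have pqe := proj_mul hq he qe
  have pqf := proj_mul hq hf qf
  have pE := proj_mul (proj_sub hq) (proj_sub hf) qf2
  have pF := proj_mul (proj_sub hq) hf qf1
  have pe' := proj_mul (proj_sub hq) he qe'
  obtain ⟨h, hh, S1, S2⟩ := orth_gc hAW pE pF (by
    rw [qf1, qf2, mul_assoc, ← mul_assoc (1 - q) f, qf1]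
    simp only [mul_assoc, (proj_sub hq).2]
    rw [← mul_assoc, sub_mul, hf.2]; simp)
  refine ⟨h, hh, ?_, ?_⟩
  · refine glue hq hf qf hh (a := q * e) (b := (1 - q) * e)
      (sub_central hh (sub_of_pe pqf (pe_symm A1)))
      (sub_trans (sub_central hh (sub_of_pe pE (pe_symm A2))) S1) (by rw [← add_mul]; simp)
  · refine glue hq he qe (central_compl hh) (a := q * f) (b := (1 - q) * f)
      (sub_central (central_compl hh) (sub_of_pe pqe A1))
      (sub_trans S2 (sub_central (central_compl hh) (sub_of_pe pe' A2))) (by rw [← add_mul]; simp)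

theorem split (hAW : IsAWStarRing A) {x y D1 D2 : A} (hx : IsProjection x) (hy : IsProjection y)
    (hxy : x * y = 0) (h1 : IsProjection D1) (h2 : IsProjection D2) (h12 : D1 * D2 = 0)
    (hu1 : (x + y) * D1 = D1) (hu2 : (x + y) * D2 = D2) :
    ∃ h : A, IsCentralProj h ∧ Sub (h * D1) (h * y) ∧ Sub ((1 - h) * D2) ((1 - h) * x) := by
  obtain ⟨u, rfl⟩ : ∃ u, y = u - x := ⟨x + y, by simp⟩
  simp only [add_sub_cancel] at hu1 hu2
  have hux : x * u = x := by rw [mul_sub, hx.2, sub_eq_zero] at hxy; exact hxy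
  have hu : IsProjection u := by
    have := proj_add hx hy hxy
    simpa using this
  have hux' := le_symm hx hu hux
  have hu1' : D1 * u = D1 := by simpa [hu.1, h1.1] using star_eq hu1
  obtain ⟨q, U, W, hq, U1, U2, W1, W2, eU, eW, cU, cW⟩ := two_proj hAW hx h1 hu
    (by rw [Commute, SemiconjBy, hux, hux']) (by rw [Commute, SemiconjBy, hu1, hu1'])
  have hG := proj_diff h1 hu hu1'
  obtain ⟨a1, qD, qx⟩ := pe_of_intertwine hx h1 U1 U2 eU
  obtain ⟨a2, qG, qy⟩ := pe_of_intertwine hy hG U1 U2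
    (by rw [sub_mul, eU, mul_sub, cU.eq])
  obtain ⟨a3, qD', qy'⟩ := pe_of_intertwine hy h1 W1 W2
    (by rw [sub_mul, eW, cW.eq]
        have : W * (1 - D1) = W * u - W * D1 := by
          rw [← eW]
          conv_lhs => rw [← hux, mul_assoc, cW.eq, ← mul_assoc, eW, mul_assoc, sub_mul, one_mul, hu1', mul_sub]
        rw [this]; simp)
  obtain ⟨a4, qG', qx'⟩ := pe_of_intertwine hx hG W1 W2
    (by conv_lhs => rw [← hux, mul_assoc, cW.eq, ← mul_assoc, eW, mul_assoc, sub_mul, one_mul, hu1'])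
  obtain ⟨h, hh, S1, S2⟩ := gc hAW (proj_mul hq h1 qD) (proj_mul hq hG qG)
  refine ⟨h, hh, ?_, ?_⟩
  · exact glue hq hy qy hh
      (sub_trans S1 (sub_central hh (sub_of_pe (proj_mul hq hy qy) a2)))
      (sub_central hh (sub_of_pe (proj_mul (proj_sub hq) hy qy') a3))
      (by rw [← add_mul]; simp)
  · have hc := central_compl hh
    have k : Sub ((1 - h) * (u - D1)) ((1 - h) * x) := glue hq hx qx hc
      (sub_trans S2 (sub_central hc (sub_of_pe (proj_mul hq hx qx) a1)))
      (sub_central hc (sub_of_pe (proj_mul (proj_sub hq) hx qx') a4))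
      (by rw [← add_mul]; simp)
    exact sub_trans (sub_central hc (sub_of_le h2 (by rw [sub_mul, hu2, h12, sub_zero]))) k

/-- A projection that splits in two copies of itself. -/
def Dbl (D : A) : Prop := ∃ D1 D2 : A, IsProjection D1 ∧ IsProjection D2 ∧ D1 * D2 = 0 ∧
  D = D1 + D2 ∧ ProjEquiv D D1 ∧ ProjEquiv D D2

theorem Dbl.proj {D : A} (H : Dbl D) : IsProjection D := by
  obtain ⟨D1, D2, h1, h2, h12, rfl, -, -⟩ := H
  exact proj_add h1 h2 h12

theorem Dbl.central {D h : A} (H : Dbl D) (hh : IsCentralProj h) : Dbl (h * D) := by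
  obtain ⟨D1, D2, h1, h2, h12, rfl, e1, e2⟩ := H
  refine ⟨h * D1, h * D2, central_proj hh h1, central_proj hh h2, ?_, mul_add _ _ _,
    pe_central hh e1, pe_central hh e2⟩
  rw [mul_assoc, ← mul_assoc D1, ← hh.2 D1, mul_assoc h, h12]; simp

/-- transporting a subprojection along a partial isometry -/
theorem transport {D v E : A} (hE : IsProjection E) (hv : star v * v = D) (hDE : D * E = E) :
    IsProjection (v * E * star v) ∧ ProjEquiv E (v * E * star v) := by
  have k : star (v * E) * (v * E) = E := by
    rw [star_mul, mul_assoc, ra hv, hE.1, hDE, hE.2]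
  have k2 : v * E * star (v * E) = v * E * star v := by
    rw [star_mul, hE.1, mul_assoc, ra hE.2, mul_assoc]
  refine ⟨?_, v * E, k, k2⟩
  rw [← k2]
  exact pi_range hE k

theorem iter (hAW : IsAWStarRing A) {ι : Type*} [DecidableEq ι] (e : ι → A)
    (hep : ∀ i, IsProjection (e i))
    (heo : ∀ i j, i ≠ j → e i * e j = 0) (e0 : A) (h0 : IsProjection e0) (hs : ∀ i, Sub (e i) e0)
    (s : Finset ι) : ∀ D : A, Dbl D → Sub D (∑ i ∈ s, e i) → Sub D e0 := by
  induction s using Finset.induction_on with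
  | empty =>
    rintro D hD ⟨v, h1, h2⟩
    simp only [Finset.sum_empty, zero_mul] at h2
    exact ⟨0, by rw [← h1, ← h2], by simp⟩
  | insert i s hi ih =>
    rintro D hD ⟨v, hv, hv2⟩
    rw [Finset.sum_insert hi] at hv2
    have hY : ∀ t : Finset ι, IsProjection (∑ i ∈ t, e i) := by
      intro t
      refine ⟨by rw [star_sum]; exact Finset.sum_congr rfl fun i _ => (hep i).1, ?_⟩
      rw [Finset.sum_mul]
      refine Finset.sum_congr rfl fun i hi => ?_
      rw [Finset.mul_sum, Finset.sum_eq_single i (fun j _ hj => heo i j hj.symm)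
        (fun h => absurd hi h), (hep i).2]
    have hio : e i * ∑ i ∈ s, e i = 0 := by
      rw [Finset.mul_sum]
      exact Finset.sum_eq_zero fun j hj => heo i j (fun h => hi (h ▸ hj))
    obtain ⟨D1, D2, h1, h2, h12, hDD, e1, e2⟩ := id hD
    have d1 : D * D1 = D1 := by rw [hDD, add_mul, h1.2, orth_symm h1 h2 h12, add_zero]
    have d2 : D * D2 = D2 := by rw [hDD, add_mul, h2.2, h12, zero_add]
    obtain ⟨t1, t1'⟩ := transport h1 hv d1
    obtain ⟨t2, t2'⟩ := transport h2 hv d2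
    obtain ⟨h, hh, S1, S2⟩ := split hAW (hep i) (hY s) hio t1 t2
      (by simp only [mul_assoc, ra hv, ra d2, ra h12, zero_mul, mul_zero])
      (by simp only [← mul_assoc, hv2]) (by simp only [← mul_assoc, hv2])
    have hc := central_compl hh
    refine gluec hh h0 ?_ ?_
    · have k : Sub (h * D) (h * ∑ i ∈ s, e i) :=
        sub_trans (sub_central hh (sub_of_pe t1 (pe_trans h1 e1 t1'))) S1
      have k2 : Sub (h * D) (∑ i ∈ s, e i) := sub_trans k (sub_of_le (central_proj hh (hY s))
        (by rw [hh.2, ← mul_assoc, (hY s).2]))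
      have k3 := sub_central hh (ih _ (hD.central hh) k2)
      rwa [ra hh.1.2] at k3
    · exact sub_trans (sub_central hc (sub_of_pe t2 (pe_trans h2 e2 t2')))
        (sub_trans S2 (sub_central hc (hs i)))

end AWS

namespace AWS

variable {A : Type u} [CStarAlgebra A]

/-- The shifts of `d` under `V`. -/
def sh (V d : A) : ℕ → A
  | 0 => d
  | k + 1 => V * sh V d k

theorem shift (hAW : IsAWStarRing A) {V u d : A} (hV : star V * V = u)
    (huV : u * V = V) (hd : IsProjection d) (hVd : star V * d = 0) (hud : u * d = d) :
    ∃ D c : A, Dbl D ∧ u * D = D ∧ IsProjection c ∧ D * c = 0 ∧ ProjEquiv d c ∧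
      ProjEquiv (D + c) D := by
  have hu : star u = u := by rw [← hV]; simp
  set t := sh V d with ht
  have t0 : t 0 = d := rfl
  have ts : ∀ k, t (k + 1) = V * t k := fun k => rfl
  have ut : ∀ k, u * t k = t k := by
    intro k
    cases k with
    | zero => exact hud
    | succ k => rw [ts, ra huV]
  have dV : d * V = 0 := by simpa [hd.1] using star_eq hVd
  have td : ∀ k, t k * d = t k := by
    intro k
    induction k with
    | zero => rw [t0, hd.2]
    | succ k ih => rw [ts, mul_assoc, ih]
  have tt : ∀ k l, star (t k) * t l = if k = l then d else 0 := by
    intro k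
    induction k with
    | zero =>
      intro l
      cases l with
      | zero => simp [t0, hd.1, hd.2]
      | succ l => simp [t0, ts, hd.1, ra dV]
    | succ k ih =>
      intro l
      cases l with
      | zero => simp [t0, ts, mul_assoc, hVd]
      | succ l => simp [ts, mul_assoc, ra hV, ut, ih]
  have t1 : ∀ k, star (t k) * t k = d := fun k => by rw [tt]; simp
  have t2 : ∀ k l, k ≠ l → star (t k) * t l = 0 := fun k l h => by rw [tt]; simp [h]
  have dt : ∀ k, d * star (t k) = star (t k) := fun k => by
    have := star_eq (td k); rwa [hd.1] at this
  let c : ℕ → A := fun k => t k * star (t k)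
  have hcdef : ∀ k, c k = t k * star (t k) := fun k => rfl
  have hc : ∀ k, IsProjection (c k) := fun k => pi_range hd (t1 k)
  have cc : ∀ k l, k ≠ l → c k * c l = 0 := fun k l h => by
    rw [hcdef, hcdef, mul_assoc, ra (t2 k l h)]; simp
  have hex : ∀ S : Set ℕ, ∃ P, RP (c '' S) P := fun S => exists_rp hAW (c '' S)
  choose D hD using hex
  have hDo : ∀ S T, Disjoint S T → D S * D T = 0 := by
    intro S T hST
    apply ((hD S).2 _).1
    rintro _ ⟨k, hk, rfl⟩
    have h1 : D T * c k = 0 := by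
      apply ((hD T).2 _).1
      rintro _ ⟨l, hl, rfl⟩
      apply cc
      rintro rfl
      exact Set.disjoint_left.1 hST hk hl
    exact orth_symm (hD T).1 (hc k) h1
  have hDu : ∀ S T, Disjoint S T → D (S ∪ T) = D S + D T := by
    intro S T hST
    have o := hDo S T hST
    have o' := hDo T S hST.symm
    refine (hD _).ext ⟨proj_add (hD S).1 (hD T).1 o, fun x => ?_⟩
    constructor
    · intro h
      have h1 : D S * x = 0 := ((hD S).2 x).1 fun s hs => by
        obtain ⟨k, hk, rfl⟩ := hs
        exact h _ ⟨k, Or.inl hk, rfl⟩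
      have h2 : D T * x = 0 := ((hD T).2 x).1 fun s hs => by
        obtain ⟨k, hk, rfl⟩ := hs
        exact h _ ⟨k, Or.inr hk, rfl⟩
      rw [add_mul, h1, h2, add_zero]
    · intro h
      have h1 : D S * x = 0 := by
        have := congrArg (D S * ·) h
        simpa [add_mul, mul_add, ra (hD S).1.2, ra o] using this
      have h2 : D T * x = 0 := by
        have := congrArg (D T * ·) h
        simpa [add_mul, mul_add, ra (hD T).1.2, ra o'] using this
      rintro _ ⟨k, hk | hk, rfl⟩
      · exact ((hD S).2 x).2 h1 _ ⟨k, hk, rfl⟩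
      · exact ((hD T).2 x).2 h2 _ ⟨k, hk, rfl⟩
  have hDt : ∀ S k, k ∈ S → D S * t k = t k := by
    intro S k hk
    have h1 := le_symm (hc k) (hD S).1 ((hD S).mul ⟨k, hk, rfl⟩)
    have h2 : c k * t k = t k := by rw [hcdef, mul_assoc, t1, td]
    rw [← h2, ← mul_assoc, h1]
  have hE : ∀ σ τ : ℕ → ℕ, Function.Injective σ → Function.Injective τ → (∀ k l, σ k ≠ τ l) →
      ProjEquiv (D (Set.range σ)) (D (Set.range τ)) := by
    intro σ τ hσ hτ hστ
    have v1 : ∀ k, star (t (τ k) * star (t (σ k))) * (t (τ k) * star (t (σ k))) = c (σ k) := by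
      intro k
      rw [star_mul, star_star, mul_assoc, ra (t1 _), dt]
    have v2 : ∀ k, (t (τ k) * star (t (σ k))) * star (t (τ k) * star (t (σ k))) = c (τ k) := by
      intro k
      rw [star_mul, star_star, mul_assoc, ra (t1 _), dt]
    refine addable hAW (T := Set.range fun k => t (τ k) * star (t (σ k)))
      (hD (Set.range σ)).1 (hD (Set.range τ)).1 (hDo _ _ ?_) ?_ ?_ ?_ ?_ ?_ ?_
    · rw [Set.disjoint_left]
      rintro _ ⟨k, rfl⟩ ⟨l, h⟩
      exact hστ k l h.symm
    · rintro _ ⟨k, rfl⟩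
      simp only [v1]; exact hc _
    · rintro _ ⟨k, rfl⟩
      have := star_eq (hDt (Set.range σ) (σ k) ⟨k, rfl⟩)
      rw [(hD _).1.1] at this
      simp only [mul_assoc, this]
    · rintro _ ⟨k, rfl⟩
      simp only [← mul_assoc, hDt (Set.range τ) (τ k) ⟨k, rfl⟩]
    · rintro _ ⟨k, rfl⟩ _ ⟨l, rfl⟩ hne
      have hkl : k ≠ l := by rintro rfl; exact hne rfl
      constructor
      · simp only [star_mul, star_star, mul_assoc, ra (t2 _ _ (hτ.ne hkl)), zero_mul, mul_zero]
      · simp only [star_mul, star_star, mul_assoc, ra (t2 _ _ (hσ.ne hkl)), zero_mul, mul_zero]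
    · convert hD (Set.range σ) using 1
      ext x; constructor
      · rintro ⟨_, ⟨k, rfl⟩, rfl⟩
        exact ⟨σ k, ⟨k, rfl⟩, (v1 k).symm⟩
      · rintro ⟨_, ⟨k, rfl⟩, rfl⟩
        exact ⟨_, ⟨k, rfl⟩, (v1 k).symm⟩
    · convert hD (Set.range τ) using 1
      ext x; constructor
      · rintro ⟨_, ⟨k, rfl⟩, rfl⟩
        exact ⟨τ k, ⟨k, rfl⟩, (v2 k).symm⟩
      · rintro ⟨_, ⟨k, rfl⟩, rfl⟩
        exact ⟨_, ⟨k, rfl⟩, (v2 k).symm⟩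
  have hD1 : D {1} = c 1 := by
    refine (hD _).ext ⟨hc 1, fun x => ?_⟩
    simp
  have i4 : Function.Injective fun k : ℕ => 4 * k := fun a b h => by simp only at h; omega
  have i42 : Function.Injective fun k : ℕ => 4 * k + 2 := fun a b h => by simp only at h; omega
  have i8 : Function.Injective fun k : ℕ => 8 * k := fun a b h => by simp only at h; omega
  have i84 : Function.Injective fun k : ℕ => 8 * k + 4 := fun a b h => by simp only at h; omega
  have i1 : Function.Injective fun k : ℕ => if k = 0 then 1 else 4 * (k - 1) := fun a b h => by
    simp only at h
    split_ifs at h <;> omega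
  have E42 := hE _ _ i4 i42 (fun k l => by omega)
  have E8 := hE _ _ i42 i8 (fun k l => by omega)
  have E84 := hE _ _ i42 i84 (fun k l => by omega)
  have E1 := hE _ _ i1 i42 (fun k l => by split_ifs <;> omega)
  have dis1 : Disjoint (Set.range fun k : ℕ => 4 * k) {1} := by
    rw [Set.disjoint_left]
    rintro _ ⟨k, rfl⟩ h
    simp only [Set.mem_singleton_iff] at h
    omega
  have dis8 : Disjoint (Set.range fun k : ℕ => 8 * k) (Set.range fun k : ℕ => 8 * k + 4) := by
    rw [Set.disjoint_left]
    rintro _ ⟨k, rfl⟩ ⟨l, h⟩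
    simp only at h
    omega
  have u1 : (Set.range fun k : ℕ => if k = 0 then 1 else 4 * (k - 1)) =
      (Set.range fun k : ℕ => 4 * k) ∪ {1} := by
    ext x
    simp only [Set.mem_range, Set.mem_union, Set.mem_singleton_iff]
    constructor
    · rintro ⟨k, rfl⟩
      split_ifs
      · exact Or.inr rfl
      · exact Or.inl ⟨k - 1, rfl⟩
    · rintro (⟨k, rfl⟩ | rfl)
      · exact ⟨k + 1, by simp⟩
      · exact ⟨0, by simp⟩
  have u8 : (Set.range fun k : ℕ => 4 * k) =
      (Set.range fun k : ℕ => 8 * k) ∪ (Set.range fun k : ℕ => 8 * k + 4) := by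
    ext x
    simp only [Set.mem_range, Set.mem_union]
    constructor
    · rintro ⟨k, rfl⟩
      rcases Nat.even_or_odd' k with ⟨l, rfl | rfl⟩
      · exact Or.inl ⟨l, by omega⟩
      · exact Or.inr ⟨l, by omega⟩
    · rintro (⟨k, rfl⟩ | ⟨k, rfl⟩)
      · exact ⟨2 * k, by omega⟩
      · exact ⟨2 * k + 1, by omega⟩
  refine ⟨D (Set.range fun k : ℕ => 4 * k), c 1, ?_, ?_, hc 1, ?_, ?_, ?_⟩
  · refine ⟨_, _, (hD _).1, (hD _).1, hDo _ _ dis8, ?_, pe_trans (hD _).1 E42 E8,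
      pe_trans (hD _).1 E42 E84⟩
    rw [u8, hDu _ _ dis8]
  · have : D (Set.range fun k : ℕ => 4 * k) * u = D (Set.range fun k : ℕ => 4 * k) := by
      apply (hD _).le
      rintro _ ⟨k, -, rfl⟩
      have := star_eq (ut k)
      rw [hu] at this
      rw [hcdef, mul_assoc, this]
    have := star_eq this
    rwa [hu, (hD _).1.1] at this
  · rw [← hD1]; exact hDo _ _ dis1
  · exact ⟨t 1, t1 1, rfl⟩
  · rw [← hD1, ← hDu _ _ dis1, ← u1]
    exact pe_trans (hD _).1 E1 (pe_symm E42)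

theorem lemL (hAW : IsAWStarRing A) {n : ℕ} (e f : Fin n → A) (u : A)
    (hep : ∀ i, IsProjection (e i)) (hfp : ∀ i, IsProjection (f i))
    (heo : ∀ i j, i ≠ j → e i * e j = 0) (hfo : ∀ i j, i ≠ j → f i * f j = 0)
    (hes : ∑ i, e i = u) (hfs : ∑ i, f i = u)
    (hee : ∀ i j, ProjEquiv (e i) (e j)) (hff : ∀ i j, ProjEquiv (f i) (f j))
    (i0 : Fin n) (H : Sub (e i0) (f i0)) : ProjEquiv (e i0) (f i0) := by
  have hsub : ∀ i, Sub (e i) (f i) := fun i =>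
    sub_trans (sub_of_pe (hep i0) (hee i i0)) (sub_trans H (sub_of_pe (hfp i) (hff i0 i)))
  choose v hv hfv using hsub
  have vo : ∀ i j, i ≠ j → star (v i) * v j = 0 := fun i j hij => by
    rw [← hfv i, ← hfv j, star_mul, (hfp i).1, mul_assoc, ra (hfo i j hij)]; simp
  have hV : star (∑ i, v i) * (∑ i, v i) = u := by
    rw [star_sum, Finset.sum_mul, ← hes]
    refine Finset.sum_congr rfl fun i _ => ?_
    rw [Finset.mul_sum, Finset.sum_eq_single i (fun j _ hj => vo i j hj.symm) (by simp), hv]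
  have uf : ∀ i, u * f i = f i := fun i => by
    rw [← hfs, Finset.sum_mul, Finset.sum_eq_single i (fun j _ hj => hfo j i hj) (by simp),
      (hfp i).2]
  have huV : u * (∑ i, v i) = ∑ i, v i := by
    rw [Finset.mul_sum]
    refine Finset.sum_congr rfl fun i _ => ?_
    rw [← hfv i, ra (uf i)]
  have hp1 := pi_range (hep i0) (hv i0)
  have fp1 : f i0 * (v i0 * star (v i0)) = v i0 * star (v i0) := by rw [ra (hfv i0)]
  have p1f := le_symm (hfp i0) (hfp i0) (hfp i0).2
  have p1f : v i0 * star (v i0) * f i0 = v i0 * star (v i0) := by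
    have := star_eq fp1
    rwa [(hfp i0).1, hp1.1] at this
  have hd := proj_diff hp1 (hfp i0) p1f
  have fd : f i0 * (f i0 - v i0 * star (v i0)) = f i0 - v i0 * star (v i0) := by
    rw [mul_sub, (hfp i0).2, fp1]
  have hve := pi_right (hep i0) (hv i0)
  have hVd : star (∑ i, v i) * (f i0 - v i0 * star (v i0)) = 0 := by
    rw [star_sum, Finset.sum_mul]
    refine Finset.sum_eq_zero fun i _ => ?_
    by_cases hi : i = i0
    · subst hi
      have h1 := star_eq (hfv i)
      have h2 := star_eq hve
      rw [(hfp i).1] at h1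
      rw [(hep i).1] at h2
      rw [mul_sub, h1, ra (hv i), h2, sub_self]
    · have h1 := star_eq (hfv i)
      rw [(hfp i).1] at h1
      rw [← h1, ← fd, mul_assoc, ra (hfo i i0 hi)]; simp
  have hud : u * (f i0 - v i0 * star (v i0)) = f i0 - v i0 * star (v i0) := by
    rw [← fd, ra (uf i0)]
  obtain ⟨D, c, hD, huD, hc, hDc, hdc, hDD⟩ := shift hAW hV huV hd hVd hud
  obtain ⟨w, hw, hew⟩ := iter hAW e hep heo (e i0) (hep i0)
    (fun i => sub_of_pe (hep i0) (hee i i0)) Finset.univ D hD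
    (sub_of_le hD.proj (by rw [hes, huD]))
  set p := v i0 * star (v i0) with hp
  set x := v i0 * w with hx
  have px : p * x = x := by rw [hp, hx, mul_assoc, ra (hv i0), hew]
  have xx : star x * x = D := by rw [hx, star_mul, mul_assoc, ra (hv i0), hew, hw]
  have hD' := pi_range hD.proj xx
  have DD' : ProjEquiv D (x * star x) := ⟨x, xx, rfl⟩
  have pD' : p * (x * star x) = x * star x := ra px _
  have fx : f i0 * x = x := by rw [hx, ra (hfv i0)]
  have D'p : x * star x * p = x * star x := by
    have := star_eq pD'
    rwa [hD'.1, hp1.1] at this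
  have D'd : x * star x * (f i0 - p) = 0 := by
    apply orth_symm hd hD'
    rw [← mul_assoc, sub_mul, fx, px, sub_self, zero_mul]
  have k1 : ProjEquiv (x * star x + (f i0 - p)) (x * star x) := by
    have := pe_add hD' hD.proj hd hc (pe_symm DD') hdc D'd hDc
    exact pe_trans (proj_add hD.proj hc hDc) this (pe_trans hD.proj hDD DD')
  have hpD := proj_diff hD' hp1 D'p
  have pd : p * (f i0 - p) = 0 := by rw [mul_sub, p1f, hp1.2, sub_self]
  have k2 := pe_add hpD hpD (proj_add hD' hd D'd) hD' (pe_refl hpD) k1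
    (by rw [sub_mul, mul_add, mul_add, pd, D'd, pD', hD'.2]; simp)
    (by rw [sub_mul, pD', hD'.2, sub_self])
  have k3 : ProjEquiv (f i0) p := by
    have a : p - x * star x + (x * star x + (f i0 - p)) = f i0 := by abel
    have b : p - x * star x + x * star x = p := by abel
    rwa [a, b] at k2
  exact pe_trans hp1 ⟨v i0, hv i0, rfl⟩ (pe_symm k3)

theorem main (hAW : IsAWStarRing A) {n : ℕ} (e f : Fin n → A)
    (hep : ∀ i, IsProjection (e i)) (hfp : ∀ i, IsProjection (f i))
    (heo : ∀ i j, i ≠ j → e i * e j = 0) (hfo : ∀ i j, i ≠ j → f i * f j = 0)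
    (hes : ∑ i, e i = 1) (hfs : ∑ i, f i = 1)
    (hee : ∀ i j, ProjEquiv (e i) (e j)) (hff : ∀ i j, ProjEquiv (f i) (f j))
    (j : Fin n) : ProjEquiv (e j) (f j) := by
  obtain ⟨h, hh, S1, S2⟩ := gc hAW (hep j) (hfp j)
  have hc := central_compl hh
  have o : ∀ (h : A), IsCentralProj h → ∀ (e : Fin n → A), (∀ i j, i ≠ j → e i * e j = 0) →
      ∀ i j, i ≠ j → (h * e i) * (h * e j) = 0 := by
    intro h hh e heo i j hij
    rw [mul_assoc, ← mul_assoc (e i), ← hh.2 (e i), mul_assoc h, heo i j hij]; simp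
  have s : ∀ (h : A) (e : Fin n → A), ∑ i, e i = 1 → ∑ i, h * e i = h := by
    intro h e he
    rw [← Finset.mul_sum, he, mul_one]
  have L1 := lemL hAW (fun i => h * e i) (fun i => h * f i) h (fun i => central_proj hh (hep i))
    (fun i => central_proj hh (hfp i)) (o h hh e heo) (o h hh f hfo) (s h e hes) (s h f hfs)
    (fun i j => pe_central hh (hee i j)) (fun i j => pe_central hh (hff i j)) j S1
  have L2 := lemL hAW (fun i => (1 - h) * f i) (fun i => (1 - h) * e i) (1 - h)
    (fun i => central_proj hc (hfp i))
    (fun i => central_proj hc (hep i)) (o _ hc f hfo) (o _ hc e heo) (s _ f hfs) (s _ e hes)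
    (fun i j => pe_central hc (hff i j)) (fun i j => pe_central hc (hee i j)) j S2
  have z : ∀ a : A, h * a * ((1 - h) * a) = 0 := by
    intro a
    rw [hh.2, mul_assoc, ← mul_assoc h, mul_sub, hh.1.2]; simp
  have := pe_add (central_proj hh (hep j)) (central_proj hh (hfp j)) (central_proj hc (hep j))
    (central_proj hc (hfp j)) L1 (pe_symm L2) (z _) (z _)
  rw [← add_mul, ← add_mul] at this
  simpa using this

end AWS

/-- If `{e₁, …, eₙ}` and `{f₁, …, fₙ}` are two orthogonal families of pairwise
equivalent projections, each summing to `1`, then `e_j ∼ f_j` for each `j`. -/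
theorem equiv_of_two_partitions {A : Type u} [NormedRing A] [StarRing A] [CStarRing A]
    [NormedAlgebra ℂ A] [StarModule ℂ A] [CompleteSpace A]
    (hAW : IsAWStarRing A) (n : ℕ)
    (e f : Fin n → A)
    (heproj : ∀ i, IsProjection (e i)) (hfproj : ∀ i, IsProjection (f i))
    (heorth : PairwiseOrthogonal e) (hforth : PairwiseOrthogonal f)
    (hesum : ∑ i, e i = 1) (hfsum : ∑ i, f i = 1)
    (heequiv : ∀ i j, ProjEquiv (e i) (e j)) (hfequiv : ∀ i j, ProjEquiv (f i) (f j)) :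
    ∀ j, ProjEquiv (e j) (f j) := by
  let _ : CStarAlgebra A := { }
  exact AWS.main hAW e f heproj hfproj heorth hforth hesum hfsum heequiv hfequiv
end

section
/- Let A and B be AW*-algebras and let f : A → B be a unital *-homomorphism that preserves suprema of arbitrary families of projections. Then for every positive integer n, the entrywise map M_n(f) : M_n(A) → M_n(B) is a unital *-homomorphism that preserves suprema of arbitrary families of projections. -/
universe u

structure AWG (A : Type u) [Ring A] [StarRing A] : Prop where
  supp : ∀ S : Set A, ∃ E : A, IsProjection E ∧ ∀ y : A, (∀ s ∈ S, y * s = 0) ↔ y * E = 0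
  pol : ∀ y a : A, y * a ≠ 0 → ∃ b : A, IsProjection (star (a * b) * (a * b)) ∧ y * (a * b) ≠ 0 ∧
    ∀ q : A, star q = q → a * q = a → a * b * q = a * b
  pm : ∀ x : A, star x = x → ∃ x₁ x₂ : A, star x₁ = x₁ ∧ star x₂ = x₂ ∧ x = x₁ - x₂ ∧
    x₁ * x₂ = 0 ∧ x₂ * x₁ = 0 ∧ ∀ c : A, c * (x * x) = x * x * c → c * (x₁ + x₂) = (x₁ + x₂) * c
  tor : ∀ a : A, a + a = 0 → a = 0
  proper : ∀ a : A, star a * a = 0 → a = 0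
  sumsq : ∀ (n : ℕ) (v : Fin n → A), ∃ a : A, ∑ i, star (v i) * v i = star a * a
  sumz : ∀ (n : ℕ) (v : Fin n → A), ∑ i, star (v i) * v i = 0 → ∀ i, v i = 0

theorem aw_supp {A : Type u} [Ring A] [StarRing A] (hA : IsAWStarRing A) (S : Set A) :
    ∃ E : A, IsProjection E ∧ ∀ y : A, (∀ s ∈ S, y * s = 0) ↔ y * E = 0 := by
  obtain ⟨p, ⟨hp1, hp2⟩, hS⟩ := hA (star '' S)
  refine ⟨1 - p, ⟨by simp [hp1], by simp [mul_sub, sub_mul, hp2]⟩, fun y => ?_⟩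
  have h1 : (∀ s ∈ S, y * s = 0) ↔ star y ∈ {a : A | ∀ s ∈ star '' S, s * a = 0} := by
    simp only [Set.mem_ofPred_eq, Set.forall_mem_image]
    refine forall₂_congr fun s _ => ?_
    rw [← star_mul, star_eq_zero]
  rw [h1, hS]
  constructor
  · rintro ⟨b, hb⟩
    have : star y = p * star y := by rw [hb, ← mul_assoc, hp2]
    have := congrArg star this
    simp only [star_star, star_mul, hp1] at this
    rw [mul_sub, mul_one, ← this, sub_self]
  · intro h
    refine ⟨star y, ?_⟩
    have : y = y * p := by rw [mul_sub, mul_one] at h; exact sub_eq_zero.mp h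
    conv_lhs => rw [this]
    simp [hp1]

section
variable {A : Type u} [CStarAlgebra A]

theorem cstar_pm (x : A) (hx : star x = x) : ∃ x₁ x₂ : A, star x₁ = x₁ ∧ star x₂ = x₂ ∧ x = x₁ - x₂ ∧
    x₁ * x₂ = 0 ∧ x₂ * x₁ = 0 ∧ ∀ c : A, c * (x * x) = x * x * c → c * (x₁ + x₂) = (x₁ + x₂) * c := by
  have hx' : IsSelfAdjoint x := hx
  refine ⟨cfc (fun t : ℝ => max t 0) x, cfc (fun t : ℝ => max (-t) 0) x, ?_, ?_, ?_, ?_, ?_, ?_⟩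
  · exact IsSelfAdjoint.cfc.star_eq
  · exact IsSelfAdjoint.cfc.star_eq
  · rw [← cfc_sub (fun t : ℝ => max t 0) (fun t : ℝ => max (-t) 0) x (by fun_prop) (by fun_prop)]
    conv_lhs => rw [← cfc_id ℝ x]
    congr 1; ext t; simp only [id]
    rcases le_total t 0 with h | h
    · rw [max_eq_right h, max_eq_left (by linarith)]; ring
    · rw [max_eq_left h, max_eq_right (by linarith)]; ring
  · rw [← cfc_mul (fun t : ℝ => max t 0) (fun t : ℝ => max (-t) 0) x (by fun_prop) (by fun_prop)]
    rw [← cfc_zero ℝ x]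
    congr 1; ext t
    rcases le_total t 0 with h | h
    · simp [max_eq_right h]
    · simp [max_eq_right (show -t ≤ 0 by linarith)]
  · rw [← cfc_mul (fun t : ℝ => max (-t) 0) (fun t : ℝ => max t 0) x (by fun_prop) (by fun_prop)]
    rw [← cfc_zero ℝ x]
    congr 1; ext t
    rcases le_total t 0 with h | h
    · simp [max_eq_right h]
    · simp [max_eq_right (show -t ≤ 0 by linarith)]
  · intro c hc
    rw [← cfc_add (a := x) (fun t : ℝ => max t 0) (fun t : ℝ => max (-t) 0) (by fun_prop) (by fun_prop)]
    have e1 : cfc (fun t : ℝ => max t 0 + max (-t) 0) x = cfc (fun s : ℝ => √s) (x * x) := by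
      have e2 : x * x = cfc (fun t : ℝ => t * t) x := by
        rw [cfc_mul (fun t : ℝ => t) (fun t : ℝ => t) x, cfc_id' ℝ x]
      rw [e2, ← cfc_comp' (fun s : ℝ => √s) (fun t : ℝ => t * t) x (by fun_prop)]
      congr 1; ext t
      rw [Real.sqrt_mul_self_eq_abs]
      rcases le_total t 0 with h | h
      · rw [max_eq_right h, max_eq_left (by linarith), abs_of_nonpos h]; ring
      · rw [max_eq_left h, max_eq_right (by linarith), abs_of_nonneg h]; ring
    rw [e1]
    exact ((show Commute (x * x) c from hc.symm).cfc_real _).symm.eq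

theorem cstar_pol (hA : IsAWStarRing A) (y a : A) (hya : y * a ≠ 0) :
    ∃ b : A, IsProjection (star (a * b) * (a * b)) ∧ y * (a * b) ≠ 0 ∧
    ∀ q : A, star q = q → a * q = a → a * b * q = a * b := by
  by_contra H0
  have H : ∀ b : A, IsProjection (star (a * b) * (a * b)) →
      (∀ q : A, star q = q → a * q = a → a * b * q = a * b) → y * (a * b) = 0 := by
    intro b hb hb2
    by_contra hb3
    exact H0 ⟨b, hb, hb3, hb2⟩
  apply hya
  set k := star a * a with hk
  have hks : IsSelfAdjoint k := IsSelfAdjoint.star_mul_self a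
  have hspec : ∀ t ∈ spectrum ℝ k, 0 ≤ t := spectrum_star_mul_self_nonneg
  have key : ∀ ε : ℝ, 0 < ε → y * a * cfc (fun t : ℝ => max (t - ε) 0) k = 0 := by
    intro ε hε
    set φ := cfc (fun t : ℝ => max (t - ε) 0) k with hφ
    have hmpos : ∀ t : ℝ, 0 < max t ε := fun t => lt_max_of_lt_right hε
    have hc1 : Continuous (fun t : ℝ => (√(max t ε))⁻¹) := by
      refine Continuous.inv₀ (by fun_prop) fun t => (Real.sqrt_pos.2 (hmpos t)).ne'
    have hc2 : Continuous (fun t : ℝ => (√(max t ε))⁻¹ * t) := hc1.mul continuous_id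
    have hc3 : Continuous (fun t : ℝ => (√(max t ε))⁻¹ * t * (√(max t ε))⁻¹) := hc2.mul hc1
    set κ := cfc (fun t : ℝ => (√(max t ε))⁻¹) k with hκ
    set μ := cfc (fun t : ℝ => √(max t ε)) k with hμ
    have hκs : star κ = κ := (IsSelfAdjoint.cfc : IsSelfAdjoint κ)
    have hφs : star φ = φ := (IsSelfAdjoint.cfc : IsSelfAdjoint φ)
    have h1 : κ * k * κ * φ = φ := by
      conv_lhs => rw [← cfc_id' ℝ k]
      rw [hκ, hφ, ← cfc_mul _ _ k hc1.continuousOn (by fun_prop),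
        ← cfc_mul _ _ k (hc2.continuousOn) hc1.continuousOn, ← cfc_mul _ _ k (hc3.continuousOn) (by fun_prop)]
      congr 1; ext t
      rcases le_total t ε with h | h
      · simp [max_eq_right (show t - ε ≤ 0 by linarith)]
      · rw [max_eq_left h]
        have h0 : 0 < t := lt_of_lt_of_le hε h
        have hs : √t * √t = t := Real.mul_self_sqrt h0.le
        have hs0 : √t ≠ 0 := (Real.sqrt_pos.2 h0).ne'
        have : (√t)⁻¹ * t * (√t)⁻¹ = 1 := by
          nth_rewrite 2 [← hs]; field_simp
        rw [this, one_mul]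
    have hcomm : κ * φ = φ * κ := (cfc_commute_cfc _ _ k).eq
    have hinv : κ * μ = 1 := by
      rw [hκ, hμ, ← cfc_mul _ _ k hc1.continuousOn (by fun_prop), ← cfc_one ℝ k]
      congr 1; ext t
      exact inv_mul_cancel₀ (Real.sqrt_pos.2 (hmpos t)).ne'
    obtain ⟨e, ⟨he1, he2⟩, he⟩ := aw_supp hA {φ}
    simp only [Set.mem_singleton_iff, forall_eq] at he
    have h2 : κ * k * κ * e = e := by
      have := (he (κ * k * κ - 1)).1 (by rw [sub_mul, h1, one_mul, sub_self])
      rw [sub_mul, one_mul, sub_eq_zero] at this; exact this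
    have h3 : e * φ = φ := by
      have := (he (1 - e)).2 (by rw [sub_mul, he2, one_mul, sub_self])
      rw [sub_mul, one_mul, sub_eq_zero] at this; exact this.symm
    have h4 : star (a * (κ * e)) * (a * (κ * e)) = e := by
      calc star (a * (κ * e)) * (a * (κ * e)) = e * (κ * k * κ * e) := by
            simp only [star_mul, hκs, he1, hk, mul_assoc]
        _ = e := by rw [h2, he2]
    have hkκ : k * κ = κ * k := by
      conv_lhs => rw [← cfc_id' ℝ k]
      conv_rhs => rw [← cfc_id' ℝ k]
      exact (cfc_commute_cfc _ _ k).eq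
    have h5 := H (κ * e) (by rw [h4]; exact ⟨he1, he2⟩) (by
      intro q hq haq
      have q1 : q * k = k := by
        have := congrArg star haq
        simp only [star_mul, hq] at this
        rw [hk, ← mul_assoc, this]
      have q2 : q * φ = φ := by
        rw [← h1, ← hkκ]; simp only [← mul_assoc, q1]
      have q3 := (he (q - 1)).1 (by rw [sub_mul, q2, one_mul, sub_self])
      rw [sub_mul, one_mul, sub_eq_zero] at q3
      have q4 := congrArg star q3
      simp only [star_mul, hq, he1] at q4
      simp only [mul_assoc, q4])
    have h6 : y * a * φ * κ = 0 := by
      calc y * a * φ * κ = y * (a * (κ * e)) * φ := by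
            rw [mul_assoc (y*a), ← hcomm]; conv_lhs => rw [← h3]
            simp only [mul_assoc]
        _ = 0 := by rw [h5, zero_mul]
    calc y * a * φ = y * a * φ * κ * μ := by rw [mul_assoc _ κ, hinv, mul_one]
      _ = 0 := by rw [h6, zero_mul]
  have hyk : y * a * k = 0 := by
    have hb : ∀ ε : ℝ, 0 < ε → ‖y * a * k‖ ≤ ‖y * a‖ * ε := by
      intro ε hε
      have : y * a * k = y * a * (k - cfc (fun t : ℝ => max (t - ε) 0) k) := by
        rw [mul_sub, key ε hε, sub_zero]
      rw [this]
      refine (norm_mul_le _ _).trans (mul_le_mul_of_nonneg_left ?_ (norm_nonneg _))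
      conv_lhs => enter [1, 1]; rw [← cfc_id' ℝ k]
      rw [← cfc_sub _ _ k (by fun_prop) (by fun_prop)]
      refine norm_cfc_le hε.le fun t ht => ?_
      have h0 := hspec t ht
      rw [Real.norm_eq_abs, abs_le]
      rcases le_total t ε with h | h
      · rw [max_eq_right (by linarith)]; constructor <;> linarith
      · rw [max_eq_left (by linarith)]; constructor <;> linarith
    have : ‖y * a * k‖ ≤ 0 := by
      have ht : Filter.Tendsto (fun ε : ℝ => ‖y * a‖ * ε) (nhdsWithin 0 (Set.Ioi 0)) (nhds (‖y * a‖ * 0)) :=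
        ((continuous_const.mul continuous_id).tendsto 0).mono_left nhdsWithin_le_nhds
      rw [mul_zero] at ht
      exact ge_of_tendsto ht (Filter.eventually_of_mem self_mem_nhdsWithin fun ε hε => hb ε hε)
    exact norm_le_zero_iff.1 this
  have h7 : star (star (y * a)) * star (y * a) = 0 := by
    have h8 : (y * a * star a) = 0 := by
      have : star (star (y * a * star a)) * star (y * a * star a) = 0 := by
        calc _ = y * a * k * (star a * star y) := by simp [hk, mul_assoc]
          _ = 0 := by rw [hyk, zero_mul]
      exact star_eq_zero.1 (CStarRing.star_mul_self_eq_zero_iff _ |>.1 this)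
    calc _ = y * a * star a * star y := by simp [mul_assoc]
      _ = 0 := by rw [h8, zero_mul]
  exact star_eq_zero.1 (CStarRing.star_mul_self_eq_zero_iff _ |>.1 h7)

theorem AWG.of_cstar (hA : IsAWStarRing A) : AWG A := by
  let : PartialOrder A := CStarAlgebra.spectralOrder A
  have : StarOrderedRing A := CStarAlgebra.spectralOrderedRing A
  refine ⟨aw_supp hA, cstar_pol hA, cstar_pm, fun a h => ?_, fun a h => CStarRing.star_mul_self_eq_zero_iff _ |>.1 h, ?_, ?_⟩
  · rw [← two_smul ℂ a] at h
    exact (smul_eq_zero.1 h).resolve_left two_ne_zero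
  · intro n v
    refine CStarAlgebra.nonneg_iff_eq_star_mul_self.1 (Finset.sum_nonneg fun i _ => star_mul_self_nonneg _)
  · intro n v h i
    have := (Finset.sum_eq_zero_iff_of_nonneg (fun i _ => star_mul_self_nonneg (v i))).1 h i (Finset.mem_univ _)
    exact CStarRing.star_mul_self_eq_zero_iff _ |>.1 this
end


theorem asc {R : Type*} [Semigroup R] {a b c : R} (h : a * b = c) (x : R) : a * (b * x) = c * x := by
  rw [← mul_assoc, h]

section
variable {A : Type u} [Ring A] [StarRing A]

theorem IsProjection.compl {p : A} (hp : IsProjection p) : IsProjection (1 - p) :=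
  ⟨by simp [hp.1], by simp [mul_sub, sub_mul, hp.2]⟩

theorem IsProjection.zero : IsProjection (0 : A) := ⟨by simp, by simp⟩
theorem IsProjection.one : IsProjection (1 : A) := ⟨by simp, by simp⟩

/-- flip `q * p = p` to `p * q = p` -/
theorem IsProjection.flip {p q : A} (hp : IsProjection p) (hq : IsProjection q) (h : q * p = p) :
    p * q = p := by
  have := congrArg star h
  simpa [hp.1, hq.1] using this

theorem IsProjection.flip0 {p q : A} (hp : IsProjection p) (hq : IsProjection q) (h : q * p = 0) :
    p * q = 0 := by
  have := congrArg star h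
  simpa [hp.1, hq.1] using this

theorem IsProjection.add {p q : A} (hp : IsProjection p) (hq : IsProjection q) (h : q * p = 0) :
    IsProjection (p + q) :=
  ⟨by simp [hp.1, hq.1], by simp [mul_add, add_mul, hp.2, hq.2, h, hp.flip0 hq h]⟩

theorem IsProjection.sub {p q : A} (hp : IsProjection p) (hq : IsProjection q) (h : q * p = p) :
    IsProjection (q - p) :=
  ⟨by simp [hp.1, hq.1], by simp [mul_sub, sub_mul, hp.2, hq.2, h, hp.flip hq h]⟩

theorem IsProjection.mul {p q : A} (hp : IsProjection p) (hq : IsProjection q) (h : q * p = p * q) :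
    IsProjection (p * q) :=
  ⟨by simp [hp.1, hq.1, h], by
    rw [mul_assoc, asc h, mul_assoc, hq.2, asc hp.2]⟩

theorem IsProjection.antisymm {p q : A} (hp : IsProjection p) (hq : IsProjection q) (h : q * p = p)
    (h2 : p * q = q) : p = q := by
  rw [← hp.flip hq h, h2]

variable (hA : AWG A)
include hA

noncomputable def AWG.L (S : Set A) : A := (hA.supp S).choose

theorem AWG.L_proj (S : Set A) : IsProjection (hA.L S) := (hA.supp S).choose_spec.1
theorem AWG.L_iff (S : Set A) (y : A) : (∀ s ∈ S, y * s = 0) ↔ y * hA.L S = 0 :=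
  (hA.supp S).choose_spec.2 y

theorem AWG.L_mul {S : Set A} {s : A} (hs : s ∈ S) : hA.L S * s = s := by
  have := (hA.L_iff S (1 - hA.L S)).2 (by rw [sub_mul, (hA.L_proj S).2, one_mul, sub_self]) s hs
  rw [sub_mul, one_mul, sub_eq_zero] at this; exact this.symm

theorem AWG.L_le {S : Set A} {q : A} (h : ∀ s ∈ S, q * s = s) : q * hA.L S = hA.L S := by
  have := (hA.L_iff S (q - 1)).1 fun s hs => by rw [sub_mul, h s hs, one_mul, sub_self]
  rw [sub_mul, one_mul, sub_eq_zero] at this; exact this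

theorem AWG.L_zero {S : Set A} {q : A} (h : ∀ s ∈ S, q * s = 0) : q * hA.L S = 0 :=
  (hA.L_iff S q).1 h

theorem AWG.L_comm {S : Set A} {q : A} (hq : star q = q) (h : ∀ s ∈ S, hA.L S * (q * s) = q * s) :
    q * hA.L S = hA.L S * q := by
  have h1 : (1 - hA.L S) * q * hA.L S = 0 := hA.L_zero fun s hs => by
    rw [sub_mul, one_mul, sub_mul, mul_assoc (hA.L S), h s hs, sub_self]
  have h2 : q * hA.L S = hA.L S * q * hA.L S := by
    rw [sub_mul, one_mul, sub_mul, sub_eq_zero] at h1; exact h1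
  have h3 := congrArg star h2
  simp only [star_mul, hq, (hA.L_proj S).1] at h3
  rw [h2, mul_assoc]; exact h3.symm

theorem AWG.pi {s : A} (h : IsProjection (star s * s)) : s * (star s * s) = s := by
  have := hA.proper (s - s * (star s * s)) (by
    have h2 := h.2
    have h2' : star s * (s * (star s * s)) = star s * s := by rw [← mul_assoc, h2]
    simp [mul_sub, sub_mul, mul_assoc, h2'])
  exact (sub_eq_zero.1 this).symm

theorem AWG.pi_star {s : A} (h : IsProjection (star s * s)) : star s * s * star s = star s := by
  have := congrArg star (hA.pi h)
  simpa [mul_assoc] using this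

theorem AWG.pi_proj {s : A} (h : IsProjection (star s * s)) : IsProjection (s * star s) :=
  ⟨by simp, by have := hA.pi_star h; rw [mul_assoc, ← mul_assoc (star s), this]⟩

theorem AWG.T0 {y a : A} (h : ∀ d b, IsProjection d → d = a * b → y * d = 0) : y * a = 0 := by
  by_contra hne
  obtain ⟨b, hb, hyb, -⟩ := hA.pol y a hne
  apply hyb
  have := h ((a * b) * star (a * b)) (b * star (a * b)) (hA.pi_proj hb) (by rw [mul_assoc])
  rw [← hA.pi hb, ← mul_assoc (a * b), ← mul_assoc, this, zero_mul]

theorem AWG.T1 {c p : A} (hc : IsProjection c) (hp : IsProjection p)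
    (H : ∀ d, IsProjection d → c * d = d → p * d = d → d = 0) :
    ∃ v, star v * v = c ∧ p * v = 0 ∧ ∀ q, q * c = c → q * p = p → q * v = v := by
  obtain ⟨x₁, x₂, s1, s2, hx, h12, h21, hcm⟩ := hA.pm (c - p) (by simp [hc.1, hp.1])
  obtain ⟨P1, P2⟩ := hA.L_proj {x₁}
  obtain ⟨N1, N2⟩ := hA.L_proj {x₂}
  have e1 : hA.L {x₁} * x₁ = x₁ := hA.L_mul rfl
  have e2 : hA.L {x₂} * x₂ = x₂ := hA.L_mul rfl
  have e3 : x₁ * hA.L {x₂} = 0 := hA.L_zero (by simpa using h12)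
  have e4 : x₂ * hA.L {x₁} = 0 := hA.L_zero (by simpa using h21)
  have hq0 : ∀ q, q * c = c → q * p = p → q * (hA.L {x₁}) = hA.L {x₁} ∧ q * (hA.L {x₂}) = hA.L {x₂} := by
    intro q h1 h2
    have e1' : x₁ * hA.L {x₁} = x₁ := by simpa [s1, P1] using congrArg star e1
    have e2' : x₂ * hA.L {x₂} = x₂ := by simpa [s2, N1] using congrArg star e2
    have h3 : q * (x₁ - x₂) = x₁ - x₂ := by rw [← hx, mul_sub, h1, h2]
    constructor
    · refine hA.L_le fun s hs => ?_
      rw [Set.mem_singleton_iff] at hs; subst hs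
      linear_combination (norm := noncomm_ring) h3 * hA.L {s} - q * e1' + q * e4 + e1' - e4
    · refine hA.L_le fun s hs => ?_
      rw [Set.mem_singleton_iff] at hs; subst hs
      linear_combination (norm := noncomm_ring) - h3 * hA.L {s} - q * e2' + q * e3 + e2' - e3
  have lk : ∀ y, y * (x₁ + x₂) = 0 → y * hA.L {x₁} = 0 ∧ y * hA.L {x₂} = 0 := by
    intro y h
    have e1' : x₁ * hA.L {x₁} = x₁ := by simpa [s1, P1] using congrArg star e1
    have e2' : x₂ * hA.L {x₂} = x₂ := by simpa [s2, N1] using congrArg star e2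
    constructor
    · refine hA.L_zero fun s hs => ?_
      rw [Set.mem_singleton_iff] at hs; subst hs
      linear_combination (norm := noncomm_ring) h * hA.L {s} - y * e1' - y * e4
    · refine hA.L_zero fun s hs => ?_
      rw [Set.mem_singleton_iff] at hs; subst hs
      linear_combination (norm := noncomm_ring) h * hA.L {s} - y * e2' - y * e3
  have e3' : hA.L {x₂} * x₁ = 0 := by simpa [s1, N1] using congrArg star e3
  have NP : hA.L {x₂} * hA.L {x₁} = 0 := hA.L_zero (by simpa using e3')
  generalize hA.L {x₁} = P at *
  generalize hA.L {x₂} = N at *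
  have e4' : P * x₂ = 0 := by simpa [s2, P1] using congrArg star e4
  have e1' : x₁ * P = x₁ := by simpa [s1, P1] using congrArg star e1
  have e2' : x₂ * N = x₂ := by simpa [s2, N1] using congrArg star e2
  have PN : P * N = 0 := by simpa [N1, P1] using congrArg star NP
  have hck := hcm c (by
    linear_combination (norm := noncomm_ring) p * hc.2 - hc.2 * p + c * hp.2 - hp.2 * c)
  have uk : (P - N) * (x₁ + x₂) = c - p := by
    rw [hx]; linear_combination (norm := noncomm_ring) e1 - e2 + e4' - e3'
  have lk' : ∀ y, y * (x₁ + x₂) = 0 → y * (P + N) = 0 := fun y h => by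
    rw [mul_add, (lk y h).1, (lk y h).2, add_zero]
  have Rk : (P + N) * (x₁ + x₂) = x₁ + x₂ := by
    linear_combination (norm := noncomm_ring) e1 + e2 + e4' + e3'
  have kR : (x₁ + x₂) * (P + N) = x₁ + x₂ := by
    linear_combination (norm := noncomm_ring) e1' + e2' + e4 + e3
  have cR1 : c * (P + N) = (P + N) * c * (P + N) := by
    have := lk' (c - (P + N) * c) (by
      linear_combination (norm := noncomm_ring) hck - (P + N) * hck - Rk * c)
    linear_combination (norm := noncomm_ring) this
  have cR : c * (P + N) = (P + N) * c := by
    have h3 := congrArg star cR1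
    simp only [star_mul, star_add, P1, N1, hc.1] at h3
    rw [cR1, mul_assoc]; exact h3.symm
  have uR : (P - N) * (P + N) = P - N := by
    linear_combination (norm := noncomm_ring) P2 - N2 + PN - NP
  have hucr := lk' ((P - N) * c - (1 - p) * (P - N)) (by
      linear_combination (norm := noncomm_ring) (P - N) * hck + uk * c - (1 - p) * uk + hc.2 - hp.2)
  have huc : (P - N) * c = (1 - p) * (P - N) := by
    linear_combination (norm := noncomm_ring) hucr - (P - N) * cR - uR * c + (1 - p) * uR
  have uu : (P - N) * (P - N) = P + N := by
    linear_combination (norm := noncomm_ring) P2 + N2 - PN - NP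
  have RR : (P + N) * (P + N) = P + N := by
    linear_combination (norm := noncomm_ring) P2 + N2 + PN + NP
  have hd : c - c * (P + N) = 0 := by
    refine H _ ⟨?_, ?_⟩ ?_ ?_
    · simp only [star_sub, star_mul, star_add, hc.1, P1, N1, cR]
    · linear_combination (norm := noncomm_ring) hc.2 + c * cR + c * c * RR - hc.2 * (P + N) - c * cR * (P + N)
    · linear_combination (norm := noncomm_ring) hc.2 - hc.2 * (P + N)
    · have hkd : (x₁ + x₂) * (c - c * (P + N)) = 0 := by
        linear_combination (norm := noncomm_ring) - (x₁ + x₂) * cR - kR * c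
      linear_combination (norm := noncomm_ring) - (P - N) * hkd + uk * (c - c * (P + N)) + hc.2 - hc.2 * (P + N)
  refine ⟨(P - N) * c, ?_, ?_, ?_⟩
  · simp only [star_sub, star_mul, hc.1, P1, N1]
    linear_combination (norm := noncomm_ring) c * uu * c - c * cR - hd + hc.2 * (P + N)
  · rw [huc]; linear_combination (norm := noncomm_ring) - hp.2 * (P - N)
  · intro q h1 h2
    obtain ⟨h3, h4⟩ := hq0 q h1 h2
    linear_combination (norm := noncomm_ring) h3 * c - h4 * c

theorem AWG.T2 {a b : A} (ha : IsProjection a) (hb : IsProjection b) (hab : b * a = 0) (W : Set A)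
    (hW : ∀ w ∈ W, IsProjection (star w * w) ∧ b * w = w ∧ w * a = w)
    (comp : ∀ w ∈ W, ∀ w' ∈ W, star w * w' = star w * w * (star w' * w')) :
    ∃ v, star v * v = hA.L ((fun w => star w * w) '' W) ∧ v * star v = hA.L ((fun w => w * star w) '' W) ∧
      (∀ w ∈ W, v * (star w * w) = w) ∧ b * v = v ∧ v * a = v := by
  have hba : a * b = 0 := ha.flip0 hb hab
  have aw : ∀ w ∈ W, a * star w = star w := fun w hw => by
    simpa [ha.1] using congrArg star (hW w hw).2.2
  have wb : ∀ w ∈ W, star w * b = star w := fun w hw => by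
    simpa [hb.1] using congrArg star (hW w hw).2.1
  have bw : ∀ w ∈ W, b * star w = 0 := fun w hw => by rw [← aw w hw, asc hab, zero_mul]
  have ww : ∀ w ∈ W, ∀ w' ∈ W, w * w' = 0 := fun w hw w' hw' => by
    rw [← (hW w hw).2.2, ← (hW w' hw').2.1, mul_assoc, asc hba, zero_mul, mul_zero]
  have ww' : ∀ w ∈ W, ∀ w' ∈ W, star w * star w' = 0 := fun w hw w' hw' => by
    rw [← star_mul, ww w' hw' w hw, star_zero]
  set E := hA.L ((fun w => star w * w) '' W) with hE
  set F := hA.L ((fun w => w * star w) '' W) with hF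
  set g := hA.L ((fun w => star w * w + w) '' W) with hg
  have Ep : IsProjection E := hA.L_proj _
  have Fp : IsProjection F := hA.L_proj _
  have gp : IsProjection g := hA.L_proj _
  have aE : a * E = E := hA.L_le (by
    rintro _ ⟨w, hw, rfl⟩; simp only; rw [asc (aw w hw)])
  have bF : b * F = F := hA.L_le (by
    rintro _ ⟨w, hw, rfl⟩; simp only; rw [asc (hW w hw).2.1])
  have abg : (a + b) * g = g := hA.L_le (by
    rintro _ ⟨w, hw, rfl⟩
    have h1 : a * w = 0 := by rw [← (hW w hw).2.1, asc hba, zero_mul]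
    simp only [add_mul, mul_add, asc (aw w hw), h1, asc (bw w hw), (hW w hw).2.1]; simp)
  have hge : ∀ w ∈ W, g * (star w * w + w) = star w * w + w := fun w hw =>
    hA.L_mul (Set.mem_image_of_mem _ hw)
  have sg : ∀ w ∈ W, (1 - b - b) * (star w * w + w) = star w * w - w := fun w hw => by
    linear_combination (norm := noncomm_ring) - bw w hw * w - bw w hw * w - (hW w hw).2.1 - (hW w hw).2.1
  have hge0 : ∀ w ∈ W, g * (star w * w - w) = 0 := fun w hw => by
    have h1 : star (star w * w - w) * g = 0 := hA.L_zero (by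
      rintro _ ⟨w', hw', rfl⟩
      simp only [star_sub, star_mul, star_star]
      have h2 := comp w hw w' hw'
      have h3 : star w * w * w' = 0 := by rw [mul_assoc, ww w hw w' hw', mul_zero]
      have h4 : star w * (star w' * w') = 0 := by rw [asc (ww' w hw w' hw'), zero_mul]
      linear_combination (norm := noncomm_ring) h3 - h2 - h4)
    simpa [gp.1] using congrArg star h1
  have gsg : g * (1 - b - b) * g = 0 := hA.L_zero (by
    rintro _ ⟨w', hw', rfl⟩
    simp only
    rw [mul_assoc, sg w' hw', hge0 w' hw'])
  have ss : (1 - b - b) * (1 - b - b) = 1 := by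
    linear_combination (norm := noncomm_ring) hb.2 + hb.2 + hb.2 + hb.2
  have sst : star (1 - b - b) = 1 - b - b := by simp [hb.1]
  set σ := 1 - b - b with hσ
  have gsg' : σ * g * σ * g = 0 := by
    linear_combination (norm := noncomm_ring) σ * gsg
  have Gp : IsProjection (g + σ * g * σ) := by
    refine gp.add ⟨by simp [sst, gp.1, mul_assoc], ?_⟩ gsg'
    linear_combination (norm := noncomm_ring) σ * g * ss * g * σ + σ * gp.2 * σ
  have FE : F * E = 0 := by
    have := Fp.flip hb bF
    rw [← this, ← aE, mul_assoc, asc hab, zero_mul, mul_zero]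
  have EFp : IsProjection (E + F) := Ep.add Fp FE
  have EF : E * F = 0 := Ep.flip0 Fp FE
  have hEF : (g + σ * g * σ) = E + F := by
    refine Gp.antisymm EFp ?_ ?_
    · have hg1 : (E + F) * g = g := hA.L_le (by
        rintro _ ⟨w, hw, rfl⟩
        have h1 : E * (star w * w) = star w * w := hA.L_mul (Set.mem_image_of_mem _ hw)
        have h2 : F * (w * star w) = w * star w := hA.L_mul (Set.mem_image_of_mem _ hw)
        have h3 := hA.pi (hW w hw).1
        have h4 : F * (star w * w) = 0 := by
          rw [← h1, asc FE, zero_mul]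
        have h5 : E * w = 0 := by
          rw [← h3, ← mul_assoc w, ← h2, asc (asc EF _), zero_mul, zero_mul]
        simp only
        linear_combination (norm := noncomm_ring) h1 + h4 + h5 + h2 * w - F * h3 + h3)
      have sEF : (E + F) * σ = σ * (E + F) := by
        have bE : b * E = 0 := by rw [← aE, asc hab, zero_mul]
        have Eb := Ep.flip0 hb bE
        have Fb := Fp.flip hb bF
        rw [hσ]
        linear_combination (norm := noncomm_ring) bE + bE + bF + bF - Eb - Eb - Fb - Fb
      linear_combination (norm := noncomm_ring) hg1 + sEF * g * σ + σ * hg1 * σ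
    · have h0 : ∀ w ∈ W, (1 - (g + σ * g * σ)) * (star w * w) = 0 ∧ (1 - (g + σ * g * σ)) * w = 0 := by
        intro w hw
        have h1 := hge w hw
        have h2 : (g + σ * g * σ) * (star w * w + w) = star w * w + w := by
          linear_combination (norm := noncomm_ring) h1 + σ * g * sg w hw + σ * hge0 w hw
        have sg' : star w * w + w = σ * (star w * w - w) := by
          linear_combination (norm := noncomm_ring) σ * sg w hw - ss * (star w * w + w)
        have h3 : (g + σ * g * σ) * (star w * w - w) = star w * w - w := by
          linear_combination (norm := noncomm_ring) hge0 w hw - σ * g * sg' + σ * h1 + sg w hw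
        constructor
        · apply hA.tor
          linear_combination (norm := noncomm_ring) - h2 - h3
        · apply hA.tor
          linear_combination (norm := noncomm_ring) - h2 + h3
      have h1 : (1 - (g + σ * g * σ)) * E = 0 := hA.L_zero (by
        rintro _ ⟨w, hw, rfl⟩; exact (h0 w hw).1)
      have h2 : (1 - (g + σ * g * σ)) * F = 0 := hA.L_zero (by
        rintro _ ⟨w, hw, rfl⟩; simp only; rw [asc (h0 w hw).2, zero_mul])
      linear_combination (norm := noncomm_ring) - h1 - h2
  have as : a * σ = a := by rw [hσ]; linear_combination (norm := noncomm_ring) - hba - hba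
  have sa : σ * a = a := by rw [hσ]; linear_combination (norm := noncomm_ring) - hab - hab
  have bs : b * σ = - b := by rw [hσ]; linear_combination (norm := noncomm_ring) - hb.2 - hb.2
  have sb : σ * b = - b := by rw [hσ]; linear_combination (norm := noncomm_ring) - hb.2 - hb.2
  have Ea := Ep.flip ha aE
  have Fb := Fp.flip hb bF
  have aFa : a * F = 0 := by rw [← bF, asc hba, zero_mul]
  have bE : b * E = 0 := by rw [← aE, asc hab, zero_mul]
  have aga : a * g * a + a * g * a = E := by
    linear_combination (norm := noncomm_ring) a * hEF * a - as * g * σ * a - a * g * sa + aE * a + Ea + aFa * a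
  have bgb : b * g * b + b * g * b = F := by
    linear_combination (norm := noncomm_ring) b * hEF * b - bs * g * σ * b + b * g * sb + bF * b + Fb + bE * b
  clear_value σ
  have gab : g * (a + b) = g := by
    simpa [gp.1, ha.1, hb.1] using congrArg star abg
  have hagbga : a * g * b * g * a = a * g * a - a * g * a * g * a := by
    linear_combination (norm := noncomm_ring) a * g * abg * a + a * gp.2 * a
  have hbgagb : b * g * a * g * b = b * g * b - b * g * b * g * b := by
    linear_combination (norm := noncomm_ring) b * g * abg * b + b * gp.2 * b
  refine ⟨b * g * a + b * g * a, ?_, ?_, ?_, ?_, ?_⟩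
  · simp only [star_add, star_mul, ha.1, hb.1, gp.1]
    linear_combination (norm := noncomm_ring) 4 * a * g * hb.2 * g * a + 4 * hagbga + 4 * a * g * ha.2 * g * a +
      2 * aga - (aga * (a * g * a + a * g * a) + E * aga + Ep.2)
  · simp only [star_add, star_mul, ha.1, hb.1, gp.1]
    linear_combination (norm := noncomm_ring) 4 * b * g * ha.2 * g * b + 4 * hbgagb + 4 * b * g * hb.2 * g * b +
      2 * bgb - (bgb * (b * g * b + b * g * b) + F * bgb + Fp.2)
  · intro w hw
    have h1 := hge w hw
    have h2 := hge0 w hw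
    have h3 := aw w hw
    linear_combination (norm := noncomm_ring) b * h1 + b * h2 + 2 * b * g * h3 * w + bw w hw * w + (hW w hw).2.1
  · linear_combination (norm := noncomm_ring) 2 * hb.2 * g * a
  · linear_combination (norm := noncomm_ring) 2 * b * g * ha.2
end


section
variable {A : Type u} [Ring A] [StarRing A] (hA : AWG A)
include hA

theorem AWG.pex {t : A} (ht : t ≠ 0) : ∃ b, IsProjection (star (t * b) * (t * b)) ∧ t * b ≠ 0 ∧
    ∀ q, star q = q → t * q = t → t * b * q = t * b := by
  obtain ⟨b, h1, h2, h3⟩ := hA.pol 1 t (by simpa using ht)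
  exact ⟨b, h1, by simpa using h2, h3⟩

theorem AWG.ext_add {m s : A} (hm : IsProjection (star m * m)) (hs : IsProjection (star s * s))
    (h1 : star m * s = 0) (h2 : s * star m = 0) :
    star (m + s) * (m + s) = star m * m + star s * s ∧ (m + s) * star (m + s) = m * star m + s * star s ∧
    IsProjection (star (m + s) * (m + s)) ∧ (m + s) * (star m * m) = m := by
  have h1' : star s * m = 0 := by simpa using congrArg star h1
  have h2' : m * star s = 0 := by simpa using congrArg star h2
  have e1 : star (m + s) * (m + s) = star m * m + star s * s := by
    rw [star_add]
    linear_combination (norm := noncomm_ring) h1 + h1'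
  refine ⟨e1, ?_, ?_, ?_⟩
  · rw [star_add]
    linear_combination (norm := noncomm_ring) h2 + h2'
  · rw [e1]
    refine hm.add hs ?_
    rw [mul_assoc, asc h2, zero_mul, mul_zero]
  · linear_combination (norm := noncomm_ring) hA.pi hm + h2 * m

theorem AWG.le_of_sandwich {e p : A} (he : IsProjection e) (hp : IsProjection p) (h : e * p * e = e) :
    p * e = e := by
  have := hA.proper ((1 - p) * e) (by
    simp only [star_mul, star_sub, star_one, he.1, hp.1]
    linear_combination (norm := noncomm_ring) he.2 + e * hp.2 * e - h)
  rw [sub_mul, one_mul, sub_eq_zero] at this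
  exact this.symm

/-- domain monotone under extension -/
theorem AWG.dom_le {w v : A} (hw : IsProjection (star w * w)) (hv : IsProjection (star v * v))
    (h : v * (star w * w) = w) : star v * v * (star w * w) = star w * w := by
  refine hA.le_of_sandwich hw hv ?_
  have h' : star w * w * star v = star w := by simpa using congrArg star h
  linear_combination (norm := noncomm_ring) h' * v * (star w * w) + star w * h

theorem AWG.zornPI (C : A → Prop) (hC : ∀ w, C w → IsProjection (star w * w))
    (hch : ∀ W : Set A, (∀ w ∈ W, C w) →
      (∀ w ∈ W, ∀ w' ∈ W, w' * (star w * w) = w ∨ w * (star w' * w') = w') →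
      ∃ v, C v ∧ ∀ w ∈ W, v * (star w * w) = w) :
    ∃ m, C m ∧ ∀ v, C v → v * (star m * m) = m → v = m := by
  obtain ⟨⟨m, hm⟩, hmax⟩ := exists_maximal_of_chains_bounded
    (r := fun (w w' : {w : A // C w}) => w'.1 * (star w.1 * w.1) = w.1) (by
      intro c hc
      obtain ⟨v, hv, hv2⟩ := hch (Subtype.val '' c) (by
        rintro _ ⟨w, hw, rfl⟩; exact w.2) (by
        rintro _ ⟨w, hw, rfl⟩ _ ⟨w', hw', rfl⟩
        by_cases heq : w = w'
        · subst heq; left; exact hA.pi (hC _ w.2)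
        · exact hc hw hw' heq)
      exact ⟨⟨v, hv⟩, fun a ha => hv2 _ ⟨a, ha, rfl⟩⟩) (by
      rintro ⟨a, ha⟩ ⟨b, hb⟩ ⟨c, hc⟩ h1 h2
      simp only at *
      rw [← hA.dom_le (hC _ ha) (hC _ hb) h1, asc h2, h1])
  refine ⟨m, hm, fun v hv h => ?_⟩
  have h2 := hmax ⟨v, hv⟩ h
  simp only at h2
  have h3 := hA.dom_le (hC _ hm) (hC _ hv) h
  have h4 := hA.dom_le (hC _ hv) (hC _ hm) h2
  have h5 := (hC _ hm).antisymm (hC _ hv) h3 h4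
  rw [← h2, ← h5, hA.pi (hC _ hm)]

omit hA in
theorem comp_chain {w w' : A}
    (h : w' * (star w * w) = w ∨ w * (star w' * w') = w') :
    star w * w' = star w * w * (star w' * w') := by
  rcases h with h | h
  · have h' : star w * w * star w' = star w := by simpa using congrArg star h
    linear_combination (norm := noncomm_ring) - h' * w'
  · linear_combination (norm := noncomm_ring) - star w * h

theorem AWG.L_central {S : Set A} (h : ∀ s ∈ S, ∀ a, a * s ∈ S) : IsCentralProj (hA.L S) := by
  refine ⟨hA.L_proj S, ?_⟩
  have hP := hA.L_proj S
  have h1 : ∀ x, hA.L S * x * hA.L S = x * hA.L S := by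
    intro x
    have := hA.L_zero (S := S) (q := (1 - hA.L S) * x) fun s hs => by
      rw [mul_assoc, sub_mul, one_mul, hA.L_mul (h s hs x), sub_self]
    linear_combination (norm := noncomm_ring) - this
  intro x
  have h2 := congrArg star (h1 (star x))
  simp only [star_mul, hP.1, star_star] at h2
  rw [← h2, ← mul_assoc]; exact h1 x

theorem AWG.GC {e f : A} (he : IsProjection e) (hf : IsProjection f) (hfe : f * e = 0) :
    ∃ z, IsCentralProj z ∧ (∃ v, star v * v = z * e ∧ z * f * v = v) ∧
      ∃ v, star v * v = (1 - z) * f ∧ (1 - z) * e * v = v := by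
  obtain ⟨m, ⟨hm, hm1, hm2⟩, hmax⟩ := hA.zornPI (fun w => IsProjection (star w * w) ∧ f * w = w ∧ w * e = w)
    (fun w h => h.1) (by
      intro W hW hch
      obtain ⟨v, h1, h2, h3, h4, h5⟩ := hA.T2 he hf hfe W hW (fun w hw w' hw' =>
        comp_chain (hch w hw w' hw'))
      exact ⟨v, ⟨by rw [h1]; exact hA.L_proj _, h4, h5⟩, h3⟩)
  have hm' := hA.pi_proj hm
  have hm1' : star m * f = star m := by simpa [hf.1] using congrArg star hm1
  have hm2' : e * star m = star m := by simpa [he.1] using congrArg star hm2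
  have ze : ∀ x, (f - m * star m) * x * (e - star m * m) = 0 := by
    intro x
    by_contra hne
    obtain ⟨b, hb, hb0, hbq⟩ := hA.pex hne
    have g1 : (f - m * star m) * (f - m * star m) = f - m * star m := by
      linear_combination (norm := noncomm_ring) hf.2 + hm'.2 - hm1 * star m - m * hm1'
    have g2 : star (e - star m * m) = e - star m * m := by simp [he.1]
    have g3 : (e - star m * m) * (e - star m * m) = e - star m * m := by
      linear_combination (norm := noncomm_ring) he.2 + hm.2 - hm2' * m - star m * hm2
    set s := (f - m * star m) * x * (e - star m * m) * b with hs
    have k1 : (f - m * star m) * s = s := by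
      rw [hs]; linear_combination (norm := noncomm_ring) g1 * x * (e - star m * m) * b
    have k2 : s * (e - star m * m) = s := hbq _ g2 (by rw [mul_assoc, g3])
    have c1 : star m * (f - m * star m) = 0 := by
      linear_combination (norm := noncomm_ring) hm1' - hA.pi_star hm
    have c2 : (e - star m * m) * star m = 0 := by
      linear_combination (norm := noncomm_ring) hm2' - hA.pi_star hm
    obtain ⟨x1, x2, x3, x4⟩ := hA.ext_add hm hb (by rw [← k1, asc c1, zero_mul]) (by
      rw [← k2, mul_assoc, c2, mul_zero])
    have := hmax (m + s) ⟨x3, by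
      linear_combination (norm := noncomm_ring) hm1 - f * k1 + k1 + hf.2 * s - hm1 * star m * s, by
      linear_combination (norm := noncomm_ring) hm2 - k2 * e + k2 + s * he.2 - s * star m * hm2⟩ x4
    exact hb0 (by simpa using this)
  have hZ := hA.L_central (S := {t | ∃ a, t = a * (e - star m * m)}) (by
    rintro _ ⟨a, rfl⟩ b; exact ⟨b * a, by rw [mul_assoc]⟩)
  have z1 : hA.L {t | ∃ a, t = a * (e - star m * m)} * (e - star m * m) = e - star m * m :=
    hA.L_mul ⟨1, by simp⟩
  have z2 : (f - m * star m) * hA.L {t | ∃ a, t = a * (e - star m * m)} = 0 := hA.L_zero (by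
    rintro _ ⟨a, rfl⟩; rw [← mul_assoc]; exact ze a)
  generalize hA.L {t | ∃ a, t = a * (e - star m * m)} = E at *
  have Ec := hZ.2
  refine ⟨1 - E, ⟨hZ.1.compl, fun a => by rw [sub_mul, mul_sub, Ec, one_mul, mul_one]⟩, ⟨(1 - E) * m, ?_, ?_⟩, star (E * m), ?_, ?_⟩
  · simp only [star_mul, hZ.1.compl.1]
    linear_combination (norm := noncomm_ring) star m * hZ.1.compl.2 * m + Ec (star m) * m + z1
  · linear_combination (norm := noncomm_ring) (1 - E) * (1 - E) * hm1 + (1 - E) * Ec f * m + hZ.1.compl.2 * m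
  · simp only [star_mul, hZ.1.1, star_star]
    linear_combination (norm := noncomm_ring) Ec (m * star m) * E - Ec f + m * star m * hZ.1.2 - z2
  · simp only [star_mul, hZ.1.1, star_star]
    linear_combination (norm := noncomm_ring) E * hm2' * E - E * Ec (star m) + hZ.1.2 * star m + Ec (star m)
end


section
variable {A : Type u} [Ring A] [StarRing A]

def Finf (z : A) : Prop := ∀ h : A, IsProjection h → z * h = h → ∀ V : ℕ → A,
  (∀ k, star (V k) * V k = h) → (∀ j k, j ≠ k → star (V j) * V k = 0) → h = 0

variable (hA : AWG A)
include hA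

theorem AWG.fin {z s v : A} (hz : Finf z) (hs : IsProjection s) (hzs : z * s = s)
    (h1 : star v * v = s) (h2 : s * v = v) : v * star v = s := by
  have hv : IsProjection (star v * v) := by rw [h1]; exact hs
  have hvv := hA.pi_proj hv
  have h3 : v * s = v := by rw [← h1]; exact hA.pi hv
  have h3' : s * star v = star v := by simpa [hs.1] using congrArg star h3
  have h4 : s * (v * star v) = v * star v := by rw [asc h2]
  have hd : IsProjection (s - v * star v) := hvv.sub hs h4
  let V : ℕ → A := fun k => v ^ k * (s - v * star v)
  have hV0 : V 0 = s - v * star v := by simp [V]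
  have hVs : ∀ k, V (k + 1) = v * V k := fun k => by simp [V, pow_succ', mul_assoc]
  have hsV : ∀ k, s * V k = V k := by
    intro k
    cases k with
    | zero => rw [hV0, mul_sub, hs.2, h4]
    | succ k => rw [hVs, asc h2]
  have key : ∀ j k, star (V (j + 1)) * V (k + 1) = star (V j) * V k := by
    intro j k
    rw [hVs, hVs, star_mul]
    linear_combination (norm := noncomm_ring) star (V j) * h1 * V k + star (V j) * hsV k
  have h0 : ∀ k, star (V 0) * V (k + 1) = 0 := by
    intro k
    rw [hVs, hV0, hd.1]
    linear_combination (norm := noncomm_ring) h2 * V k - v * h1 * V k - h3 * V k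
  have h0' : ∀ k, star (V (k + 1)) * V 0 = 0 := fun k => by
    simpa using congrArg star (h0 k)
  have horth : ∀ j k, j ≠ k → star (V j) * V k = 0 := by
    intro j
    induction j with
    | zero => intro k hk; cases k with
      | zero => exact absurd rfl hk
      | succ k => exact h0 k
    | succ j ih => intro k hk; cases k with
      | zero => exact h0' j
      | succ k => rw [key]; exact ih k (by omega)
  have hsq : ∀ k, star (V k) * V k = s - v * star v := by
    intro k
    induction k with
    | zero => rw [hV0, hd.1, hd.2]
    | succ k ih => rw [key, ih]
  have := hz _ hd (by rw [mul_sub, hzs, ← h4, asc hzs]) V hsq horth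
  exact (sub_eq_zero.1 this).symm

theorem AWG.canc {z p' p s w w1 : A} (hz : Finf z) (hp' : IsProjection p') (hs : IsProjection s)
    (hsp : s * p' = 0) (hzs : z * s = s) (hp : IsProjection p)
    (hpp : p' * p = p) (hw : star w * w = p) (hsw : s * w = w) (hw1 : star w1 * w1 = p') (hsw1 : s * w1 = w1) :
    ∃ v, star v * v = p' - p ∧ (s - w * star w) * v = v := by
  have hwP : IsProjection (star w * w) := by rw [hw]; exact hp
  have hww := hA.pi_proj hwP
  have hps := hp'.flip0 hs hsp
  have hsw' : star w * s = star w := by simpa [hs.1] using congrArg star hsw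
  have hsww : s * (w * star w) = w * star w := by rw [asc hsw]
  have hd : IsProjection (p' - p) := hp.sub hp' hpp
  have hs' : IsProjection (s - w * star w) := hww.sub hs hsww
  have hpp' := hp.flip hp' hpp
  have o1 : (s - w * star w) * (p' - p) = 0 := by
    have a1 : s * p = 0 := by rw [← hpp, asc hsp, zero_mul]
    linear_combination (norm := noncomm_ring) hsp - a1 - w * hsw' * (p - p') * (-1) * (-1) - w * star w * hsp + w * star w * a1
  obtain ⟨y, ⟨yp, yc⟩, ⟨α, α1, α2⟩, β, β1, β2⟩ := hA.GC hd hs' o1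
  have yp' : IsProjection (1 - y) := yp.compl
  have yc' : ∀ a, (1 - y) * a = a * (1 - y) := fun a => by rw [sub_mul, mul_sub, yc, one_mul, mul_one]
  have yy : y * (1 - y) = 0 := by rw [mul_sub, yp.2, mul_one, sub_self]
  have α3 : y * α = α := by rw [← α2]; linear_combination (norm := noncomm_ring) yp.2 * (s - w * star w) * α
  generalize hx : 1 - y = x at *
  have β1p : IsProjection (star β * β) := by
    rw [β1]; exact yp'.mul hs' (yc' _).symm
  have β3 : x * β = β := by rw [← β2]; linear_combination (norm := noncomm_ring) yp'.2 * (p' - p) * β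
  have β4 : β * (s - w * star w) = β := by
    have := hA.pi β1p
    rw [β1] at this
    linear_combination (norm := noncomm_ring) - this * (s - w * star w) + β * x * hs'.2 + this
  have wp : w * p = w := by rw [← hw]; exact hA.pi hwP
  have wp' : p * star w = star w := by simpa [hp.1] using congrArg star wp
  have βw : β * w = 0 := by
    linear_combination (norm := noncomm_ring) - β4 * w + β * hsw - β * w * hw - β * wp
  have βw' : star w * star β = 0 := by simpa using congrArg star βw
  have dβ : (p' - p) * β = β := by
    linear_combination (norm := noncomm_ring) - (p' - p) * β2 - yc' (p' - p) * (p' - p) * β + x * hd.2 * β + β2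
  have wβ : w * β = 0 := by
    linear_combination (norm := noncomm_ring) - w * dβ - wp * (p' - p) * β + w * hpp' * β - w * hp.2 * β
  have wβ' : star β * star w = 0 := by simpa using congrArg star wβ
  have p'β : p' * β = β := by
    linear_combination (norm := noncomm_ring) - p' * dβ + dβ + hp'.2 * β - hpp * β
  obtain ⟨X, hX⟩ : ∃ X, X = x * star w + β := ⟨_, rfl⟩
  have sX : star X = w * x + star β := by rw [hX]; simp [yp'.1]
  have hXX : star X * X = x * s := by
    rw [sX, hX]
    linear_combination (norm := noncomm_ring) w * yp'.2 * star w - yc' w * star w + β1 + w * β3 + wβ - star β * yc' (star w) * (-1) + wβ' * x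
  have hXX2 : X * star X = x * p + β * star β := by
    rw [sX, hX]
    linear_combination (norm := noncomm_ring) x * hw * x + x * βw' + βw * x - x * yc' p + yp'.2 * p
  have pX : p' * X = X := by
    rw [hX]
    linear_combination (norm := noncomm_ring) p'β - yc' p' * star w - x * p' * wp' + x * hpp * star w + x * wp'
  have Xp : star X * p' = star X := by simpa [hp'.1] using congrArg star pX
  have xX : x * X = X := by
    rw [hX]
    linear_combination (norm := noncomm_ring) yp'.2 * star w + β3
  have hT := hA.fin (z := z) (s := x * s) (v := w1 * X) hz (yp'.mul hs (yc' _).symm) (by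
      linear_combination (norm := noncomm_ring) hzs * x - yc' s + z * yc' s) (by
      rw [star_mul]
      linear_combination (norm := noncomm_ring) star X * hw1 * X + star X * pX + hXX) (by
      linear_combination (norm := noncomm_ring) x * hsw1 * X + yc' w1 * X + w1 * xX)
  have hXX3 : X * star X = x * p' := by
    rw [star_mul] at hT
    linear_combination (norm := noncomm_ring) - pX * star X - p' * X * Xp - hw1 * X * star X * p' - star w1 * w1 * X * star X * hw1 + star w1 * hT * w1 + star w1 * x * hsw1 - yc' (star w1) * w1 + x * hw1
  have sα : (s - w * star w) * α = α := by
    linear_combination (norm := noncomm_ring) - (s - w * star w) * α2 - yc (s - w * star w) * (s - w * star w) * α + y * hs'.2 * α + α2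
  have β4' : (s - w * star w) * star β = star β := by
    have := congrArg star β4
    rw [star_mul, hs'.1] at this; exact this
  have βα : β * α = 0 := by
    linear_combination (norm := noncomm_ring) - β3 * α + yc' β * α - β * x * α3 + β * yc' y * (-1) * α * (-1) + β * yy * α
  have βα' : star α * star β = 0 := by simpa using congrArg star βα
  refine ⟨α + star β, ?_, ?_⟩
  · simp only [star_add, star_star]
    linear_combination (norm := noncomm_ring) α1 + βα + βα' + hXX3 - hXX2 - hx * (p' - p)
  · rw [mul_add, sα, β4']
end


section
variable {A : Type u} [Ring A] [StarRing A] (hA : AWG A)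

noncomputable def AWG.PP {K : Type*} (u : K → A) (S : Set K) : A :=
  hA.L ((fun k => u k * star (u k)) '' S)

theorem AWG.PP_star {K : Type*} (u : K → A) (S : Set K) : star (hA.PP u S) = hA.PP u S := (hA.L_proj _).1

section
variable {K : Type*} {u : K → A} {h : A} (hh : IsProjection h) (hu : ∀ k, star (u k) * u k = h)
  (ho : ∀ j k, j ≠ k → star (u j) * u k = 0)
include hA hh hu ho

omit ho in
theorem AWG.uh (k : K) : u k * h = u k := by
  have := hA.pi (s := u k) (by rw [hu]; exact hh)
  rwa [hu] at this

omit ho in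
theorem AWG.PP_mem {S : Set K} {k : K} (hk : k ∈ S) : hA.PP u S * u k = u k := by
  have h1 : hA.PP u S * (u k * star (u k)) = u k * star (u k) := hA.L_mul ⟨k, hk, rfl⟩
  have h2 := hA.uh hh hu k
  linear_combination (norm := noncomm_ring) h1 * u k - hA.PP u S * u k * hu k - hA.PP u S * h2 + u k * hu k + h2

omit hh hu in
theorem AWG.PP_nmem {S : Set K} {k : K} (hk : k ∉ S) : hA.PP u S * u k = 0 := by
  have h1 : star (u k) * hA.PP u S = 0 := hA.L_zero (by
    rintro _ ⟨j, hj, rfl⟩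
    simp only
    rw [asc (ho k j (by rintro rfl; exact hk hj)), zero_mul])
  have := congrArg star h1
  rwa [star_mul, star_star, star_zero, show star (hA.PP u S) = hA.PP u S from (hA.L_proj _).1] at this

omit hh hu in
theorem AWG.PP_orth {S T : Set K} (hST : Disjoint S T) : hA.PP u S * hA.PP u T = 0 := by
  refine hA.L_zero ?_
  rintro _ ⟨j, hj, rfl⟩
  simp only
  rw [asc (hA.PP_nmem ho (fun h => hST.notMem_of_mem_left h hj)), zero_mul]

theorem AWG.T3 {J : Type*} {l r : J → K} (hl : Function.Injective l) (hr : Function.Injective r)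
    (hlr : ∀ i j, l i ≠ r j) :
    ∃ v, star v * v = hA.PP u (Set.range l) ∧ hA.PP u (Set.range r) * v = v := by
  classical
  have hdis : Disjoint (Set.range r) (Set.range l) := by
    rw [Set.disjoint_left]; rintro _ ⟨i, rfl⟩ ⟨j, hj⟩; exact hlr _ _ hj
  have hww : ∀ i, star (u (r i) * star (u (l i))) * (u (r i) * star (u (l i))) = u (l i) * star (u (l i)) := by
    intro i
    have := hA.uh hh hu (l i)
    simp only [star_mul, star_star]
    linear_combination (norm := noncomm_ring) u (l i) * hu (r i) * star (u (l i)) + this * star (u (l i))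
  obtain ⟨v, h1, h2, h3, h4, h5⟩ := hA.T2 (a := hA.PP u (Set.range l)) (b := hA.PP u (Set.range r))
    (hA.L_proj _) (hA.L_proj _) (hA.PP_orth ho hdis) (Set.range fun j => u (r j) * star (u (l j))) (by
      rintro _ ⟨i, rfl⟩
      refine ⟨?_, ?_, ?_⟩
      · simp only; rw [hww]; exact hA.pi_proj (by rw [hu]; exact hh)
      · simp only; rw [asc (hA.PP_mem hh hu (Set.mem_range_self i))]
      · have := congrArg star (hA.PP_mem hh hu (S := Set.range l) ⟨i, rfl⟩)
        simp only [star_mul] at this ⊢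
        rw [show star (hA.PP u (Set.range l)) = hA.PP u (Set.range l) from (hA.L_proj _).1] at this
        rw [mul_assoc, this]) (by
      rintro _ ⟨i, rfl⟩ _ ⟨j, rfl⟩
      simp only
      rw [hww, hww]
      simp only [star_mul, star_star]
      by_cases hij : i = j
      · subst hij
        linear_combination (norm := noncomm_ring) u (l i) * hu (r i) * star (u (l i)) - u (l i) * hu (l i) * star (u (l i))
      · have e1 := ho (r i) (r j) (fun h => hij (hr h))
        have e2 := ho (l i) (l j) (fun h => hij (hl h))
        linear_combination (norm := noncomm_ring) u (l i) * e1 * star (u (l j)) - u (l i) * e2 * star (u (l j)))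
  refine ⟨v, ?_, h4⟩
  rw [h1]
  unfold AWG.PP
  congr 1
  rw [← Set.range_comp, ← Set.range_comp]
  congr 1
  ext i
  exact hww i

theorem AWG.PP_union {S T : Set K} (hST : Disjoint S T) :
    hA.PP u (S ∪ T) = hA.PP u S + hA.PP u T := by
  have o := hA.PP_orth ho hST.symm
  have P : IsProjection (hA.PP u S + hA.PP u T) := IsProjection.add (hA.L_proj _) (hA.L_proj _) o
  refine IsProjection.antisymm (hA.L_proj _) P ?_ ?_
  · refine hA.L_le ?_
    rintro _ ⟨k, hk | hk, rfl⟩ <;> simp only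
    · rw [add_mul, asc (hA.PP_mem hh hu hk), asc (hA.PP_nmem ho (hST.notMem_of_mem_left hk))]; simp
    · rw [add_mul, asc (hA.PP_mem hh hu hk), asc (hA.PP_nmem ho (hST.notMem_of_mem_right hk))]; simp
  · rw [mul_add]
    congr 1
    · refine hA.L_le ?_
      rintro _ ⟨k, hk, rfl⟩; simp only; rw [asc (hA.PP_mem hh hu (Or.inl hk))]
    · refine hA.L_le ?_
      rintro _ ⟨k, hk, rfl⟩; simp only; rw [asc (hA.PP_mem hh hu (Or.inr hk))]
end

include hA in
theorem AWG.PI2 {I : Type*} (i0 : I) {u : I × ℕ → A} {h z t : A} (hh : IsProjection h)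
    (hu : ∀ k, star (u k) * u k = h)
    (ho : ∀ j k, j ≠ k → star (u j) * u k = 0) (ht : star t * t = z - hA.PP u Set.univ)
    (hht : h * t = t) :
    ∃ v1 v2, star v1 * v1 = z ∧ star v2 * v2 = z ∧ star v1 * v2 = 0 := by
  -- generic isometry construction
  have gen : ∀ c : ℕ, c < 2 → ∃ v, star v * v = z ∧
      hA.PP u {k | k.2 % 4 = 2 * c ∨ k.2 % 4 = (1 + 2 * c)} * v = v := by
    intro c hc
    obtain ⟨α, α1, α2⟩ := hA.T3 hh hu ho (J := I × ℕ) (l := fun k => (k.1, 2 * k.2))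
      (r := fun k => (k.1, 4 * (2 * k.2) + 1 + 2 * c)) (by
        rintro ⟨a, b⟩ ⟨a', b'⟩ h; simp at h ⊢; omega) (by
        rintro ⟨a, b⟩ ⟨a', b'⟩ h; simp at h ⊢; omega) (by
        rintro ⟨a, b⟩ ⟨a', b'⟩ h; simp at h; omega)
    obtain ⟨β, β1, β2⟩ := hA.T3 hh hu ho (J := I × ℕ) (l := fun k => (k.1, 2 * k.2 + 1))
      (r := fun k => (k.1, 4 * (2 * k.2 + 1) + 2 * c)) (by
        rintro ⟨a, b⟩ ⟨a', b'⟩ h; simp at h ⊢; omega) (by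
        rintro ⟨a, b⟩ ⟨a', b'⟩ h; simp at h ⊢; omega) (by
        rintro ⟨a, b⟩ ⟨a', b'⟩ h; simp at h; omega)
    have hγ : hA.PP u {(i0, 2 * c)} * (u (i0, 2 * c) * t) = u (i0, 2 * c) * t := by
      rw [asc (hA.PP_mem hh hu (Set.mem_singleton _))]
    have hγ2 : star (u (i0, 2 * c) * t) * (u (i0, 2 * c) * t) = z - hA.PP u Set.univ := by
      rw [star_mul, ← ht]
      linear_combination (norm := noncomm_ring) star t * hu (i0, 2 * c) * t + star t * hht
    generalize u (i0, 2 * c) * t = γ at hγ hγ2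
    have horth : ∀ {S T : Set (I × ℕ)} {x y : A}, Disjoint S T → hA.PP u S * x = x → hA.PP u T * y = y →
        star x * y = 0 ∧ star y * x = 0 := by
      intro S T x y hST hx hy
      have : star x * y = 0 := by
        rw [← hx, ← hy, star_mul, hA.PP_star, mul_assoc, asc (hA.PP_orth ho hST)]; simp
      exact ⟨this, by simpa using congrArg star this⟩
    obtain ⟨o1, o1'⟩ := horth (by
      rw [Set.disjoint_left]; rintro _ ⟨⟨a, b⟩, rfl⟩ ⟨⟨a', b'⟩, h⟩; simp at h; omega) α2 β2
    obtain ⟨o2, o2'⟩ := horth (by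
      rw [Set.disjoint_left]; rintro _ ⟨⟨a, b⟩, rfl⟩ h; simp at h) α2 hγ
    obtain ⟨o3, o3'⟩ := horth (by
      rw [Set.disjoint_left]; rintro _ ⟨⟨a, b⟩, rfl⟩ h; simp at h) β2 hγ
    have hun : hA.PP u Set.univ = hA.PP u (Set.range fun k : I × ℕ => (k.1, 2 * k.2)) +
        hA.PP u (Set.range fun k : I × ℕ => (k.1, 2 * k.2 + 1)) := by
      rw [← hA.PP_union hh hu ho (by
        rw [Set.disjoint_left]; rintro _ ⟨⟨a, b⟩, rfl⟩ ⟨⟨a', b'⟩, h⟩; simp at h; omega)]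
      congr 1
      symm
      rw [Set.eq_univ_iff_forall]
      rintro ⟨a, b⟩
      rcases Nat.even_or_odd' b with ⟨m, rfl | rfl⟩
      · left; exact ⟨(a, m), rfl⟩
      · right; exact ⟨(a, m), rfl⟩
    have mono : ∀ {S T : Set (I × ℕ)} {x : A}, S ⊆ T → hA.PP u S * x = x → hA.PP u T * x = x := by
      intro S T x hST hx
      have : hA.PP u T * hA.PP u S = hA.PP u S := hA.L_le (by
        rintro _ ⟨k, hk, rfl⟩; simp only; rw [asc (hA.PP_mem hh hu (hST hk))])
      rw [← hx, asc this]
    refine ⟨α + β + γ, ?_, ?_⟩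
    · simp only [star_add]
      linear_combination (norm := noncomm_ring) α1 + β1 + hγ2 - hun + o1 + o1' + o2 + o2' + o3 + o3'
    · rw [mul_add, mul_add, mono _ α2, mono _ β2, mono _ hγ]
      · rintro _ rfl; simp; omega
      · rintro _ ⟨⟨a, b⟩, rfl⟩; simp; omega
      · rintro _ ⟨⟨a, b⟩, rfl⟩; simp; omega
  obtain ⟨v, h1, h2⟩ := gen 0 (by omega)
  obtain ⟨w, h3, h4⟩ := gen 1 (by omega)
  refine ⟨v, w, h1, h3, ?_⟩
  rw [← h2, ← h4, star_mul, hA.PP_star, mul_assoc, asc (hA.PP_orth ho (by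
    rw [Set.disjoint_left]; rintro ⟨a, b⟩ h h'; simp at h h'; omega))]
  simp

include hA in
theorem AWG.PI {z0 : A} (hz0 : IsCentralProj z0) (hn : ¬ Finf z0) :
    ∃ z v1 v2, IsCentralProj z ∧ z ≠ 0 ∧ z0 * z = z ∧ star v1 * v1 = z ∧ star v2 * v2 = z ∧
      star v1 * v2 = 0 := by
  unfold Finf at hn
  push Not at hn
  obtain ⟨h, hh, hzh, V, hV, hVo, hne⟩ := hn
  have hinj : Function.Injective V := by
    intro j k hjk
    by_contra hjk'
    have := hVo j k hjk'
    rw [← hjk, hV] at this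
    exact hne this
  obtain ⟨S, hVS, hS⟩ := zorn_subset_nonempty
    {S : Set A | (∀ v ∈ S, star v * v = h) ∧ ∀ v ∈ S, ∀ w ∈ S, v ≠ w → star v * w = 0} (by
      intro c hc hch hcn
      refine ⟨⋃₀ c, ⟨?_, ?_⟩, fun s hs => Set.subset_sUnion_of_mem hs⟩
      · rintro v ⟨s, hs, hv⟩; exact (hc hs).1 v hv
      · rintro v ⟨s, hs, hv⟩ w ⟨s', hs', hw⟩ hvw
        rcases hch.total hs hs' with hss | hss
        · exact (hc hs').2 v (hss hv) w hw hvw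
        · exact (hc hs).2 v hv w (hss hw) hvw) (Set.range V) (by
      refine ⟨?_, ?_⟩
      · rintro _ ⟨k, rfl⟩; exact hV k
      · rintro _ ⟨j, rfl⟩ _ ⟨k, rfl⟩ hjk
        exact hVo j k (fun e => hjk (by rw [e])))
  obtain ⟨hS1, hS2⟩ := hS.prop
  have hSinf : Infinite S := by
    rw [Set.infinite_coe_iff]
    exact (Set.infinite_range_of_injective hinj).mono hVS
  have heq : Nonempty (S × ℕ ≃ S) := by
    rw [← Cardinal.eq]
    simp
  obtain ⟨φ⟩ := heq
  have Ep : IsProjection (hA.L ((fun v => v * star v) '' S)) := hA.L_proj _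
  have Ev : ∀ v ∈ S, hA.L ((fun v => v * star v) '' S) * v = v := by
    intro v hv
    have h1 : hA.L ((fun v => v * star v) '' S) * (v * star v) = v * star v := hA.L_mul ⟨v, hv, rfl⟩
    have h2 := hA.pi (s := v) (by rw [hS1 v hv]; exact hh)
    rw [← h2, ← mul_assoc v, asc h1]
  set E := hA.L ((fun v => v * star v) '' S) with hE
  have vE : ∀ v ∈ S, star v * E = star v := fun v hv => by
    simpa [Ep.1] using congrArg star (Ev v hv)
  have hV0 := hVS ⟨0, rfl⟩
  have hV0p : IsProjection (star (V 0) * V 0) := by rw [hV 0]; exact hh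
  obtain ⟨z, ⟨hz, hzc⟩, ⟨t, t1, t2⟩, x, x1, x2⟩ := hA.GC Ep.compl (hA.pi_proj hV0p) (by
    linear_combination (norm := noncomm_ring) - V 0 * vE _ hV0)
  have hVh : V 0 * h = V 0 := by have := hA.pi hV0p; rwa [hV 0] at this
  have hVh' : h * star (V 0) = star (V 0) := by simpa [hh.1] using congrArg star hVh
  have hzh0 : z * h ≠ 0 := by
    intro h0
    have y1 : star (x * V 0) * (x * V 0) = h := by
      rw [star_mul]
      linear_combination (norm := noncomm_ring) star (V 0) * x1 * V 0 + star (V 0) * V 0 * hV 0 + hV 0 * h + hh.2 + hzc (star (V 0)) * V 0 * star (V 0) * V 0 - z * hV 0 * (star (V 0) * V 0) - h0 * (star (V 0) * V 0)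
    have y2 : (1 - E) * x = x := by
      linear_combination (norm := noncomm_ring) - (1 - E) * x2 + hzc (1 - E) * (1 - E) * x + x2 + (1 - z) * Ep.2 * x
    have hmem : x * V 0 ∈ S := by
      have hle : S ⊆ insert (x * V 0) S := Set.subset_insert _ _
      have e0 : ∀ v ∈ S, star v * (x * V 0) = 0 := fun v hv => by
        linear_combination (norm := noncomm_ring) - star v * y2 * V 0 - vE v hv * x * V 0
      have := hS.le_of_ge (y := insert (x * V 0) S) ⟨?_, ?_⟩ hle
      · exact this (Set.mem_insert _ _)
      · rintro v (rfl | hv)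
        · exact y1
        · exact hS1 v hv
      · rintro v (rfl | hv) w (rfl | hw) hvw
        · exact absurd rfl hvw
        · simpa using congrArg star (e0 w hw)
        · exact e0 v hv
        · exact hS2 v hv w hw hvw
    have y3 := Ev _ hmem
    have y4 : x * V 0 = 0 := by
      linear_combination (norm := noncomm_ring) - y2 * V 0 - y3
    rw [y4] at y1
    exact hne (by rw [← y1]; simp)
  have hzhp : IsProjection (z * h) := hz.mul hh (hzc h).symm
  have hu : ∀ k : S × ℕ, star (z * (φ k).1) * (z * (φ k).1) = z * h := fun k => by
    have := hS1 _ (φ k).2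
    rw [star_mul, hz.1]
    linear_combination (norm := noncomm_ring) star (φ k).1 * hz.2 * (φ k).1 - hzc (star (φ k).1) * (φ k).1 + z * this
  have ho : ∀ j k : S × ℕ, j ≠ k → star (z * (φ j).1) * (z * (φ k).1) = 0 := fun j k hjk => by
    have := hS2 _ (φ j).2 _ (φ k).2 (fun e => hjk (φ.injective (Subtype.ext e)))
    rw [star_mul, hz.1]
    linear_combination (norm := noncomm_ring) star (φ j).1 * hz.2 * (φ k).1 - hzc (star (φ j).1) * (φ k).1 + z * this
  have hPP : hA.PP (fun k : S × ℕ => z * (φ k).1) Set.univ = z * E := by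
    refine IsProjection.antisymm (hA.L_proj _) (hz.mul Ep (hzc E).symm) ?_ ?_
    · refine hA.L_le ?_
      rintro _ ⟨k, -, rfl⟩
      simp only
      have := Ev _ (φ k).2
      linear_combination (norm := noncomm_ring) z * (hzc E).symm * (φ k).1 * star (z * (φ k).1) + hz.2 * E * (φ k).1 * star (z * (φ k).1) + z * this * star (z * (φ k).1)
    · have := hA.L_zero (S := (fun v => v * star v) '' S)
        (q := hA.PP (fun k : S × ℕ => z * (φ k).1) Set.univ * z - z) (by
          rintro _ ⟨v, hv, rfl⟩
          have h1 := hA.PP_mem hzhp hu (k := φ.symm ⟨v, hv⟩) (Set.mem_univ _)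
          simp only [Equiv.apply_symm_apply] at h1
          simp only
          linear_combination (norm := noncomm_ring) h1 * star v)
      linear_combination (norm := noncomm_ring) this
  have zt : z * t = t := by linear_combination (norm := noncomm_ring) hz.2 * V 0 * star (V 0) * t - z * t2 + t2
  have ht0 : V 0 * star (V 0) * t = t := by
    linear_combination (norm := noncomm_ring) t2 - hzc (V 0 * star (V 0)) * t - V 0 * star (V 0) * zt
  obtain ⟨v1, v2, e1, e2, e3⟩ := hA.PI2 (⟨V 0, hV0⟩ : S) (z := z) (t := star (V 0) * t) hzhp hu ho (by
      rw [hPP, star_mul, star_star]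
      linear_combination (norm := noncomm_ring) star t * ht0 + t1) (by
      linear_combination (norm := noncomm_ring) z * hVh' * t + hzc (star (V 0)) * t + star (V 0) * zt)
  have hc := hz0.2
  refine ⟨z * z0, v1 * z0, v2 * z0, ⟨hz.mul hz0.1 (hc z), ?_⟩, ?_, ?_, ?_, ?_, ?_⟩
  · intro a; linear_combination (norm := noncomm_ring) z * hc a + hzc a * z0
  · intro h0
    apply hzh0
    linear_combination (norm := noncomm_ring) h0 * h - z * hzh
  · linear_combination (norm := noncomm_ring) hc z * z0 + z * hz0.1.2
  · rw [star_mul, hz0.1.1]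
    linear_combination (norm := noncomm_ring) z0 * e1 * z0 + hc z * z0 + z * hz0.1.2
  · rw [star_mul, hz0.1.1]
    linear_combination (norm := noncomm_ring) z0 * e2 * z0 + hc z * z0 + z * hz0.1.2
  · rw [star_mul, hz0.1.1]
    linear_combination (norm := noncomm_ring) z0 * e3 * z0
end


section
variable {A : Type u} [Ring A] [StarRing A]

structure Room (z ε r : A) : Prop where
  ep : IsProjection ε
  rr : star r * r = ε
  er : ε * r = 0
  ze : z * ε = ε
  zr : z * r = r

variable (hA : AWG A)
include hA

theorem AWG.CC {z ε r : A} (hz : Finf z) (hr : Room z ε r) (P : Set A)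
    (hP : ∀ p ∈ P, IsProjection p ∧ ε * p = p)
    (hch : ∀ p ∈ P, ∀ p' ∈ P, p' * p = p ∨ p * p' = p')
    {c : A} (hc : IsProjection c) (hc0 : c ≠ 0) (hcQ : hA.L P * c = c) :
    ∃ p ∈ P, ∃ c', IsProjection c' ∧ c' ≠ 0 ∧ c * c' = c' ∧ p * c' = c' := by
  obtain ⟨ep, rr, er, ze, zr⟩ := hr
  by_contra hcon
  have H : ∀ p ∈ P, ∀ d, IsProjection d → c * d = d → p * d = d → d = 0 := by
    intro p hp d hd h1 h2
    by_contra h0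
    exact hcon ⟨p, hp, d, hd, h0, h1, h2⟩
  have re : r * ε = r := by
    have := hA.pi (s := r) (by rw [rr]; exact ep)
    rwa [rr] at this
  have er' : star r * ε = 0 := by simpa [ep.1] using congrArg star er
  have re' : ε * star r = star r := by simpa [ep.1] using congrArg star re
  have hQ : IsProjection (hA.L P) := hA.L_proj P
  have hεQ : ε * hA.L P = hA.L P := hA.L_le fun p hp => (hP p hp).2
  have hPQ : ∀ p ∈ P, hA.L P * p = p := fun p hp => hA.L_mul hp
  obtain ⟨Q, hQe⟩ : ∃ Q, Q = hA.L P := ⟨_, rfl⟩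
  rw [← hQe] at hQ hεQ hPQ hcQ
  have hQε : Q * ε = Q := hQ.flip ep hεQ
  have hcQ' : c * Q = c := hc.flip hQ hcQ
  have rQ : star r * Q = 0 := by rw [← hεQ, asc er', zero_mul]
  have hs1 : IsProjection (r * Q * star r) := ⟨by simp [hQ.1, mul_assoc], by
    linear_combination (norm := noncomm_ring) r * Q * rr * Q * star r + r * hQε * Q * star r + r * hQ.2 * star r⟩
  have hs0 : IsProjection (r * (Q - c) * star r) := ⟨by simp [hQ.1, hc.1, mul_assoc], by
    linear_combination (norm := noncomm_ring) r * (Q - c) * rr * (Q - c) * star r + r * hQε * (Q - c) * star r + r * hQ.2 * star r + r * hc.2 * star r - r * hcQ * star r - r * hcQ' * star r - r * c * hεQ * star r + r * c * hεQ * c * star r + (r * c * Q - r * c * ε) * hcQ * star r + r * c * hcQ * star r - r * c * hQ.2 * c * star r⟩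
  have hsQ : r * (Q - c) * star r * Q = 0 := by
    linear_combination (norm := noncomm_ring) r * (Q - c) * rQ
  have hs0r : ∀ x, r * (Q - c) * star r * x = x → r * star r * x = x := by
    intro x hx
    rw [← hx]
    linear_combination (norm := noncomm_ring) r * rr * (Q - c) * star r * x + re * (Q - c) * star r * x
  have hzs0 : z * (r * (Q - c) * star r) = r * (Q - c) * star r := by
    linear_combination (norm := noncomm_ring) zr * (Q - c) * star r
  have hzs1 : z * (r * Q * star r) = r * Q * star r := by
    linear_combination (norm := noncomm_ring) zr * Q * star r
  have stepA : ∀ p ∈ P, ∃ w, star w * w = p ∧ r * (Q - c) * star r * w = w := by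
    intro p hp
    obtain ⟨v, v1, v2, v3⟩ := hA.T1 hc (hP p hp).1 (H p hp)
    have v3 := v3 Q hcQ (hPQ p hp)
    have v4 : c * star v = star v := by
      have := hA.pi_star (s := v) (by rw [v1]; exact hc)
      rwa [v1] at this
    have v2' : star v * p = 0 := by simpa [(hP p hp).1.1] using congrArg star v2
    have v3' : star v * Q = star v := by simpa [hQ.1] using congrArg star v3
    have v5 : v * c = v := by simpa [hc.1] using congrArg star v4
    have vε : v * ε = v := by
      linear_combination (norm := noncomm_ring) - v5 * ε - v * hcQ' * ε + v * c * hQε + v * hcQ' + v5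
    obtain ⟨y, y1, y2⟩ := hA.canc (z := z) (p' := Q) (s := r * Q * star r) (p := v * star v) (w := r * star v)
      (w1 := r * Q) hz hQ hs1 (by linear_combination (norm := noncomm_ring) r * Q * rQ) hzs1
      (hA.pi_proj (by rw [v1]; exact hc)) (by rw [asc v3]) (by
        simp only [star_mul, star_star]
        linear_combination (norm := noncomm_ring) v * rr * star v + vε * star v)
      (by linear_combination (norm := noncomm_ring) r * Q * rr * star v + r * hQε * star v + r * hcQ * star v - r * Q * v4 + r * v4)
      (by
        simp only [star_mul, hQ.1]
        linear_combination (norm := noncomm_ring) Q * rr * Q + hQε * Q + hQ.2)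
      (by linear_combination (norm := noncomm_ring) r * Q * rr * Q + r * hQε * Q + r * hQ.2)
    have hpp := (hP p hp).1
    refine ⟨y * p, ?_, ?_⟩
    · simp only [star_mul, hpp.1]
      linear_combination (norm := noncomm_ring) p * y1 * p + p * hPQ p hp - p * v * v2' + hpp.2
    · rw [star_mul, star_star] at y2
      linear_combination (norm := noncomm_ring) y2 * p + r * v1 * star r * y * p
  obtain ⟨m, ⟨hm, hm1, hm2, hm3⟩, hmax⟩ := hA.zornPI (fun w => IsProjection (star w * w) ∧ w * Q = w ∧
      r * (Q - c) * star r * w = w ∧ ∀ p ∈ P, star w * w * p = p ∨ p * (star w * w) = star w * w)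
    (fun w h => h.1) (by
      intro W hW hchW
      obtain ⟨v, h1, h2, h3, h4, h5⟩ := hA.T2 hQ hs0 hsQ W (fun w hw => ⟨(hW w hw).1, (hW w hw).2.2.1, (hW w hw).2.1⟩)
        (fun w hw w' hw' => comp_chain (hchW w hw w' hw'))
      refine ⟨v, ⟨by rw [h1]; exact hA.L_proj _, h5, h4, ?_⟩, h3⟩
      intro p hp
      rw [h1]
      by_cases hall : ∀ w ∈ W, p * (star w * w) = star w * w
      · right
        apply hA.L_le
        rintro _ ⟨w, hw, rfl⟩
        exact hall w hw
      · left
        push Not at hall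
        obtain ⟨w, hw, hne⟩ := hall
        have h6 := ((hW w hw).2.2.2 p hp).resolve_right hne
        have h7 := hA.L_mul (Set.mem_image_of_mem (fun w => star w * w) hw)
        rw [← h6, asc h7])
  obtain ⟨e, he⟩ : ∃ e, star m * m = e := ⟨_, rfl⟩
  rw [he] at hm hm3 hmax
  have hme : m * e = m := by
    have := hA.pi (s := m) (by rw [he]; exact hm)
    rwa [he] at this
  have hQm : Q * star m = star m := by simpa [hQ.1] using congrArg star hm1
  have heP : ∀ p ∈ P, e * p = p := by
    intro p hp
    by_contra hne
    have hpe := (hm3 p hp).resolve_left hne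
    have hpp := (hP p hp).1
    have hep := hm.flip hpp hpe
    obtain ⟨w1, w11, w12⟩ := stepA p hp
    obtain ⟨y, y1, y2⟩ := hA.canc (z := z) (p' := p) (s := r * (Q - c) * star r) (p := e) (w := m)
      (w1 := w1) hz hpp hs0 (by rw [← hPQ p hp, asc hsQ, zero_mul]) hzs0 hm hpe he hm2 w11 w12
    have hyP : IsProjection (star y * y) := by rw [y1]; exact hm.sub hpp hpe
    have hm2' : star m * (r * (Q - c) * star r) = star m := by
      have := congrArg star hm2
      rwa [star_mul, hs0.1] at this
    have ye : y * (p - e) = y := by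
      have := hA.pi hyP
      rwa [y1] at this
    have a1 : star m * y = 0 := by
      have hme' : e * star m = star m := by simpa [hm.1] using congrArg star hme
      linear_combination (norm := noncomm_ring) - star m * y2 + hm2' * y - he * star m * y - hme' * y
    have a2 : y * star m = 0 := by
      have hme' : e * star m = star m := by simpa [hm.1] using congrArg star hme
      linear_combination (norm := noncomm_ring) - ye * star m - y * p * hme' + y * hpe * star m
    obtain ⟨b1, b2, b3, b4⟩ := hA.ext_add (by rw [he]; exact hm) hyP a1 a2
    have hs0y : r * (Q - c) * star r * y = y := by
      have hs2 := hs0.2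
      linear_combination (norm := noncomm_ring) - r * (Q - c) * star r * y2 + hs2 * y - hm2 * star m * y + y2
    have hdom : star (m + y) * (m + y) = p := by rw [b1, he, y1]; abel
    have := hmax (m + y) ⟨b3, by
      rw [add_mul, hm1, ← ye, mul_assoc, sub_mul, hpp.flip hQ (hPQ p hp)]
      have : e * Q = e := by rw [← he, mul_assoc, hm1]
      rw [this], by rw [mul_add, hm2, hs0y], by
      intro p' hp'
      rw [hdom]
      exact hch p' hp' p hp⟩ (by rw [← he]; exact b4)
    rw [this, he] at hdom
    exact hne (by rw [hdom]; exact hpp.2)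
  have heQ : e = Q := by
    refine hm.antisymm hQ (by rw [← he, asc hQm]) ?_
    rw [hQe]; exact hA.L_le heP
  rw [heQ] at he
  have u0 : (Q - c) * (star r * m) = star r * m := by
    linear_combination (norm := noncomm_ring) star r * hm2 * (-1) * (-1) - rr * (Q - c) * star r * m - hεQ * star r * m + ε * hcQ * star r * m * (-1) + hεQ * c * star r * m + hcQ * star r * m + star r * hm2 * 0
  have u1 : Q * (star r * m) = star r * m := by
    linear_combination (norm := noncomm_ring) - Q * u0 + hQ.2 * star r * m - hcQ * star r * m + u0
  have cu : c * (star r * m) = 0 := by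
    linear_combination (norm := noncomm_ring) u1 - u0
  have := hA.fin hz hQ (s := Q) (v := star r * m) (by rw [← hεQ, asc ze]) (by
    simp only [star_mul, star_star]
    linear_combination (norm := noncomm_ring) star m * hs0r m hm2 + he) u1
  apply hc0
  rw [← hcQ', ← this, asc cu, zero_mul]
end


section
variable {A : Type u} [Ring A] [StarRing A]
variable (hA : AWG A)
include hA

theorem AWG.exproj {w : A} (hw : w ≠ 0) : ∃ d b, IsProjection d ∧ d = w * b ∧ d ≠ 0 := by
  by_contra hcon
  apply hw
  have := hA.T0 (y := 1) (a := w) fun d b hd hb => by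
    by_contra h0
    exact hcon ⟨d, b, hd, hb, by simpa using h0⟩
  simpa using this

theorem AWG.lemE {z ε r : A} (hz : Finf z) (hr : Room z ε r) (G : Set A)
    (hadd : ∀ x ∈ G, ∀ y ∈ G, x + y ∈ G) (hmul : ∀ x ∈ G, ∀ a, x * a ∈ G)
    (hGε : ∀ x ∈ G, ε * x = x) {c : A} (hc : IsProjection c) (hc0 : c ≠ 0)
    (hy : ∀ y, (∀ g ∈ G, y * g = 0) → y * c = 0) : ∃ g ∈ G, g ≠ 0 ∧ c * g = g := by
  obtain ⟨q, ⟨hq, hεq, hqG⟩, hmax⟩ := hA.zornPI (fun q => IsProjection q ∧ ε * q = q ∧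
      ∀ c, IsProjection c → c ≠ 0 → q * c = c → ∃ g ∈ G, g ≠ 0 ∧ c * g = g)
    (fun q h => by rw [h.1.1, h.1.2]; exact h.1) (by
      intro W hW hch
      have hsq : ∀ w ∈ W, star w * w = w := fun w hw => by rw [(hW w hw).1.1, (hW w hw).1.2]
      refine ⟨hA.L W, ⟨hA.L_proj W, hA.L_le fun w hw => (hW w hw).2.1, ?_⟩, fun w hw => by
        rw [hsq w hw, hA.L_mul hw]⟩
      intro c hc hc0 hcL
      obtain ⟨p, hp, c', h1, h2, h3, h4⟩ := hA.CC hz hr W (fun p hp => ⟨(hW p hp).1, (hW p hp).2.1⟩)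
        (fun p hp p' hp' => by
          have := hch p hp p' hp'
          rwa [hsq p hp, hsq p' hp'] at this) hc hc0 hcL
      obtain ⟨g, g1, g2, g3⟩ := (hW p hp).2.2 c' h1 h2 h4
      exact ⟨g, g1, g2, by rw [← g3, asc h3]⟩)
  have hx0 : ∀ x ∈ G, (1 - q) * x = 0 := by
    intro x hx
    by_contra hne
    obtain ⟨f, b, hf, hfb, hf0⟩ := hA.exproj hne
    have hqf : q * f = 0 := by
      rw [hfb]; linear_combination (norm := noncomm_ring) - hq.2 * x * b
    have hfq := hf.flip0 hq hqf
    have hqf' : IsProjection (q + f) := hq.add hf hfq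
    have := hmax (q + f) ⟨hqf', by
      rw [mul_add, hεq]
      congr 1
      rw [hfb]; linear_combination (norm := noncomm_ring) hGε x hx * b - hεq * x * b, by
      intro c hc hc0 hcq
      have hw : c = x * b * c + q * (c - x * b * c) := by
        rw [hfb] at hcq
        linear_combination (norm := noncomm_ring) - hcq
      by_cases hw0 : q * (c - x * b * c) = 0
      · rw [hw0, add_zero] at hw
        exact ⟨c, by rw [hw, mul_assoc]; exact hmul x hx _, hc0, hc.2⟩
      · obtain ⟨d, a, hd, hda, hd0⟩ := hA.exproj hw0
        obtain ⟨g, g1, g2, g3⟩ := hqG d hd hd0 (by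
          rw [hda, mul_assoc, asc hq.2])
        have key : q * (c - x * b * c) * a * g = g := by rw [← hda]; exact g3
        refine ⟨c * a * g, ?_, ?_, ?_⟩
        · have : c * a * g = x * (b * c * a * g) + g := by
            linear_combination (norm := noncomm_ring) hw * a * g + key
          rw [this]
          exact hadd _ (hmul x hx _) _ g1
        · intro h0
          apply g2
          have e1 : q * (c - x * b * c) * a * g = q * (1 - x * b) * (c * a * g) := by noncomm_ring
          rw [← key, e1, h0, mul_zero]
        · rw [mul_assoc, asc hc.2]⟩ (by rw [hq.1, hq.2, add_mul, hq.2, hfq, add_zero])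
    apply hf0
    simpa using this
  have := hy (1 - q) hx0
  exact hqG c hc hc0 (by rw [sub_mul, one_mul, sub_eq_zero] at this; exact this.symm)
end


section
variable {A : Type u} [Ring A] [StarRing A]

def Good (ε : A) : Prop := ∀ h : A, IsProjection h → h ≠ 0 → ∀ Γ : Set (A × A),
  (∀ p ∈ Γ, ∀ q ∈ Γ, p + q ∈ Γ) → (∀ p ∈ Γ, ∀ a, (p.1 * a, p.2 * a) ∈ Γ) →
  (∀ x, (x, 0) ∈ Γ → x = 0) → (∀ p ∈ Γ, h * p.1 = p.1 ∧ ε * p.2 = p.2) →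
  ∃ u v : A, u ≠ 0 ∧ u * h = u ∧ ∀ p ∈ Γ, u * p.1 = v * p.2

variable (hA : AWG A)
include hA

theorem AWG.cancR {Γ : Set (A × A)} (hmul : ∀ p ∈ Γ, ∀ a, (p.1 * a, p.2 * a) ∈ Γ)
    (h0 : ∀ x, (x, 0) ∈ Γ → x = 0) {x b : A} (hx : (x, b) ∈ Γ) {y y' : A}
    (h : (y * x + y' * b) * star b = 0) : y * x + y' * b = 0 := by
  have hR := hA.L_proj {star b}
  have e1 : hA.L {star b} * star b = star b := hA.L_mul rfl
  have e2 : b * hA.L {star b} = b := by simpa [hR.1] using congrArg star e1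
  have e3 := h0 (x * (1 - hA.L {star b})) (by
    have := hmul _ hx (1 - hA.L {star b})
    simp only at this
    rwa [mul_sub b, mul_one, e2, sub_self] at this)
  have e4 := (hA.L_iff {star b} (y * x + y' * b)).1 (by simpa using h)
  linear_combination (norm := noncomm_ring) e4 + y * e3 - y' * e2

theorem AWG.good_room {z ε ε2 w r : A} (hz : Finf z) (hε : IsProjection ε)
    (hw : star w * w = ε) (hw2 : w * star w = ε2) (ho : ε2 * ε = 0)
    (hr : Room z (ε + ε2) r) : Good ε := by
  intro h hh hh0 Γ hadd hmul h0 hp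
  by_cases hall : ∀ p ∈ Γ, p.1 = 0
  · exact ⟨h, 0, hh0, hh.2, fun p hp => by rw [hall p hp]; simp⟩
  push Not at hall
  obtain ⟨⟨x, b⟩, hxb, hx⟩ := hall
  simp only at hx
  have hX : x * star b ≠ 0 := fun h => hx (by
    simpa using hA.cancR hmul h0 hxb (y := 1) (y' := 0) (by simpa using h))
  have hεb : ε * b = b := (hp _ hxb).2
  have hhx : h * x = x := (hp _ hxb).1
  have hxh : star x * h = star x := by simpa [hh.1] using congrArg star hhx
  have hbε : star b * ε = star b := by simpa [hε.1] using congrArg star hεb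
  have hε2 : IsProjection ε2 := by rw [← hw2]; exact hA.pi_proj (by rw [hw]; exact hε)
  have ho' : ε * ε2 = 0 := hε.flip0 hε2 ho
  have hwε : w * ε = w := by
    have := hA.pi (s := w) (by rw [hw]; exact hε)
    rwa [hw] at this
  have hε2w : ε2 * w = w := by rw [← hw2, mul_assoc, hw, hwε]
  have ht : w * b * star x ≠ 0 := by
    intro h
    apply hX
    have h' : b * star x = 0 := by
      linear_combination (norm := noncomm_ring) star w * h - hw * b * star x - hεb * star x
    simpa using congrArg star h'
  obtain ⟨b0, s1, s2, s3⟩ := hA.pex ht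
  have hsh := s3 h hh.1 (by rw [mul_assoc, hxh])
  have hεs : ε2 * (w * b * star x * b0) = w * b * star x * b0 := by
    linear_combination (norm := noncomm_ring) hε2w * b * star x * b0
  generalize w * b * star x * b0 = s at *
  have hεs' : ε * s = 0 := by rw [← hεs, asc ho', zero_mul]
  have hc := hA.pi_proj s1
  have hc0 : s * star s ≠ 0 := by
    intro h; apply s2
    rw [← hA.pi s1, ← mul_assoc, h, zero_mul]
  by_contra hcon
  obtain ⟨g, ⟨⟨x', b'⟩, hg, rfl⟩, hg0, hcg⟩ := hA.lemE hz hr ((fun p : A × A => s * p.1 + p.2) '' Γ) (by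
      rintro _ ⟨p, hp, rfl⟩ _ ⟨q, hq, rfl⟩
      refine ⟨p + q, hadd _ hp _ hq, ?_⟩
      simp [mul_add]; abel) (by
      rintro _ ⟨p, hp, rfl⟩ a
      refine ⟨_, hmul _ hp a, ?_⟩
      simp [add_mul, mul_assoc]) (by
      rintro _ ⟨p, hpΓ, rfl⟩
      obtain ⟨p1, p2⟩ := hp p hpΓ
      simp only
      linear_combination (norm := noncomm_ring) hεs' * p.1 + hεs * p.1 + p2 - ε2 * p2 + ho * p.2) hc hc0 (by
      intro y hy
      by_contra hyc
      apply hcon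
      refine ⟨y * s, -y, fun h => hyc (by rw [asc h, zero_mul]), by rw [mul_assoc, hsh], ?_⟩
      intro p hp
      have := hy _ ⟨p, hp, rfl⟩
      simp only at this
      linear_combination (norm := noncomm_ring) this)
  simp only at hcg hg0
  have hb' : b' = 0 := by
    have := (hp _ hg).2
    simp only at this
    linear_combination (norm := noncomm_ring) -ε * hcg + hεs' * star s * (s * x' + b') - hεs' * x' - this
  subst hb'
  have := h0 _ hg
  subst this
  simp at hg0

theorem AWG.good_ab {ε : A} (hε : IsProjection ε)
    (hab : ∀ d, IsProjection d → ε * d = d → ∀ a, d * a * (ε - d) = 0) : Good ε := by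
  intro h hh hh0 Γ hadd hmul h0 hp
  by_cases hall : ∀ p ∈ Γ, p.1 = 0
  · exact ⟨h, 0, hh0, hh.2, fun p hp => by rw [hall p hp]; simp⟩
  push Not at hall
  obtain ⟨⟨x, b⟩, hxb, hx⟩ := hall
  simp only at hx
  have hX : x * star b ≠ 0 := fun h => hx (by
    simpa using hA.cancR hmul h0 hxb (y := 1) (y' := 0) (by simpa using h))
  have hεb : ε * b = b := (hp _ hxb).2
  have hhx : h * x = x := (hp _ hxb).1
  have hxh : star x * h = star x := by simpa [hh.1] using congrArg star hhx
  have pr : ∀ a : A, a * star a = 0 → a = 0 := fun a h => by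
    simpa using hA.proper (star a) (by simpa using h)
  obtain ⟨d, a', hd, hda, hXd⟩ : ∃ d a', IsProjection d ∧ d = b * star b * a' ∧ x * star b * d ≠ 0 := by
    by_contra hcon
    apply hX
    have h1 := hA.T0 (y := x * star b) (a := b * star b) fun d a hd hda => by
      by_contra h0
      exact hcon ⟨d, a, hd, hda, h0⟩
    have h2 : x * star b * b = 0 := pr _ (by
      simp only [star_mul, star_star]
      linear_combination (norm := noncomm_ring) h1 * b * star x)
    exact pr _ (by
      simp only [star_mul, star_star]
      linear_combination (norm := noncomm_ring) h2 * star x)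
  have hεd : ε * d = d := by rw [hda, mul_assoc b, asc hεb]
  have hdε := hd.flip hε hεd
  have hcomm : ∀ m, ε * m = m → m * ε = m → d * m = m * d := by
    intro m h1 h2
    have e1 := hab d hd hεd m
    have e2 := congrArg star (hab d hd hεd (star m))
    simp only [star_mul, star_sub, star_star, hε.1, hd.1, star_zero] at e2
    linear_combination (norm := noncomm_ring) e1 - d * h2 + h1 * d - e2
  have htd : (x * (star b * a'), d) ∈ Γ := by
    have := hmul _ hxb (star b * a')
    simp only [← mul_assoc] at this
    rw [← hda] at this
    rwa [← mul_assoc]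
  refine ⟨d * (b * star x), b * star x * (x * (star b * a')), ?_, by rw [mul_assoc, mul_assoc, hxh], ?_⟩
  · intro h
    apply hXd
    have := congrArg star h
    simpa [hd.1] using this
  rintro ⟨x1, b1⟩ hx1
  simp only
  have hεb1 : ε * b1 = b1 := (hp _ hx1).2
  have hbε1 : star b1 * ε = star b1 := by simpa [hε.1] using congrArg star hεb1
  have hk : d * (b1 * star b1) = b1 * star b1 * d := hcomm _ (by rw [asc hεb1]) (by rw [mul_assoc, hbε1])
  have ht : x * (star b * a') * (b1 * star b1) - x1 * star b1 * d = 0 := h0 _ (by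
    have h1 := hmul _ htd (b1 * star b1)
    have h2 := hmul _ hx1 (star b1 * d * (-1))
    have := hadd _ h1 _ h2
    simp only [Prod.mk_add_mk] at this
    have e1 : d * (b1 * star b1) + b1 * (star b1 * d * (-1)) = 0 := by
      linear_combination (norm := noncomm_ring) hk
    rw [e1] at this
    convert this using 2
    noncomm_ring)
  have hc2 := hcomm (b * star x * x1 * star b1) (by
    linear_combination (norm := noncomm_ring) hεb * star x * x1 * star b1) (by rw [mul_assoc, hbε1])
  have := hA.cancR hmul h0 hx1 (y := d * (b * star x)) (y' := - (b * star x * (x * (star b * a')))) (by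
    linear_combination (norm := noncomm_ring) hc2 - b * star x * ht)
  linear_combination (norm := noncomm_ring) this
end


section
variable {A : Type u} [Ring A] [StarRing A]
variable (hA : AWG A)
include hA

theorem AWG.halve {p : A} (hp : IsProjection p) : ∃ w a, IsProjection (star w * w) ∧ w * w = 0 ∧
    p * w = w ∧ w * p = w ∧ IsProjection a ∧ a = p - star w * w - w * star w ∧
    ∀ d, IsProjection d → a * d = d → ∀ x, d * x * (a - d) = 0 := by
  obtain ⟨m, ⟨hm, hmm, hpm, hmp⟩, hmax⟩ := hA.zornPI (fun w => IsProjection (star w * w) ∧ w * w = 0 ∧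
      p * w = w ∧ w * p = w) (fun w h => h.1) (by
    intro W hW hch
    have hww : ∀ w ∈ W, ∀ w' ∈ W, w' * w = 0 := by
      intro w hw w' hw'
      have h1 := (hW w hw).2.1
      have h2 := (hW w' hw').2.1
      rcases hch w hw w' hw' with h | h
      · rw [← h, ← mul_assoc, h2, zero_mul]
      · have h3 := hA.dom_le (hW w' hw').1 (hW w hw).1 h
        have h4 := (hW w' hw').1.flip (hW w hw).1 h3
        have h5 := hA.pi (hW w' hw').1
        linear_combination (norm := noncomm_ring) -h5 * w - w' * h4 * w + w' * (star w' * w' * star w) * h1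
    have ha := hA.L_proj ((fun w => star w * w) '' W)
    have hb := hA.L_proj ((fun w => w * star w) '' W)
    have hba : hA.L ((fun w => w * star w) '' W) * hA.L ((fun w => star w * w) '' W) = 0 := by
      apply hA.L_zero
      rintro _ ⟨w, hw, rfl⟩
      apply hb.flip0 (hW w hw).1
      apply hA.L_zero
      rintro _ ⟨w', hw', rfl⟩
      simp only
      linear_combination (norm := noncomm_ring) star w * hww w' hw' w hw * star w'
    have hab := ha.flip0 hb hba
    have hL1 : ∀ w ∈ W, star w * w ∈ ((fun w => star w * w) '' W) := fun w hw => ⟨w, hw, rfl⟩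
    have hL2 : ∀ w ∈ W, w * star w ∈ ((fun w => w * star w) '' W) := fun w hw => ⟨w, hw, rfl⟩
    have pa : p * hA.L ((fun w => star w * w) '' W) = hA.L ((fun w => star w * w) '' W) := by
      apply hA.L_le
      rintro _ ⟨w, hw, rfl⟩
      have : p * star w = star w := by simpa [hp.1] using congrArg star (hW w hw).2.2.2
      simp only
      rw [asc this]
    have pb : p * hA.L ((fun w => w * star w) '' W) = hA.L ((fun w => w * star w) '' W) := by
      apply hA.L_le
      rintro _ ⟨w, hw, rfl⟩
      simp only
      rw [asc (hW w hw).2.2.1]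
    obtain ⟨v, h1, h2, h3, h4, h5⟩ := hA.T2 ha hb hba W (fun w hw => ⟨(hW w hw).1, by
        have := hA.L_mul (hL2 w hw)
        have h6 := hA.pi (hW w hw).1
        linear_combination (norm := noncomm_ring) this * w - hA.L ((fun w => w * star w) '' W) * h6 + h6, by
        have h7 := (hW w hw).1.flip ha (hA.L_mul (hL1 w hw))
        have h6 := hA.pi (hW w hw).1
        linear_combination (norm := noncomm_ring) w * h7 - h6 * hA.L ((fun w => star w * w) '' W) + h6⟩)
      (fun w hw w' hw' => comp_chain (hch w hw w' hw'))
    refine ⟨v, ⟨by rw [h1]; exact ha, ?_, ?_, ?_⟩, h3⟩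
    · rw [← h5, ← h4]
      linear_combination (norm := noncomm_ring) hA.L ((fun w => w * star w) '' W) * v * hab * v * hA.L ((fun w => star w * w) '' W)
    · rw [← h4, asc pb]
    · rw [← h5, mul_assoc, ha.flip hp pa])
  have hmm' : star m * star m = 0 := by simpa using congrArg star hmm
  have hpm' : star m * p = star m := by simpa [hp.1] using congrArg star hpm
  have hmp' : p * star m = star m := by simpa [hp.1] using congrArg star hmp
  have hpi := hA.pi hm
  have he' := hA.pi_proj hm
  have hpi' := hA.pi_star hm
  obtain ⟨a, ha⟩ : ∃ a, a = p - star m * m - m * star m := ⟨_, rfl⟩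
  have hap : IsProjection a := by
    rw [ha]
    refine he'.sub (hm.sub hp (by rw [asc hmp'])) ?_
    linear_combination (norm := noncomm_ring) hpm * star m - star m * hmm * star m
  have am : a * m = 0 := by
    rw [ha]
    linear_combination (norm := noncomm_ring) hpm - star m * hmm - hpi
  have am' : a * star m = 0 := by
    rw [ha]
    linear_combination (norm := noncomm_ring) hmp' - m * hmm' - hpi'
  have ma : m * a = 0 := by simpa [hap.1] using congrArg star am'
  have ma' : star m * a = 0 := by simpa [hap.1] using congrArg star am
  have pa : p * a = a := by
    rw [ha]
    linear_combination (norm := noncomm_ring) hp.2 - hmp' * m - hpm * star m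
  refine ⟨m, a, hm, hmm, hpm, hmp, hap, ha, ?_⟩
  intro d hd had x
  by_contra hne
  have hda := hd.flip hap had
  have hd2 := hd.2
  have hadp := hd.sub hap had
  obtain ⟨b0, s1, s2, s3⟩ := hA.pex hne
  have s4 := s3 (a - d) hadp.1 (by rw [mul_assoc, hadp.2])
  have s5 : d * (d * x * (a - d) * b0) = d * x * (a - d) * b0 := by
    linear_combination (norm := noncomm_ring) hd2 * x * (a - d) * b0
  generalize d * x * (a - d) * b0 = s at *
  have as : a * s = s := by rw [← s5, asc had]
  have sa : s * a = s := by
    rw [← s4]; linear_combination (norm := noncomm_ring) s * hap.2 - s * hda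
  obtain ⟨b1, b2, b3, b4⟩ := hA.ext_add hm s1 (by rw [← as, asc ma', zero_mul])
    (by rw [← sa, mul_assoc, am', mul_zero])
  have := hmax (m + s) ⟨b3, by
    linear_combination (norm := noncomm_ring) hmm + ma * s - m * as + s * am - sa * m - s4 * s + s * had * s - s * a * s5, by
    rw [mul_add, hpm, ← as, asc pa], by
    rw [add_mul, hmp, ← sa, mul_assoc, hap.flip hp pa]⟩ b4
  exact s2 (by simpa using this)

theorem AWG.quarter {z w : A} (hz : Finf z) (hw : IsProjection (star w * w)) (hww : w * w = 0)
    (hzw : z * w = w) (hze : z * (star w * w) = star w * w) (F : A → Prop)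
    (hF : ∀ p, IsProjection p → Good p → F p)
    (hFa : ∀ p q, IsProjection p → IsProjection q → q * p = 0 → F p → F q → F (p + q)) :
    F (star w * w) := by
  obtain ⟨v, a, v1, v2, v3, v4, v5, v6, v7⟩ := hA.halve hw
  have v8 := hA.pi_proj v1
  have v2' : star v * star v = 0 := by simpa using congrArg star v2
  have o : v * star v * (star v * v) = 0 := by
    linear_combination (norm := noncomm_ring) v * v2' * v
  have hs := v1.add v8 o
  have v3' : star v * (star w * w) = star v := by simpa [mul_assoc] using congrArg star v3
  have v4' : (star w * w) * star v = star v := by simpa using congrArg star v4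
  have hs2 : star w * w * (star v * v + v * star v) = star v * v + v * star v := by
    rw [mul_add, asc v4', asc v3]
  have rm : Room z (star v * v + v * star v) (w * (star v * v + v * star v)) := by
    refine ⟨hs, ?_, ?_, ?_, ?_⟩
    · rw [star_mul, hs.1]
      have := hs.2
      linear_combination (norm := noncomm_ring) (star v * v + v * star v) * hs2 + this
    · have e := hs.flip hw hs2
      linear_combination (norm := noncomm_ring) - e * w * (star v * v + v * star v) + (star v * v + v * star v) * star w * hww * (star v * v + v * star v)
    · rw [← hs2, asc hze]
    · rw [asc hzw]
  have g1 : Good (star v * v) := hA.good_room hz v1 rfl rfl o rm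
  have g2 : Good (v * star v) := hA.good_room (w := star v) hz v8 (by simp) (by simp) (v1.flip0 v8 o) (by
    rw [add_comm]; exact rm)
  have g3 : Good a := hA.good_ab v5 v7
  have : star w * w = (star v * v + v * star v) + a := by rw [v6]; abel
  rw [this]
  refine hFa _ _ hs v5 ?_ (hFa _ _ v1 v8 o (hF _ v1 g1) (hF _ v8 g2)) (hF _ v5 g3)
  have := hs.2
  rw [v6]
  linear_combination (norm := noncomm_ring) hs2 - this

theorem AWG.decomp {z : A} (hz : Finf z) (hzp : IsProjection z) (F : A → Prop)
    (hF : ∀ p, IsProjection p → Good p → F p)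
    (hFa : ∀ p q, IsProjection p → IsProjection q → q * p = 0 → F p → F q → F (p + q)) :
    F z := by
  obtain ⟨v, a, v1, v2, v3, v4, v5, v6, v7⟩ := hA.halve hzp
  have v8 := hA.pi_proj v1
  have v2' : star v * star v = 0 := by simpa using congrArg star v2
  have o : v * star v * (star v * v) = 0 := by
    linear_combination (norm := noncomm_ring) v * v2' * v
  have hs := v1.add v8 o
  have v4' : z * star v = star v := by simpa [hzp.1] using congrArg star v4
  have hs2 : z * (star v * v + v * star v) = star v * v + v * star v := by
    rw [mul_add, asc v4', asc v3]
  have g1 := hA.quarter hz v1 v2 v3 (by rw [asc v4']) F hF hFa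
  have g2 := hA.quarter (w := star v) hz (by simpa using v8) v2' v4' (by rw [star_star, asc v3]) F hF hFa
  rw [star_star] at g2
  have : z = (star v * v + v * star v) + a := by rw [v6]; abel
  rw [this]
  refine hFa _ _ hs v5 ?_ (hFa _ _ v1 v8 o g1 g2) (hF _ v5 (hA.good_ab v5 v7))
  have := hs.2
  rw [v6]
  linear_combination (norm := noncomm_ring) hs2 - this
end


section
variable {A : Type u} [Ring A] [StarRing A]

def CD {n : ℕ} (M : Set (Fin n → A)) (δ : Fin n → A) : Prop :=
  (∀ x, (∀ j, δ j * x j = x j) → x ∈ M) ∨ ∃ y : Fin n → A, y ≠ 0 ∧ (∀ j, δ j * y j = y j) ∧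
    ∀ m ∈ M, (∀ j, δ j * m j = m j) → ∑ j, star (y j) * m j = 0

structure MM {n : ℕ} (M : Set (Fin n → A)) : Prop where
  add : ∀ x ∈ M, ∀ y ∈ M, x + y ∈ M
  mul : ∀ x ∈ M, ∀ a, (fun j => x j * a) ∈ M
  N : ∀ c : Fin n → A, ∃ e, IsProjection e ∧ ∀ a, (fun j => c j * a) ∈ M ↔ e * a = a

theorem sum_single_star {n : ℕ} (i : Fin n) (c : A) (m : Fin n → A) :
    ∑ j, star (Pi.single (M := fun _ => A) i c j) * m j = star c * m i := by
  rw [Finset.sum_eq_single i]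
  · simp
  · intro j _ hj; simp [hj]
  · simp

theorem sum_star_single {n : ℕ} (i : Fin n) (c : A) (m : Fin n → A) :
    ∑ j, star (m j) * (Pi.single (M := fun _ => A) i c j) = star (m i) * c := by
  rw [Finset.sum_eq_single i]
  · simp
  · intro j _ hj; simp [hj]
  · simp

variable (hA : AWG A)
include hA

theorem AWG.normalize {n : ℕ} {y : Fin n → A} (hy : y ≠ 0) : ∃ b h, IsProjection h ∧ h ≠ 0 ∧
    ∑ j, star (y j * b) * (y j * b) = h ∧ ∀ j, y j * b * h = y j * b := by
  obtain ⟨a, ha⟩ := hA.sumsq n y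
  have ha0 : a ≠ 0 := by
    rintro rfl
    apply hy
    funext i
    exact hA.sumz n y (by rw [ha]; simp) i
  obtain ⟨b, b1, b2, -⟩ := hA.pex ha0
  have hs : ∑ j, star (y j * b) * (y j * b) = star (a * b) * (a * b) := by
    have : star (a * b) * (a * b) = star b * (star a * a) * b := by rw [star_mul]; noncomm_ring
    rw [this, ← ha, Finset.mul_sum, Finset.sum_mul]
    refine Finset.sum_congr rfl fun j _ => ?_
    rw [star_mul]; noncomm_ring
  refine ⟨b, _, b1, fun h => b2 (hA.proper _ h), hs, ?_⟩
  generalize star (a * b) * (a * b) = h at *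
  intro j
  have := hA.sumz n (fun j => y j * b * (1 - h)) (by
    have : ∀ j, star (y j * b * (1 - h)) * (y j * b * (1 - h)) =
        (1 - h) * (star (y j * b) * (y j * b)) * (1 - h) := by
      intro j
      rw [star_mul _ (1 - h), star_sub, star_one, b1.1]; noncomm_ring
    simp only [this]
    rw [← Finset.sum_mul, ← Finset.mul_sum, hs, sub_mul, one_mul, b1.2, sub_self, zero_mul]) j
  linear_combination (norm := noncomm_ring) - this

theorem AWG.step {n : ℕ} {M : Set (Fin n → A)} (hM : MM M) {δ : Fin n → A}
    (hδ : ∀ j, IsProjection (δ j)) {ε : A} (hε : IsProjection ε) (hg : Good ε) (i : Fin n)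
    (ho : ε * δ i = 0) (hC : CD M δ) : CD M (Function.update δ i (δ i + ε)) := by
  have ho' := (hδ i).flip0 hε ho
  have hδi := hδ i
  have split : ∀ x : Fin n → A, (∀ j, Function.update δ i (δ i + ε) j * x j = x j) →
      (∀ j, δ j * Function.update x i (δ i * x i) j = Function.update x i (δ i * x i) j) ∧
      Function.update x i (δ i * x i) + Pi.single i (ε * x i) = x := by
    intro x hx
    constructor
    · intro j
      by_cases hj : j = i
      · subst hj; simp only [Function.update_self]; rw [asc hδi.2]
      · have := hx j
        simpa [hj] using this
    · funext j
      have := hx j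
      by_cases hj : j = i
      · subst hj; simpa [add_mul] using this
      · simp [hj]
  rcases hC with hC | ⟨y0, hy0, hy1, hy2⟩
  · obtain ⟨e, he, hN⟩ := hM.N (Pi.single i ε)
    have hN' : ∀ a, Pi.single i (ε * a) ∈ M ↔ e * a = a := by
      intro a
      rw [← hN a]
      have : (fun j => (Pi.single i ε : Fin n → A) j * a) = Pi.single i (ε * a) := by
        funext j
        by_cases hj : j = i
        · subst hj; simp
        · simp [hj]
      rw [this]
    by_cases h1 : e = 1
    · left
      intro x hx
      rw [← (split x hx).2]
      exact hM.add _ (hC _ (split x hx).1) _ ((hN' _).2 (by rw [h1, one_mul]))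
    · right
      have h2 : e * (1 - ε) = 1 - ε := by
        rw [← hN']
        apply hC
        rw [mul_sub, hε.2, mul_one, sub_self]; simp
      have h2' : (1 - ε) * e = 1 - ε := hε.compl.flip he h2
      have h3 : ε * (1 - e) = 1 - e := by
        linear_combination (norm := noncomm_ring) h2'
      refine ⟨Pi.single i (1 - e), ?_, ?_, ?_⟩
      · intro h
        apply h1
        have := congrFun h i
        simp only [Pi.single_eq_same, Pi.zero_apply] at this
        exact (sub_eq_zero.1 this).symm
      · intro j
        by_cases hj : j = i
        · subst hj
          simp only [Function.update_self, Pi.single_eq_same]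
          linear_combination (norm := noncomm_ring) h3 - δ j * h3 + ho' * (1 - e)
        · simp [hj]
      · intro m hm hmX
        rw [sum_single_star, he.compl.1]
        have h4 : e * (ε * m i) = ε * m i := by
          rw [← hN', asc hε.2]
          have h5 := hM.add _ hm _ (hM.mul _ (hC _ (split m hmX).1) (-1))
          convert h5 using 1
          funext j
          have := congrFun (split m hmX).2 j
          simp only [Pi.add_apply] at this ⊢
          linear_combination (norm := noncomm_ring) this
        linear_combination (norm := noncomm_ring) - h2 * m i - h4
  · right
    obtain ⟨b0, h, hh, hh0, hs, hyh⟩ := hA.normalize hy0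
    have hU1 : ∀ j, δ j * (y0 j * b0) = y0 j * b0 := fun j => by rw [asc (hy1 j)]
    have hU2 : ∀ m ∈ M, (∀ j, δ j * m j = m j) → ∑ j, star (y0 j * b0) * m j = 0 := by
      intro m hm hmX
      have : ∑ j, star (y0 j * b0) * m j = star b0 * ∑ j, star (y0 j) * m j := by
        rw [Finset.mul_sum]
        exact Finset.sum_congr rfl fun j _ => by rw [star_mul, mul_assoc]
      rw [this, hy2 m hm hmX, mul_zero]
    obtain ⟨U, hU⟩ : ∃ U : Fin n → A, U = fun j => y0 j * b0 := ⟨_, rfl⟩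
    have hUj : ∀ j, y0 j * b0 = U j := fun j => by rw [hU]
    simp only [hUj] at hs hyh hU1 hU2
    have hyh' : ∀ j, h * star (U j) = star (U j) := fun j => by
      simpa [hh.1] using congrArg star (hyh j)
    have hU1' : ∀ j, star (U j) * δ j = star (U j) := fun j => by
      simpa [(hδ j).1] using congrArg star (hU1 j)
    have hUε : star (U i) * ε = 0 := by
      rw [← hU1' i, mul_assoc, ho', mul_zero]
    obtain ⟨u, v, hu0, huh, huv⟩ := hg h hh hh0
      {p | ∃ x : Fin n → A, (∀ j, δ j * x j = x j) ∧ ε * p.2 = p.2 ∧ x + Pi.single i p.2 ∈ M ∧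
        p.1 = ∑ j, star (U j) * x j}
      (by
        rintro p ⟨x, x1, x2, x3, x4⟩ q ⟨y, y1, y2, y3, y4⟩
        refine ⟨x + y, fun j => by rw [Pi.add_apply, mul_add, x1, y1], by
          rw [Prod.snd_add, mul_add, x2, y2], ?_, ?_⟩
        · have := hM.add _ x3 _ y3
          rw [Prod.snd_add, Pi.single_add]
          convert this using 1
          abel
        · simp only [Prod.fst_add, Pi.add_apply, mul_add, Finset.sum_add_distrib, x4, y4])
      (by
        rintro p ⟨x, x1, x2, x3, x4⟩ a
        refine ⟨fun j => x j * a, fun j => by rw [asc (x1 j)], by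
          simp only; rw [asc x2], ?_, ?_⟩
        · have := hM.mul _ x3 a
          convert this using 1
          funext j
          by_cases hj : j = i
          · subst hj; simp [add_mul]
          · simp [hj]
        · simp only [x4, Finset.sum_mul, mul_assoc])
      (by
        rintro p ⟨x, x1, x2, x3, x4⟩
        simp only [Pi.single_zero, add_zero] at x3
        simp only at x4
        rw [x4]; exact hU2 x x3 x1)
      (by
        rintro p ⟨x, x1, x2, x3, x4⟩
        refine ⟨?_, x2⟩
        rw [x4, Finset.mul_sum]
        exact Finset.sum_congr rfl fun j _ => by rw [asc (hyh' j)])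
    refine ⟨(fun j => U j * star u) - Pi.single i (ε * star v), ?_, ?_, ?_⟩
    · intro h0
      apply hu0
      have e1 : ∑ j, star (U j) * ((fun j => U j * star u) - Pi.single i (ε * star v) : Fin n → A) j = star u := by
        simp only [Pi.sub_apply, mul_sub, Finset.sum_sub_distrib]
        rw [sum_star_single, ← mul_assoc, hUε, zero_mul, sub_zero]
        simp only [← mul_assoc]
        rw [← Finset.sum_mul, hs]
        simpa [hh.1] using congrArg star huh
      rw [h0] at e1
      simpa using e1.symm
    · intro j
      by_cases hj : j = i
      · subst hj
        have e1 : ε * U j = 0 := by simpa [hε.1] using congrArg star hUε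
        simp only [Function.update_self, Pi.sub_apply, Pi.single_eq_same]
        linear_combination (norm := noncomm_ring) hU1 j * star u + e1 * star u - ho' * star v - hε.2 * star v
      · simp only [Function.update_of_ne hj, Pi.sub_apply, Pi.single_eq_of_ne hj, sub_zero]
        rw [asc (hU1 j)]
    · intro m hm hmX
      obtain ⟨s1, s2⟩ := split m hmX
      have := huv (∑ j, star (U j) * Function.update m i (δ i * m i) j, ε * m i)
        ⟨_, s1, by simp only; rw [asc hε.2], by simp only; rw [s2]; exact hm, rfl⟩
      simp only at this
      have e1 : ∑ j, star (U j) * Function.update m i (δ i * m i) j = ∑ j, star (U j) * m j := by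
        refine Finset.sum_congr rfl fun j _ => ?_
        by_cases hj : j = i
        · subst hj; simp only [Function.update_self]; rw [asc (hU1' j)]
        · simp [hj]
      rw [e1] at this
      simp only [Pi.sub_apply, star_sub, sub_mul, Finset.sum_sub_distrib]
      rw [sum_single_star]
      simp only [star_mul, star_star, hε.1, mul_assoc]
      rw [← Finset.mul_sum, this, sub_self]

theorem AWG.CDz {n : ℕ} {M : Set (Fin n → A)} (hM : MM M) {z : A} (hz : Finf z)
    (hzp : IsProjection z) : CD M (fun _ => z) := by
  have fill := hA.decomp hz hzp (fun p => ∀ (δ : Fin n → A) (i : Fin n), (∀ j, IsProjection (δ j)) →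
      p * δ i = 0 → CD M δ → CD M (Function.update δ i (δ i + p)))
    (fun p hp hg δ i hδ ho hC => hA.step hM hδ hp hg i ho hC) (by
      intro p q hp hq hqp h1 h2 δ i hδ ho hC
      have hpq := hp.flip0 hq hqp
      have o1 : p * δ i = 0 := by
        linear_combination (norm := noncomm_ring) p * ho - hp.2 * δ i - hpq * δ i
      have o2 : q * δ i = 0 := by
        linear_combination (norm := noncomm_ring) ho - o1
      have := h2 (Function.update δ i (δ i + p)) i (by
        intro j
        by_cases hj : j = i
        · subst hj; simp only [Function.update_self]; exact (hδ j).add hp o1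
        · simp only [Function.update_of_ne hj]; exact hδ j) (by
        simp only [Function.update_self]; rw [mul_add, o2, hqp, add_zero]) (h1 δ i hδ o1 hC)
      simpa [add_assoc] using this)
  have key : ∀ S : Finset (Fin n), CD M (fun j => if j ∈ S then z else 0) := by
    intro S
    induction S using Finset.induction_on with
    | empty =>
      left
      intro x hx
      have hx0 : x = 0 := by funext j; have := hx j; simpa using this.symm
      obtain ⟨e, he, h⟩ := hM.N 0
      have := (h 0).2 (by simp)
      rw [hx0]
      convert this using 1
      funext j; simp
    | insert i S hi ih =>
      have := fill _ i (by
        intro j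
        by_cases hj : j ∈ S
        · simpa [hj] using hzp
        · simpa [hj] using IsProjection.zero) (by simp [hi]) ih
      convert this using 1
      funext j
      by_cases hj : j = i
      · subst hj; simp [hi]
      · simp [hj]
  simpa using key Finset.univ
end


section
variable {A : Type u} [Ring A] [StarRing A]
variable (hA : AWG A)
include hA

theorem AWG.pinf {n : ℕ} {M : Set (Fin n → A)} (hM : MM M)
    (hperp : ∀ y : Fin n → A, (∀ m ∈ M, ∑ j, star (y j) * m j = 0) → y = 0)
    {z v1 v2 : A} (hz : IsCentralProj z) (h1 : star v1 * v1 = z) (h2 : star v2 * v2 = z)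
    (h12 : star v1 * v2 = 0) (x : Fin n → A) : (fun j => z * x j) ∈ M := by
  obtain ⟨hzp, hzc⟩ := hz
  have h21 : star v2 * v1 = 0 := by simpa using congrArg star h12
  have z1 : z * v1 = v1 := by
    have := hA.pi (s := v1) (by rw [h1]; exact hzp)
    rwa [h1, ← hzc] at this
  have z2 : z * v2 = v2 := by
    have := hA.pi (s := v2) (by rw [h2]; exact hzp)
    rwa [h2, ← hzc] at this
  let V : ℕ → A := fun k => v1 ^ k * v2
  have hV0 : V 0 = v2 := by simp [V]
  have hVs : ∀ k, V (k + 1) = v1 * V k := fun k => by simp [V, pow_succ', mul_assoc]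
  have hsV : ∀ k, z * V k = V k := by
    intro k
    cases k with
    | zero => rw [hV0, z2]
    | succ k => rw [hVs, asc z1]
  have key : ∀ j k, star (V (j + 1)) * V (k + 1) = star (V j) * V k := by
    intro j k
    rw [hVs, hVs, star_mul]
    linear_combination (norm := noncomm_ring) star (V j) * h1 * V k + star (V j) * hsV k
  have h0 : ∀ k, star (V 0) * V (k + 1) = 0 := by
    intro k
    rw [hVs, hV0, asc h21, zero_mul]
  have h0' : ∀ k, star (V (k + 1)) * V 0 = 0 := fun k => by
    simpa using congrArg star (h0 k)
  have horth : ∀ j k, j ≠ k → star (V j) * V k = 0 := by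
    intro j
    induction j with
    | zero => intro k hk; cases k with
      | zero => exact absurd rfl hk
      | succ k => exact h0 k
    | succ j ih => intro k hk; cases k with
      | zero => exact h0' j
      | succ k => rw [key]; exact ih k (by omega)
  have hsq : ∀ k, star (V k) * V k = z := by
    intro k
    induction k with
    | zero => rw [hV0, h2]
    | succ k ih => rw [key, ih]
  have hVx : ∀ (x : Fin n → A) (i : Fin n), star (V i) * ∑ k : Fin n, V k * x k = z * x i := by
    intro x i
    rw [Finset.mul_sum, Finset.sum_eq_single i]
    · rw [asc (hsq i)]
    · intro j _ hj
      rw [asc (horth i j (fun h => hj (Fin.ext h.symm))), zero_mul]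
    · simp
  obtain ⟨e, he, hN⟩ := hM.N (fun i => star (V i))
  have hy := hperp (fun i => star (V i) * (1 - e)) (by
    intro m hm
    have e1 : e * ∑ k : Fin n, V k * m k = ∑ k : Fin n, V k * m k := by
      rw [← hN]
      simp only [hVx, hzc]
      exact hM.mul _ hm z
    have : ∑ j : Fin n, star (star (V j) * (1 - e)) * m j = (1 - e) * ∑ k : Fin n, V k * m k := by
      rw [Finset.mul_sum]
      refine Finset.sum_congr rfl fun j _ => ?_
      rw [star_mul, star_star, he.compl.1, mul_assoc]
    rw [this, sub_mul, one_mul, e1, sub_self])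
  have hVe : ∀ i : Fin n, star (V i) * e = star (V i) := by
    intro i
    have := congrFun hy i
    simp only [Pi.zero_apply] at this
    linear_combination (norm := noncomm_ring) - this
  have := (hN (e * ∑ k : Fin n, V k * x k)).2 (by rw [asc he.2])
  simp only [← mul_assoc, hVe] at this
  simpa only [hVx] using this

theorem AWG.abs {n : ℕ} {M : Set (Fin n → A)} (hM : MM M)
    (hperp : ∀ y : Fin n → A, (∀ m ∈ M, ∑ j, star (y j) * m j = 0) → y = 0) (x : Fin n → A) : x ∈ M := by
  let Z : Set A := {z | IsCentralProj z ∧ ∀ x : Fin n → A, (fun j => z * x j) ∈ M}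
  let S : Set A := {y | ∃ a, ∃ z ∈ Z, y = a * z}
  obtain ⟨hsp, hsc⟩ := hA.L_central (S := S) (by
    rintro _ ⟨a, z, hz, rfl⟩ b
    exact ⟨b * a, z, hz, by rw [mul_assoc]⟩)
  have hZs : ∀ z ∈ Z, hA.L S * z = z := fun z hz => hA.L_mul ⟨1, z, hz, by simp⟩
  have hsM : ∀ x : Fin n → A, (fun j => hA.L S * x j) ∈ M := by
    intro x
    obtain ⟨e, he, hN⟩ := hM.N x
    simp only [hsc]
    rw [hN]
    apply hA.L_le
    rintro _ ⟨a, z, hz, rfl⟩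
    have : e * z = z := by
      rw [← hN]
      simp only [← hz.1.2]
      exact hz.2 x
    rw [← hz.1.2, asc this]
  generalize hA.L S = s at *
  have hz0p := hsp.compl
  have hz0 : IsCentralProj (1 - s) := ⟨hz0p, fun a => by rw [sub_mul, mul_sub, hsc, one_mul, mul_one]⟩
  suffices h : 1 - s = 0 by
    have := hsM x
    rw [← sub_eq_zero.1 h] at this
    simpa using this
  by_contra hne
  by_cases hfin : Finf (1 - s)
  · rcases hA.CDz hM hfin hz0p with h | ⟨y, hy, hy1, hy2⟩
    · have := hZs (1 - s) ⟨hz0, fun x => h _ fun j => by rw [asc hz0p.2]⟩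
      apply hne
      rw [← this, mul_sub, mul_one, hsp.2, sub_self]
    · apply hy
      apply hperp
      intro m hm
      have := hy2 (fun j => m j * (1 - s)) (hM.mul _ hm _) (fun j => by
        rw [← mul_assoc, hz0.2, mul_assoc, hz0p.2])
      rw [← this]
      refine Finset.sum_congr rfl fun j _ => ?_
      have h2 : star (y j) * (1 - s) = star (y j) := by
        have := congrArg star (hy1 j)
        rwa [star_mul, hz0p.1] at this
      rw [← hz0.2, ← mul_assoc, h2]
  · obtain ⟨z, v1, v2, hz, hz0', hzz, e1, e2, e3⟩ := hA.PI hz0 hfin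
    have := hZs z ⟨hz, fun x => hA.pinf hM hperp hz e1 e2 e3 x⟩
    apply hz0'
    rw [← hzz, sub_mul, this, one_mul, sub_self]
end


theorem IsProjection.flip' {A : Type u} [Ring A] [StarRing A] {p q : A} (hq : IsProjection q)
    (hp : IsProjection p) (h : p * q = p) : q * p = p := by
  have := congrArg star h
  simpa [hp.1, hq.1] using this

theorem final_N {A B : Type u} [Ring A] [StarRing A] [Algebra ℂ A] [Ring B] [StarRing B] [Algebra ℂ B]
    (gA : AWG A) (hB : IsAWStarRing B) (f : A →⋆ₐ[ℂ] B)
    (hf : ∀ (ι : Type u) (p : ι → A) (s : A), (∀ i, IsProjection (p i)) →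
      IsSupProj p s → IsSupProj (fun i => f (p i)) (f s))
    {n : ℕ} (τ : Fin n → Fin n → B) (c : Fin n → A) :
    ∃ e, IsProjection e ∧ ∀ a, (∀ i, ∑ j, τ i j * f (c j * a) = 0) ↔ e * a = a := by
  obtain ⟨β, hβ⟩ : ∃ β : Fin n → B, β = fun i => ∑ j, τ i j * f (c j) := ⟨_, rfl⟩
  have hb : ∀ a, (∀ i, ∑ j, τ i j * f (c j * a) = 0) ↔ ∀ i, β i * f a = 0 := by
    intro a
    simp only [hβ, map_mul, Finset.sum_mul, mul_assoc]
  simp only [hb]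
  obtain ⟨P, hP, hPe⟩ := hB (Set.range β)
  let S : Set A := {q | IsProjection q ∧ ∀ i, β i * f q = 0}
  have he := gA.L_proj S
  have hsup := hf S (fun q => q.1) (gA.L S) (fun q => q.2.1) ⟨he, fun q =>
      q.2.1.flip he (gA.L_mul q.2), fun t ht h => he.flip ht (gA.L_le fun q hq =>
        ht.flip' hq.1 (h ⟨q, hq⟩))⟩
  have h1 := hsup.2.2 P hP (fun q => by
    have : f q.1 ∈ {a | ∀ s ∈ Set.range β, s * a = 0} := by
      rintro _ ⟨i, rfl⟩; exact q.2.2 i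
    rw [hPe] at this
    obtain ⟨b, hb⟩ := this
    have hfq : IsProjection (f q.1) := ⟨by rw [← map_star, q.2.1.1], by rw [← map_mul, q.2.1.2]⟩
    exact hfq.flip hP (by rw [hb, asc hP.2]))
  simp only [ProjLE] at h1
  have h2 : P * f (gA.L S) = f (gA.L S) := hP.flip' hsup.1 h1
  have h3 : ∀ i, β i * f (gA.L S) = 0 := by
    have : f (gA.L S) ∈ {a | ∀ s ∈ Set.range β, s * a = 0} := by
      rw [hPe]; exact ⟨_, h2.symm⟩
    exact fun i => this _ ⟨i, rfl⟩
  refine ⟨gA.L S, he, fun a => ⟨fun ha => ?_, fun ha i => ?_⟩⟩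
  · have := gA.T0 (y := 1 - gA.L S) (a := a) fun d b hd hda => by
      have hdS : d ∈ S := ⟨hd, fun i => by rw [hda, map_mul, asc (ha i), zero_mul]⟩
      rw [sub_mul, one_mul, gA.L_mul hdS, sub_self]
    rw [sub_mul, one_mul, sub_eq_zero] at this
    exact this.symm
  · rw [← ha, map_mul, asc (h3 i), zero_mul]

/-- If `f : A → B` is a unital *-homomorphism between AW*-algebras preserving
suprema of arbitrary families of projections, then the entrywise map
`Mₙ(f) : Mₙ(A) → Mₙ(B)` is a unital *-homomorphism preserving suprema of
arbitrary families of projections. -/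
theorem matrix_map_preserves_sups {A B : Type u}
    [NormedRing A] [StarRing A] [CStarRing A] [NormedAlgebra ℂ A] [StarModule ℂ A]
    [CompleteSpace A]
    [NormedRing B] [StarRing B] [CStarRing B] [NormedAlgebra ℂ B] [StarModule ℂ B]
    [CompleteSpace B]
    (hA : IsAWStarRing A) (hB : IsAWStarRing B)
    (f : A →⋆ₐ[ℂ] B)
    (hf : ∀ (ι : Type u) (p : ι → A) (s : A), (∀ i, IsProjection (p i)) →
      IsSupProj p s → IsSupProj (fun i => f (p i)) (f s))
    (n : ℕ) :
    (Matrix.map (1 : Matrix (Fin n) (Fin n) A) ⇑f = 1) ∧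
    (∀ x y : Matrix (Fin n) (Fin n) A, (x * y).map ⇑f = x.map ⇑f * y.map ⇑f) ∧
    (∀ x y : Matrix (Fin n) (Fin n) A, (x + y).map ⇑f = x.map ⇑f + y.map ⇑f) ∧
    (∀ x : Matrix (Fin n) (Fin n) A, (star x).map ⇑f = star (x.map ⇑f)) ∧
    (∀ (c : ℂ) (x : Matrix (Fin n) (Fin n) A), (c • x).map ⇑f = c • x.map ⇑f) ∧
    (∀ (ι : Type u) (p : ι → Matrix (Fin n) (Fin n) A) (s : Matrix (Fin n) (Fin n) A),
      (∀ i, IsProjection (p i)) → IsSupProj p s →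
      IsSupProj (fun i => (p i).map ⇑f) (s.map ⇑f)) := by
  have gA : AWG A := by
    let : CStarAlgebra A := {}
    exact AWG.of_cstar hA
  have hmul : ∀ x y : Matrix (Fin n) (Fin n) A, (x * y).map ⇑f = x.map ⇑f * y.map ⇑f :=
    fun x y => Matrix.map_mul
  have hsub : ∀ x y : Matrix (Fin n) (Fin n) A, (x - y).map ⇑f = x.map ⇑f - y.map ⇑f :=
    fun x y => by ext i j; simp
  have hstar : ∀ x : Matrix (Fin n) (Fin n) A, (star x).map ⇑f = star (x.map ⇑f) :=
    fun x => by ext i j; exact map_star f (x j i)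
  have hone : (Matrix.map (1 : Matrix (Fin n) (Fin n) A) ⇑f = 1) := by
    simp
  refine ⟨hone, hmul, fun x y => by ext i j; simp, hstar, fun c x => by ext i j; simp, ?_⟩
  rintro ι p s hp ⟨hs, hs1, hs2⟩
  simp only [ProjLE] at hs1 hs2
  have hfs : IsProjection (s.map ⇑f) := ⟨by rw [← hstar, hs.1], by rw [← hmul, hs.2]⟩
  refine ⟨hfs, fun i => by simp only [ProjLE]; rw [← hmul, hs1], ?_⟩
  intro t ht htp
  simp only [ProjLE] at htp ⊢
  obtain ⟨τ, hτ⟩ : ∃ τ, τ = (1 - t) * s.map ⇑f := ⟨_, rfl⟩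
  let M : Set (Fin n → A) := {x | ∀ i, ∑ j, τ i j * f (x j) = 0}
  have hMM : MM M := by
    refine ⟨?_, ?_, ?_⟩
    · intro x hx y hy i
      simp only [Pi.add_apply, map_add, mul_add, Finset.sum_add_distrib]
      rw [hx i, hy i, add_zero]
    · intro x hx a i
      simp only [map_mul, ← mul_assoc]
      rw [← Finset.sum_mul, hx i, zero_mul]
    · intro c
      exact final_N gA hB f hf (fun i j => τ i j) c
  have hcol : ∀ X : Matrix (Fin n) (Fin n) A, τ * X.map ⇑f = 0 → ∀ j, (fun k => X k j) ∈ M := by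
    intro X hX j i
    have := congrFun (congrFun hX i) j
    simpa [Matrix.mul_apply] using this
  have c1 : ∀ i, τ * (p i).map ⇑f = 0 := by
    intro i
    have hpi : IsProjection ((p i).map ⇑f) := ⟨by rw [← hstar, (hp i).1], by rw [← hmul, (hp i).2]⟩
    have e1 : t * (p i).map ⇑f = (p i).map ⇑f := ht.flip' hpi (htp i)
    have e2 : s * p i = p i := hs.flip' (hp i) (hs1 i)
    rw [hτ, mul_assoc, ← hmul, e2, sub_mul, one_mul, e1, sub_self]
  have c2 : τ * (1 - s).map ⇑f = 0 := by
    rw [hτ, hsub, hone, mul_assoc, mul_sub, mul_one, hfs.2, sub_self, mul_zero]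
  have hperp : ∀ y : Fin n → A, (∀ m ∈ M, ∑ j, star (y j) * m j = 0) → y = 0 := by
    intro y hy
    by_contra hy0
    obtain ⟨b, h, hh, hh0, hsum, hyh⟩ := gA.normalize hy0
    let P : Matrix (Fin n) (Fin n) A := fun i j => (y i * b) * star (y j * b)
    have hP : IsProjection P := by
      constructor
      · ext i j
        rw [Matrix.star_apply]
        simp only [P, star_mul, star_star]
      · ext i j
        rw [Matrix.mul_apply]
        have : ∀ k, P i k * P k j = y i * b * (star (y k * b) * (y k * b)) * star (y j * b) := by
          intro k; simp only [P]; noncomm_ring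
        simp only [this]
        rw [← Finset.sum_mul, ← Finset.mul_sum, hsum, hyh]
    have hPX : ∀ X : Matrix (Fin n) (Fin n) A, τ * X.map ⇑f = 0 → P * X = 0 := by
      intro X hX
      ext i j
      rw [Matrix.mul_apply, Matrix.zero_apply]
      have e1 := hy _ (hcol X hX j)
      have : ∀ k, P i k * X k j = y i * b * star b * (star (y k) * X k j) := by
        intro k; simp only [P, star_mul]; noncomm_ring
      simp only [this]
      rw [← Finset.mul_sum, e1, mul_zero]
    have e1 := hPX _ c2
    have e2 : P * s = P := by
      rw [mul_sub, mul_one, sub_eq_zero] at e1; exact e1.symm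
    have e3 : s * P = P := hs.flip' hP e2
    have e4 := hs2 (s - P) (hP.sub hs e3) (fun i => by
      rw [mul_sub, hs1, (hp i).flip0 hP (hPX _ (c1 i)), sub_zero])
    rw [mul_sub, hs.2, e3, sub_eq_self] at e4
    apply hh0
    rw [← hsum]
    refine Finset.sum_eq_zero fun j _ => ?_
    have e5 : y j * b * star (y j * b) = 0 := congrFun (congrFun e4 j) j
    have e6 := gA.proper (star (y j * b)) (by rw [star_star]; exact e5)
    rw [e6, zero_mul]
  have hall := gA.abs hMM hperp
  have hτ0 : τ = 0 := by
    ext i j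
    have := hall (Pi.single j 1) i
    rw [Finset.sum_eq_single j] at this
    · simpa using this
    · intro k _ hk; simp [hk]
    · simp
  rw [hτ0, sub_mul, one_mul] at hτ
  exact hfs.flip ht (sub_eq_zero.1 hτ.symm).symm
end
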